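/- Let (X_n) be a regular sequence of compact length surfaces, each with q > 0 boundary components and reduced connectivity number c, converging in the Gromov-Hausdorff sense to a compact metric space X, such that the boundaries (∂X_n) converge to a subset ∂∞X of X. If b is a connected component of ∂∞X and x, y, z ∈ b are such that z separates x and y in b, then z separates x and y in X. -/

import Mathlib

open Filter Topology Metric Set GromovHausdorff
open scoped ENNReal unitInterval

noncomputable section

/-! ## Model spaces -/

/-- The closed upper half plane in `ℝ × ℝ` (used for topological charts). -/
def HalfPlane : Set (ℝ × ℝ) := {p | 0 ≤ p.2}

/-- The closed upper half plane in the Euclidean plane (used for metric charts). -/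
def EHalfPlane : Set (EuclideanSpace ℝ (Fin 2)) := {p | 0 ≤ p 1}

/-- The unit circle (the 1-sphere). -/
def Circle1 : Set (EuclideanSpace ℝ (Fin 2)) := Metric.sphere 0 1

/-- The 2-sphere. -/
def Sphere2 : Set (EuclideanSpace ℝ (Fin 3)) := Metric.sphere 0 1

/-- The closed 2-disc. -/
def Disc2 : Set (EuclideanSpace ℝ (Fin 2)) := Metric.closedBall 0 1

/-- The relation on the unit square generating the Möbius identification
`(0, y) ∼ (1, 1 - y)`. -/
def mobiusRel (p q : I × I) : Prop :=
  ((p.1 : ℝ) = 0 ∧ (q.1 : ℝ) = 1 ∧ (p.2 : ℝ) = 1 - (q.2 : ℝ)) ∨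
  ((p.1 : ℝ) = 1 ∧ (q.1 : ℝ) = 0 ∧ (p.2 : ℝ) = 1 - (q.2 : ℝ))

/-- The Möbius band, as a quotient of the unit square. -/
def MobiusBand : Type := Quot mobiusRel

instance : TopologicalSpace MobiusBand :=
  inferInstanceAs (TopologicalSpace (Quot mobiusRel))

/-! ## Surfaces -/

/-- A topological 2-manifold with (possibly empty) boundary: every point has an open
neighborhood homeomorphic to an open subset of the closed half plane. -/
def IsSurface (X : Type*) [TopologicalSpace X] : Prop :=
  ∀ x : X, ∃ (U : Set X) (V : Set HalfPlane),
    IsOpen U ∧ x ∈ U ∧ IsOpen V ∧ Nonempty (↥U ≃ₜ ↥V)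

/-- A compact surface: a compact connected (Hausdorff) topological 2-manifold with
possibly empty boundary. -/
def IsCompactSurface (X : Type*) [TopologicalSpace X] : Prop :=
  CompactSpace X ∧ ConnectedSpace X ∧ T2Space X ∧ IsSurface X

/-- The (manifold) boundary of a surface: the set of points having no open neighborhood
homeomorphic to an open subset of the plane. -/
def surfaceBoundary (X : Type*) [TopologicalSpace X] : Set X :=
  {x | ¬ ∃ (U : Set X) (V : Set (ℝ × ℝ)), IsOpen U ∧ x ∈ U ∧ IsOpen V ∧ Nonempty (↥U ≃ₜ ↥V)}

/-- The set of boundary components of a surface, i.e. the connected components of the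
boundary. -/
def surfaceBoundaryComponents (X : Type*) [TopologicalSpace X] : Set (Set X) :=
  {b | ∃ x ∈ surfaceBoundary X, b = connectedComponentIn (surfaceBoundary X) x}

/-- A surface is orientable iff it contains no subset homeomorphic to the Möbius band. -/
def SurfOrientable (X : Type*) [TopologicalSpace X] : Prop :=
  ¬ ∃ A : Set X, Nonempty (↥A ≃ₜ MobiusBand)

/-- The free rank of the first homology (the abelianized fundamental group). -/
noncomputable def h1Rank (X : Type*) [TopologicalSpace X] : ℕ :=
  ⨆ x : X, (Module.rank ℤ (Additive (Abelianization (FundamentalGroup X x)))).toNat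

open Classical in
/-- The connectivity number of a compact surface `S`, i.e. `2 - χ(S)`.  By the
classification of compact surfaces this equals the free rank of the first homology,
plus one unless the surface is closed and orientable. -/
noncomputable def connNum (X : Type*) [TopologicalSpace X] : ℕ :=
  h1Rank X + (if surfaceBoundary X = ∅ ∧ SurfOrientable X then 0 else 1)

/-- The reduced connectivity number: the connectivity number minus the number of
boundary components. -/
noncomputable def redConnNum (X : Type*) [TopologicalSpace X] : ℤ :=
  (connNum X : ℤ) - ((surfaceBoundaryComponents X).ncard : ℤ)

/-! ## Length and geodesic spaces -/

/-- The length of a path, as the total variation of the parametrization. -/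
noncomputable def pathLength {X : Type*} [MetricSpace X] {x y : X} (γ : Path x y) : ℝ≥0∞ :=
  eVariationOn (fun t => γ t) Set.univ

/-- A metric space is a length space if the distance between any two points is the
infimum of the lengths of paths joining them. -/
def IsLengthSpace (X : Type*) [MetricSpace X] : Prop :=
  ∀ x y : X, edist x y = ⨅ γ : Path x y, pathLength γ

/-- A metric space is geodesic if any two points are joined by a path whose length
realizes the distance. -/
def IsGeodesicSpace (X : Type*) [MetricSpace X] : Prop :=
  ∀ x y : X, ∃ γ : Path x y, pathLength γ = edist x y

/-! ## Peano spaces, Jordan curves and cyclic elements -/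

/-- A Peano space: a compact connected locally connected metric space. -/
def IsPeano (X : Type*) [MetricSpace X] : Prop :=
  CompactSpace X ∧ ConnectedSpace X ∧ LocallyConnectedSpace X

/-- A Jordan curve: a subset homeomorphic to the 1-sphere. -/
def IsJordanCurve {X : Type*} [TopologicalSpace X] (J : Set X) : Prop :=
  Nonempty (↥J ≃ₜ ↥Circle1)

/-- A set is cyclicly connected if every pair of distinct points of it lies on a common
Jordan curve contained in it. -/
def CycliclyConnected {X : Type*} [TopologicalSpace X] (A : Set X) : Prop :=
  ∀ x ∈ A, ∀ y ∈ A, x ≠ y → ∃ J : Set X, J ⊆ A ∧ IsJordanCurve J ∧ x ∈ J ∧ y ∈ J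

/-- A maximal cyclic subset: a nondegenerate cyclicly connected subset which is not a
proper subset of any cyclicly connected subset. -/
def IsMaximalCyclic {X : Type*} [TopologicalSpace X] (A : Set X) : Prop :=
  A.Nontrivial ∧ CycliclyConnected A ∧ ∀ B : Set X, CycliclyConnected B → A ⊆ B → A = B

/-- A subcontinuum: a compact connected (hence nonempty) subset. -/
def IsSubcontinuum {X : Type*} [TopologicalSpace X] (C : Set X) : Prop :=
  IsCompact C ∧ IsConnected C

/-- `b` is a boundary component of the subset `T` (viewed as a subspace). -/
def IsBoundaryComponentOf {X : Type*} [TopologicalSpace X] (T b : Set X) : Prop :=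
  ∃ b' ∈ surfaceBoundaryComponents ↥T, b = Subtype.val '' b'

/-- An admissible subcontinuum: it meets every maximal cyclic subset `T` in at most a
point or in a boundary component of `T`. -/
def IsAdmissible {X : Type*} [TopologicalSpace X] (C : Set X) : Prop :=
  IsSubcontinuum C ∧
    ∀ T : Set X, IsMaximalCyclic T →
      ((T ∩ C).Subsingleton ∨ IsBoundaryComponentOf T (T ∩ C))

/-- A 1-cactoid: a Peano space all of whose maximal cyclic subsets are homeomorphic to
the 1-sphere. -/
def IsOneCactoid (X : Type*) [MetricSpace X] : Prop :=
  IsPeano X ∧ ∀ T : Set X, IsMaximalCyclic T → Nonempty (↥T ≃ₜ ↥Circle1)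

/-- A subset homeomorphic to the 2-sphere or the closed 2-disc. -/
def SphereOrDisc {X : Type*} [TopologicalSpace X] (T : Set X) : Prop :=
  Nonempty (↥T ≃ₜ ↥Sphere2) ∨ Nonempty (↥T ≃ₜ ↥Disc2)

/-! ## Generalized cactoids -/

/-- A generalized cactoid. -/
def IsGeneralizedCactoid (X : Type*) [MetricSpace X] : Prop :=
  IsPeano X ∧ (∀ T : Set X, IsMaximalCyclic T → IsCompactSurface ↥T) ∧
  {T : Set X | IsMaximalCyclic T ∧ ¬ SphereOrDisc T}.Finite ∧
  ∃ (n : ℕ) (C : Fin n → Set X),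
    (∀ i, IsAdmissible (C i)) ∧ (Pairwise fun i j => Disjoint (C i) (C j)) ∧
    ∀ T b : Set X, IsMaximalCyclic T → IsBoundaryComponentOf T b → b ⊆ ⋃ i, C i

/-- A pre-boundary consisting of `n` disjoint admissible subcontinua, each containing a
boundary component of some maximal cyclic subset, which together cover all boundary
components of all maximal cyclic subsets. -/
def IsPreBoundaryOfSize {X : Type*} [TopologicalSpace X] (n : ℕ) (P : Set X) : Prop :=
  ∃ C : Fin n → Set X,
    (∀ i, IsAdmissible (C i)) ∧ (Pairwise fun i j => Disjoint (C i) (C j)) ∧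
    (∀ i, ∃ T b : Set X, IsMaximalCyclic T ∧ IsBoundaryComponentOf T b ∧ b ⊆ C i) ∧
    (∀ T b : Set X, IsMaximalCyclic T → IsBoundaryComponentOf T b → b ⊆ ⋃ i, C i) ∧
    P = ⋃ i, C i

def IsPreBoundary {X : Type*} [TopologicalSpace X] (P : Set X) : Prop :=
  ∃ n, IsPreBoundaryOfSize n P

/-- A minimal pre-boundary: one with the minimal possible number of pieces. -/
def IsMinimalPreBoundary {X : Type*} [TopologicalSpace X] (P : Set X) : Prop :=
  ∃ n, IsPreBoundaryOfSize n P ∧ ∀ (m : ℕ) (Q : Set X), IsPreBoundaryOfSize m Q → n ≤ m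

/-- The boundary of a generalized cactoid: the union of all minimal pre-boundaries. -/
def cactoidBoundary (X : Type*) [TopologicalSpace X] : Set X :=
  ⋃₀ {P : Set X | IsMinimalPreBoundary P}

/-- The boundary components of a generalized cactoid: the connected components of its
boundary. -/
def cactoidBoundaryComponents (X : Type*) [TopologicalSpace X] : Set (Set X) :=
  {b | ∃ x ∈ cactoidBoundary X, b = connectedComponentIn (cactoidBoundary X) x}

/-- The connectivity number of a generalized cactoid: the sum of the reduced
connectivity numbers of its maximal cyclic subsets plus the number of its boundary
components. -/
noncomputable def cactoidConnNum (X : Type*) [TopologicalSpace X] : ℤ :=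
  (∑ᶠ T ∈ {T : Set X | IsMaximalCyclic T}, redConnNum ↥T) +
    ((cactoidBoundaryComponents X).ncard : ℤ)

/-! ## Bundled spaces -/

structure BundledMet where
  carrier : Type
  [str : MetricSpace carrier]

attribute [instance] BundledMet.str

structure BundledTop where
  carrier : Type
  [str : TopologicalSpace carrier]

attribute [instance] BundledTop.str

/-! ## Metric two-point identifications -/

/-- `p : A → B` is (the projection of) a metric 2-point identification: it glues exactly
two distinct points `x₁, x₂` of `A` and carries the corresponding quotient metric. -/
def IsTwoPointIdentification {A B : Type*} [MetricSpace A] [MetricSpace B] (p : A → B) : Prop :=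
  Function.Surjective p ∧ ∃ x₁ x₂ : A, x₁ ≠ x₂ ∧
    (∀ a b : A, p a = p b ↔ (a = b ∨ (a = x₁ ∧ b = x₂) ∨ (a = x₂ ∧ b = x₁))) ∧
    ∀ a b : A, dist (p a) (p b) =
      min (dist a b) (min (dist a x₁ + dist x₂ b) (dist a x₂ + dist x₁ b))

/-- `Y` is obtained from `X` by a successive application of `k` metric 2-point
identifications, exactly `k₀` of which are boundary identifications with respect to the
subset `B ⊆ X`. -/
def ObtainedByIdentifications (X : Type) [MetricSpace X] (B : Set X) (k k0 : ℕ)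
    (Y : Type) [MetricSpace Y] : Prop :=
  ∃ (Z : ℕ → BundledMet) (p : ∀ i : ℕ, (Z i).carrier → (Z (i + 1)).carrier)
    (e : X ≃ᵢ (Z 0).carrier) (f : (Z k).carrier ≃ᵢ Y) (q : ∀ i : ℕ, X → (Z i).carrier),
    (∀ i, i < k → IsTwoPointIdentification (p i)) ∧
    (∀ x, q 0 x = e x) ∧ (∀ i x, q (i + 1) x = p i (q i x)) ∧
    {i : ℕ | i < k ∧ ∃ a b : (Z i).carrier,
        a ∈ q i '' B ∧ b ∈ q i '' B ∧ a ≠ b ∧ p i a = p i b}.ncard = k0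

/-! ## Gromov–Hausdorff sequences of surfaces -/

/-- A sequence of (isometry classes of) compact length surfaces with connectivity
number `c`. -/
def IsSurfaceGHSeq (c : ℕ) (K : ℕ → GHSpace) : Prop :=
  ∀ n, IsCompactSurface (K n).Rep ∧ IsLengthSpace (K n).Rep ∧ connNum (K n).Rep = c

/-- The structural description of the limit spaces in the Main Theorem: `X` is obtained
from a geodesic generalized cactoid `Y` by `k` successive metric 2-point
identifications, `k₀` of them boundary identifications, where the connectivity number
of `Y` is at most `c + k₀ - 2k`. -/
def MainThmRHS (c : ℕ) (X : Type) [MetricSpace X] : Prop :=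
  ∃ (k k0 : ℕ) (Y : BundledMet),
    IsGeneralizedCactoid Y.carrier ∧ IsGeodesicSpace Y.carrier ∧
    ObtainedByIdentifications Y.carrier (cactoidBoundary Y.carrier) k k0 X ∧
    cactoidConnNum Y.carrier ≤ (c : ℤ) + (k0 : ℤ) - 2 * (k : ℤ)

/-! ## Covering dimension -/

/-- `X` has covering dimension at most `n`: every open cover admits an open refinement
of order at most `n + 1`. -/
def CoveringDimLE (X : Type*) [TopologicalSpace X] (n : ℕ) : Prop :=
  ∀ U : Set (Set X), (∀ u ∈ U, IsOpen u) → ⋃₀ U = Set.univ →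
    ∃ V : Set (Set X), (∀ v ∈ V, IsOpen v) ∧ ⋃₀ V = Set.univ ∧
      (∀ v ∈ V, ∃ u ∈ U, v ⊆ u) ∧
      ∀ x : X, {v | v ∈ V ∧ x ∈ v}.encard ≤ (n : ℕ∞) + 1

/-! ## Curves in surfaces -/

/-- A continuous map from the circle is nullhomotopic if it is homotopic to a constant. -/
def IsNullhomotopic {X : Type*} [TopologicalSpace X] (f : C(↥Circle1, X)) : Prop :=
  ∃ y : X, f.Homotopic (ContinuousMap.const _ y)

/-- A contractible Jordan curve. -/
def IsContractibleJordanCurve {X : Type*} [TopologicalSpace X] (J : Set X) : Prop :=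
  IsJordanCurve J ∧
    ∀ f : C(↥Circle1, X), Function.Injective f → Set.range f = J → IsNullhomotopic f

/-- A non-contractible Jordan curve. -/
def IsNonContractibleJordanCurve {X : Type*} [TopologicalSpace X] (J : Set X) : Prop :=
  IsJordanCurve J ∧
    ∀ f : C(↥Circle1, X), Function.Injective f → Set.range f = J → ¬ IsNullhomotopic f

/-- A simple arc in a surface: an injective path whose endpoints lie on the boundary and
whose interior does not. -/
def IsSimpleArc {X : Type*} [TopologicalSpace X] (γ : C(I, X)) : Prop :=
  Function.Injective γ ∧ γ 0 ∈ surfaceBoundary X ∧ γ 1 ∈ surfaceBoundary X ∧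
    ∀ t : I, t ≠ 0 → t ≠ 1 → γ t ∉ surfaceBoundary X

/-- A subset separates the space if its complement is disconnected. -/
def SeparatesSpace {X : Type*} [TopologicalSpace X] (A : Set X) : Prop :=
  ¬ IsPreconnected Aᶜ

/-- The arc `γ` forms a contractible Jordan curve together with a subarc of some
boundary component. -/
def FormsContractibleJordanWithBoundary {X : Type*} [TopologicalSpace X]
    (γ : C(I, X)) : Prop :=
  ∃ β : C(I, X), Function.Injective β ∧ Set.range β ⊆ surfaceBoundary X ∧
    β 0 = γ 0 ∧ β 1 = γ 1 ∧ IsContractibleJordanCurve (Set.range γ ∪ Set.range β)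

/-- `z` separates `x` and `y` inside the subset `A`: both lie in `A \ {z}` and no
connected subset of `A \ {z}` contains both. -/
def SeparatesIn {X : Type*} [TopologicalSpace X] (A : Set X) (z x y : X) : Prop :=
  x ∈ A \ {z} ∧ y ∈ A \ {z} ∧
    ∀ C : Set X, C ⊆ A \ {z} → IsPreconnected C → ¬ (x ∈ C ∧ y ∈ C)

/-! ## Metric doubles -/

/-- `D` together with the two canonical maps `ip, im : X → D` is the metric double of
`X` along the subset `B`. -/
structure IsMetricDouble (X : Type*) [MetricSpace X] (B : Set X) (D : Type*)
    [MetricSpace D] (ip im : X → D) : Prop where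
  isom_p : Isometry ip
  isom_m : Isometry im
  surj : Set.range ip ∪ Set.range im = Set.univ
  agree : ∀ z ∈ B, ip z = im z
  dist_mix : ∀ a b : X, dist (ip a) (im b) = ⨅ z : ↥B, (dist a (z : X) + dist (z : X) b)

/-- Regularity of a sequence of doubles: there is no sequence of non-contractible
Jordan curves in the doubles with vanishing diameters. -/
def RegularDoubleSeq (D : ℕ → Type) [∀ n, MetricSpace (D n)] : Prop :=
  ∀ J : ∀ n, Set (D n), (∀ n, IsNonContractibleJordanCurve (J n)) →
    0 < ⨅ n, Metric.diam (J n)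

/-- The copy `A^+` (or `A^-`) in the double limit corresponding to a subset `A` of the
limit `X`, via the isometric identification `j` of `X` with `X^+` (resp. `X^-`). -/
def plusCopy {Z D : Type*} {X : Set Z} {Xp : Set D} (j : ↥X → ↥Xp) (A : Set Z) :
    Set D :=
  (fun x => ((j x : ↥Xp) : D)) '' {x : ↥X | (x : Z) ∈ A}

/-! ## Riemannian and polyhedral surfaces -/

/-- The Riemannian length integrand `√(g_{γ(t)}(γ'(t), γ'(t)))`. -/
noncomputable def riemLengthIntegrand (g : (ℝ × ℝ) → (ℝ × ℝ) → (ℝ × ℝ) → ℝ)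
    (γ : ℝ → ℝ × ℝ) (t : ℝ) : ℝ :=
  Real.sqrt (g (γ t) (deriv γ t) (deriv γ t))

/-- A compact connected smooth Riemannian 2-manifold, as a metric space: a compact
length surface such that around every point there is a chart in which the length of
every C¹ curve is computed by a smooth positive definite symmetric bilinear metric. -/
def IsSmoothRiemannianSurface (X : Type*) [MetricSpace X] : Prop :=
  IsCompactSurface X ∧ IsLengthSpace X ∧
  ∀ x : X, ∃ (U : Set X) (V : Set (ℝ × ℝ)) (φ : X → ℝ × ℝ) (ψ : ℝ × ℝ → X)
      (g : (ℝ × ℝ) → (ℝ × ℝ) → (ℝ × ℝ) → ℝ),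
    IsOpen U ∧ x ∈ U ∧ (∃ V' : Set (ℝ × ℝ), IsOpen V' ∧ V = V' ∩ HalfPlane) ∧
    ContinuousOn φ U ∧ φ '' U = V ∧ ContinuousOn ψ V ∧
    (∀ y ∈ U, ψ (φ y) = y) ∧ (∀ v ∈ V, φ (ψ v) = v) ∧
    (∀ m : ℕ, ContDiffOn ℝ m
      (fun pq : (ℝ × ℝ) × (ℝ × ℝ) × (ℝ × ℝ) => g pq.1 pq.2.1 pq.2.2)
      (V ×ˢ ((Set.univ : Set (ℝ × ℝ)) ×ˢ (Set.univ : Set (ℝ × ℝ))))) ∧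
    (∀ p u v, g p u v = g p v u) ∧
    (∀ p (a : ℝ) u u' v, g p (a • u + u') v = a * g p u v + g p u' v) ∧
    (∀ p ∈ V, ∀ u : ℝ × ℝ, u ≠ 0 → 0 < g p u u) ∧
    ∀ (cur : ℝ → X) (a b : ℝ), a ≤ b → Set.MapsTo cur (Set.Icc a b) U →
      ContDiffOn ℝ 1 (φ ∘ cur) (Set.Icc a b) →
      eVariationOn cur (Set.Icc a b) =
        ENNReal.ofReal (∫ t in a..b, riemLengthIntegrand g (φ ∘ cur) t)

/-- A polyhedral surface: a compact length surface which is flat (locally isometric to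
a subset of the Euclidean half plane) away from finitely many singular points. -/
def IsPolyhedralSurface (X : Type*) [MetricSpace X] : Prop :=
  IsCompactSurface X ∧ IsLengthSpace X ∧
  ∃ F : Set X, F.Finite ∧ ∀ x : X, x ∉ F →
    ∃ (U : Set X) (W : Set (EuclideanSpace ℝ (Fin 2))),
      IsOpen U ∧ x ∈ U ∧ W ⊆ EHalfPlane ∧ Nonempty (↥U ≃ᵢ ↥W)

end

/-! ## Logarithms of nonvanishing functions -/

theorem exists_log_of_simplyConnected {A : Type*} [TopologicalSpace A] [SimplyConnectedSpace A]
    [LocallyPathConnectedSpace A] {f : A → ℂ} (hf : Continuous f) (h0 : ∀ a, f a ≠ 0) :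
    ∃ k : A → ℂ, Continuous k ∧ ∀ a, Complex.exp (k a) = f a := by
  obtain ⟨a₀⟩ : Nonempty A := inferInstance
  obtain ⟨F, ⟨-, hF⟩, -⟩ := Complex.isCoveringMap_exp.existsUnique_continuousMap_lifts
    (A := A) ⟨fun a => (⟨f a, h0 a⟩ : {z : ℂ // z ≠ 0}), by fun_prop⟩ a₀ (Complex.log (f a₀))
    (Subtype.ext (Complex.exp_log (h0 a₀)))
  exact ⟨F, F.continuous, fun a => congrArg Subtype.val (congrFun hF a)⟩

theorem exists_log_of_convex_isOpen {S : Set ℂ} (hc : Convex ℝ S) (ho : IsOpen S)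
    (hne : S.Nonempty) {f : ℂ → ℂ} (hf : ContinuousOn f S) (h0 : ∀ a ∈ S, f a ≠ 0) :
    ∃ k : ℂ → ℂ, ContinuousOn k S ∧ ∀ a ∈ S, Complex.exp (k a) = f a := by
  classical
  have : ContractibleSpace S := hc.contractibleSpace hne
  have : LocallyPathConnectedSpace S := ho.locallyPathConnectedSpace
  obtain ⟨k, hk, hk'⟩ := exists_log_of_simplyConnected (A := S) (f := S.domRestrict f)
    hf.domRestrict (fun a => h0 a a.2)
  refine ⟨fun z => if h : z ∈ S then k ⟨z, h⟩ else 0, ?_, fun a ha => ?_⟩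
  · rw [continuousOn_iff_continuous_domRestrict]
    convert hk using 1
    ext a
    simp
  · simp [ha, hk' ⟨a, ha⟩]

theorem eq_of_exp_eq_const {A : Type*} [TopologicalSpace A] {S : Set A} (hS : IsPreconnected S)
    {k : A → ℂ} (hk : ContinuousOn k S) {c : ℂ} (h : ∀ a ∈ S, Complex.exp (k a) = c)
    {a b : A} (ha : a ∈ S) (hb : b ∈ S) : k a = k b := by
  have : PreconnectedSpace S := isPreconnected_iff_preconnectedSpace.mp hS
  have := Complex.isCoveringMap_exp.eq_of_comp_eq (A := S) (g₁ := S.domRestrict k)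
    (g₂ := fun _ => k b) hk.domRestrict continuous_const
    (by ext x; simp [h x x.2, h b hb]) ⟨b, hb⟩ rfl
  exact congrFun this ⟨a, ha⟩

theorem convex_re_lt (c : ℝ) : Convex ℝ {w : ℂ | w.re < c} := convex_halfSpace_re_lt c

theorem norm_exp_lt_iff {r : ℝ} (hr : 0 < r) (w : ℂ) :
    ‖Complex.exp w‖ < r ↔ w.re < Real.log r := by
  rw [Complex.norm_exp, Real.lt_log_iff_exp_lt hr]

theorem exists_zpow_mul_exp {r : ℝ} (hr : 0 < r) {u : ℂ → ℂ}
    (hu : ContinuousOn u (ball 0 r \ {0})) (h0 : ∀ z ∈ ball (0 : ℂ) r \ {0}, u z ≠ 0) :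
    ∃ (d : ℤ) (k : ℂ → ℂ), ContinuousOn k (ball 0 r \ {0}) ∧
      ∀ z ∈ ball (0 : ℂ) r \ {0}, u z = z ^ d * Complex.exp (k z) := by
  set H : Set ℂ := {w | w.re < Real.log r} with hH
  have hHo : IsOpen H := isOpen_lt Complex.continuous_re continuous_const
  have hHc : Convex ℝ H := convex_re_lt _
  have hHne : H.Nonempty := ⟨((Real.log r - 1 : ℝ) : ℂ), by simp [hH]⟩
  have hmaps : ∀ w ∈ H, Complex.exp w ∈ ball (0 : ℂ) r \ {0} := fun w hw =>
    ⟨by rw [mem_ball_zero_iff]; exact (norm_exp_lt_iff hr w).2 hw, Complex.exp_ne_zero w⟩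
  obtain ⟨L, hL, hLe⟩ := exists_log_of_convex_isOpen hHc hHo hHne
    (f := fun w => u (Complex.exp w)) (hu.comp Complex.continuous_exp.continuousOn hmaps)
    (fun w hw => h0 _ (hmaps w hw))
  have hshift : ∀ w ∈ H, ∀ n : ℤ, w + n * (2 * Real.pi * Complex.I) ∈ H := by
    intro w hw n
    simpa [hH] using hw
  have hper : ∀ w (n : ℤ), Complex.exp (w + n * (2 * Real.pi * Complex.I)) = Complex.exp w := by
    intro w n
    exact Complex.exp_periodic.int_mul n w
  obtain ⟨w₀, hw₀⟩ := hHne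
  -- the increment of `L` under a translation by a period is constant
  have hexp : ∃ d : ℤ, L (w₀ + 2 * Real.pi * Complex.I) = L w₀ + d * (2 * Real.pi * Complex.I) := by
    have h1 := hshift w₀ hw₀ 1
    have h2 := hper w₀ 1
    simp only [Int.cast_one, one_mul] at h1 h2
    have : Complex.exp (L (w₀ + 2 * Real.pi * Complex.I)) = Complex.exp (L w₀) := by
      rw [hLe _ h1, hLe _ hw₀, h2]
    exact Complex.exp_eq_exp_iff_exists_int.1 this
  obtain ⟨d, hd⟩ := hexp
  have hinc : ∀ w ∈ H, L (w + 2 * Real.pi * Complex.I) = L w + d * (2 * Real.pi * Complex.I) := by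
    intro w hw
    have hc : ContinuousOn (fun w => L (w + 2 * Real.pi * Complex.I) - L w) H := by
      refine (hL.comp (by fun_prop) (fun w hw => ?_)).sub hL
      simpa using hshift w hw 1
    have := eq_of_exp_eq_const hHc.isPreconnected hc (c := 1) (fun w hw => by
      have h1 := hshift w hw 1
      have h2 := hper w 1
      simp only [Int.cast_one, one_mul] at h1 h2
      rw [Complex.exp_sub, hLe _ h1, hLe _ hw, h2, div_self (h0 _ (hmaps w hw))]) hw hw₀
    rw [hd] at this
    linear_combination this
  have hincn : ∀ w ∈ H, ∀ n : ℤ, L (w + n * (2 * Real.pi * Complex.I)) =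
      L w + n * d * (2 * Real.pi * Complex.I) := by
    intro w hw n
    induction n using Int.induction_on with
    | zero => simp
    | succ i ih =>
      have := hinc _ (hshift w hw i)
      push_cast at this ih ⊢
      rw [show w + (i + 1) * (2 * Real.pi * Complex.I) =
        w + i * (2 * Real.pi * Complex.I) + 2 * Real.pi * Complex.I by ring, this, ih]
      ring
    | pred i ih =>
      have := hinc _ (hshift w hw (-i - 1))
      push_cast at this ih ⊢
      rw [show w + (-i - 1) * (2 * Real.pi * Complex.I) + 2 * Real.pi * Complex.I =
        w + -i * (2 * Real.pi * Complex.I) by ring, ih] at this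
      linear_combination -this
  set g : ℂ → ℂ := fun w => L w - d * w with hg
  have hgper : ∀ w ∈ H, ∀ w' ∈ H, Complex.exp w = Complex.exp w' → g w = g w' := by
    intro w hw w' hw' h
    obtain ⟨n, hn⟩ := Complex.exp_eq_exp_iff_exists_int.1 h
    rw [hg, hn]
    simp only
    rw [hincn w' hw' n]
    ring
  have hlogH : ∀ z ∈ ball (0 : ℂ) r \ {0}, Complex.log z ∈ H := by
    intro z hz
    refine (norm_exp_lt_iff hr _).1 ?_
    rw [Complex.exp_log hz.2]
    simpa using hz.1
  refine ⟨d, fun z => g (Complex.log z), ?_, fun z hz => ?_⟩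
  · have hgc : ContinuousOn g H := hL.sub (by fun_prop)
    have hopen : IsOpen (ball (0 : ℂ) r \ {0}) := isOpen_ball.sdiff isClosed_singleton
    intro z₁ hz₁
    refine ContinuousAt.continuousWithinAt ?_
    set w₁ := Complex.log z₁ with hw₁
    have hz₁0 : z₁ ≠ 0 := hz₁.2
    have hc1 : ContinuousAt (fun z => w₁ + Complex.log (z / z₁)) z₁ := by
      refine continuousAt_const.add (ContinuousAt.clog (by fun_prop) ?_)
      rw [div_self hz₁0]
      exact Complex.one_mem_slitPlane
    have hv : w₁ + Complex.log (z₁ / z₁) = w₁ := by rw [div_self hz₁0]; simp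
    have hc2 : ContinuousAt (fun z => g (w₁ + Complex.log (z / z₁))) z₁ := by
      have hgv : ContinuousAt g (w₁ + Complex.log (z₁ / z₁)) := by
        rw [hv]
        exact hgc.continuousAt (hHo.mem_nhds (hlogH z₁ hz₁))
      exact ContinuousAt.comp (g := g) (f := fun z => w₁ + Complex.log (z / z₁)) hgv hc1
    refine hc2.congr ?_
    have hev : ∀ᶠ z in 𝓝 z₁, w₁ + Complex.log (z / z₁) ∈ H := by
      refine hc1.eventually_mem (hHo.mem_nhds ?_)
      rw [hv]
      exact hlogH z₁ hz₁
    filter_upwards [hev, hopen.mem_nhds hz₁] with z hz1 hz2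
    refine hgper _ hz1 _ (hlogH z hz2) ?_
    rw [Complex.exp_add, Complex.exp_log (div_ne_zero hz2.2 hz₁0), Complex.exp_log hz₁0,
      Complex.exp_log hz2.2, mul_div_cancel₀ _ hz₁0]
  · have hz0 : z ≠ 0 := hz.2
    simp only [hg]
    rw [Complex.exp_sub, hLe _ (hlogH z hz), Complex.exp_log hz0, Complex.exp_int_mul,
      Complex.exp_log hz0, mul_div_cancel₀ _ (zpow_ne_zero _ hz0)]

theorem zpow_exponent_eq_zero {r : ℝ} (hr : 0 < r) {m : ℤ} {k : ℂ → ℂ}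
    (hk : ContinuousOn k (ball 0 r \ {0}))
    (h : ∀ z ∈ ball (0 : ℂ) r \ {0}, z ^ m = Complex.exp (k z)) : m = 0 := by
  set c : ℝ → ℂ := fun θ => ((r / 2 : ℝ) : ℂ) * Complex.exp (θ * Complex.I) with hc
  have hr2 : ((r / 2 : ℝ) : ℂ) ≠ 0 := by
    rw [Ne, Complex.ofReal_eq_zero]; positivity
  have hcm : ∀ θ, c θ ∈ ball (0 : ℂ) r \ {0} := by
    intro θ
    refine ⟨?_, mul_ne_zero hr2 (Complex.exp_ne_zero _)⟩
    rw [mem_ball_zero_iff, norm_mul, Complex.norm_exp_ofReal_mul_I, mul_one, Complex.norm_real,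
      Real.norm_of_nonneg (by positivity)]
    linarith
  have hcont : Continuous fun θ : ℝ => k (c θ) - m * (θ * Complex.I) := by
    refine Continuous.sub ?_ (by fun_prop)
    exact hk.comp_continuous (by fun_prop) hcm
  have := eq_of_exp_eq_const (S := univ) isPreconnected_univ hcont.continuousOn
    (c := ((r / 2 : ℝ) : ℂ) ^ m) (fun θ _ => by
      rw [Complex.exp_sub, ← h _ (hcm θ), Complex.exp_int_mul, hc]
      simp only
      rw [mul_zpow, mul_div_cancel_right₀ _ (zpow_ne_zero _ (Complex.exp_ne_zero _))])
    (mem_univ 0) (mem_univ (2 * Real.pi))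
  have h2 : c (2 * Real.pi) = c 0 := by
    simp [hc, Complex.exp_two_pi_mul_I]
  simp only [h2] at this
  have h3 : (m : ℂ) * ((2 * Real.pi : ℝ) * Complex.I) = 0 := by
    simp only [Complex.ofReal_zero, zero_mul, mul_zero, sub_zero] at this
    linear_combination this
  have h4 : ((2 * Real.pi : ℝ) : ℂ) * Complex.I ≠ 0 :=
    mul_ne_zero (by rw [Ne, Complex.ofReal_eq_zero]; positivity) Complex.I_ne_zero
  exact_mod_cast (mul_eq_zero.1 h3).resolve_right h4

/-- The closed upper half plane in `ℂ`. -/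
def upperHalf : Set ℂ := {z | 0 ≤ z.im}

theorem exists_log_upperHalf {r : ℝ} (hr : 0 < r) {u : ℂ → ℂ}
    (hu : ContinuousOn u ((upperHalf ∩ ball 0 r) \ {0}))
    (h0 : ∀ z ∈ (upperHalf ∩ ball (0 : ℂ) r) \ {0}, u z ≠ 0) :
    ∃ k : ℂ → ℂ, ContinuousOn k ((upperHalf ∩ ball 0 r) \ {0}) ∧
      ∀ z ∈ (upperHalf ∩ ball (0 : ℂ) r) \ {0}, u z = Complex.exp (k z) := by
  set H : Set ℂ := {w | w.re < Real.log r} with hH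
  have hHo : IsOpen H := isOpen_lt Complex.continuous_re continuous_const
  have hHc : Convex ℝ H := convex_re_lt _
  have hHne : H.Nonempty := ⟨((Real.log r - 1 : ℝ) : ℂ), by simp [hH]⟩
  set cl : ℂ → ℂ := fun w => ⟨w.re, max 0 (min Real.pi w.im)⟩ with hcl
  have hclc : Continuous cl := by
    have : cl = fun w => ((w.re : ℝ) : ℂ) + ((max 0 (min Real.pi w.im) : ℝ) : ℂ) * Complex.I := by
      ext w
      apply Complex.ext <;> simp [hcl]
    rw [this]
    fun_prop
  have hmaps : ∀ w ∈ H, Complex.exp (cl w) ∈ (upperHalf ∩ ball (0 : ℂ) r) \ {0} := by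
    intro w hw
    refine ⟨⟨?_, ?_⟩, Complex.exp_ne_zero _⟩
    · simp only [upperHalf, mem_ofPred_eq, Complex.exp_im, hcl]
      refine mul_nonneg (Real.exp_pos _).le (Real.sin_nonneg_of_nonneg_of_le_pi (le_max_left _ _) ?_)
      exact max_le Real.pi_pos.le (min_le_left _ _)
    · rw [mem_ball_zero_iff]
      exact (norm_exp_lt_iff hr _).2 hw
  obtain ⟨L, hL, hLe⟩ := exists_log_of_convex_isOpen hHc hHo hHne
    (f := fun w => u (Complex.exp (cl w)))
    (hu.comp (Complex.continuous_exp.comp hclc).continuousOn hmaps)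
    (fun w hw => h0 _ (hmaps w hw))
  set lg : ℂ → ℂ := fun z => Complex.log (-Complex.I * z) + ((Real.pi / 2 : ℝ) : ℂ) * Complex.I
    with hlg
  have hslit : ∀ z ∈ upperHalf \ {0}, -Complex.I * z ∈ Complex.slitPlane := by
    intro z hz
    rw [Complex.mem_slitPlane_iff]
    simp only [neg_mul, Complex.neg_re, Complex.mul_re, Complex.I_re, zero_mul, Complex.I_im,
      one_mul, zero_sub, neg_neg, Complex.neg_im, Complex.mul_im, zero_add]
    have h1 : 0 ≤ z.im := hz.1
    rcases h1.lt_or_eq with h | h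
    · left; simpa using h
    · right
      intro hre
      apply hz.2
      exact Complex.ext (by simpa using hre) (by simpa using h.symm)
  have hexp : ∀ z ∈ upperHalf \ {0}, Complex.exp (lg z) = z := by
    intro z hz
    rw [hlg, Complex.exp_add, Complex.exp_log (Complex.slitPlane_ne_zero (hslit z hz))]
    push_cast
    rw [Complex.exp_pi_div_two_mul_I]
    linear_combination (-z) * Complex.I_mul_I
  have hcl_eq : ∀ z ∈ upperHalf \ {0}, cl (lg z) = lg z := by
    intro z hz
    have him : 0 ≤ z.im := hz.1
    have h1 : |Complex.arg (-Complex.I * z)| ≤ Real.pi / 2 := by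
      rw [Complex.abs_arg_le_pi_div_two_iff]
      simpa using him
    have h2 := abs_le.1 h1
    apply Complex.ext
    · simp [hcl]
    · simp only [hcl, hlg, Complex.add_im, Complex.log_im, Complex.mul_im, Complex.ofReal_re,
        Complex.I_im, mul_one, Complex.ofReal_im, Complex.I_re, mul_zero, add_zero]
      rw [min_eq_right (by linarith), max_eq_right (by linarith)]
  have hsub : ∀ z ∈ (upperHalf ∩ ball (0 : ℂ) r) \ {0}, z ∈ upperHalf \ {0} :=
    fun z hz => ⟨hz.1.1, hz.2⟩
  have hlgH : ∀ z ∈ (upperHalf ∩ ball (0 : ℂ) r) \ {0}, lg z ∈ H := by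
    intro z hz
    refine (norm_exp_lt_iff hr _).1 ?_
    rw [hexp z (hsub z hz)]
    simpa using hz.1.2
  refine ⟨fun z => L (lg z), ?_, fun z hz => ?_⟩
  · refine hL.comp ?_ hlgH
    refine ContinuousOn.add (ContinuousOn.clog (by fun_prop) fun z hz => hslit z (hsub z hz))
      continuousOn_const
  · rw [hLe _ (hlgH z hz), hcl_eq z (hsub z hz), hexp z (hsub z hz)]

/-! ## Winding of germs of homeomorphisms -/

theorem exists_isUnit_zpow_mul_exp {r s : ℝ} (hr : 0 < r) (hs : 0 < s) {h g : ℂ → ℂ}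
    (hh : ContinuousOn h (ball 0 r)) (hg : ContinuousOn g (ball 0 s)) (h0 : h 0 = 0)
    (hne : ∀ z ∈ ball (0 : ℂ) r \ {0}, h z ≠ 0) (gne : ∀ z ∈ ball (0 : ℂ) s \ {0}, g z ≠ 0)
    (inv : ∀ z ∈ ball (0 : ℂ) r, h z ∈ ball (0 : ℂ) s → g (h z) = z) :
    ∃ (d : ℤ) (k : ℂ → ℂ), IsUnit d ∧ ContinuousOn k (ball 0 r \ {0}) ∧
      ∀ z ∈ ball (0 : ℂ) r \ {0}, h z = z ^ d * Complex.exp (k z) := by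
  obtain ⟨d, k, hk, hkz⟩ := exists_zpow_mul_exp hr (hh.mono sdiff_subset) hne
  obtain ⟨d', k', hk', hkz'⟩ := exists_zpow_mul_exp hs (hg.mono sdiff_subset) gne
  have hca : ContinuousAt h 0 := hh.continuousAt (isOpen_ball.mem_nhds (mem_ball_self hr))
  have hev : ∀ᶠ z in 𝓝 (0 : ℂ), h z ∈ ball (0 : ℂ) s := by
    refine hca.eventually_mem (isOpen_ball.mem_nhds ?_)
    rw [h0]; exact mem_ball_self hs
  obtain ⟨ρ, hρ, hρs⟩ := Metric.eventually_nhds_iff_ball.1 hev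
  set t := min ρ r with ht
  have ht0 : 0 < t := lt_min hρ hr
  have hsub : ball (0 : ℂ) t \ {0} ⊆ ball 0 r \ {0} :=
    sdiff_subset_sdiff_left (ball_subset_ball (min_le_right _ _))
  have hmaps : ∀ z ∈ ball (0 : ℂ) t \ {0}, h z ∈ ball (0 : ℂ) s \ {0} := fun z hz =>
    ⟨hρs z (ball_subset_ball (min_le_left _ _) hz.1), hne z (hsub hz)⟩
  have := zpow_exponent_eq_zero (m := 1 - d * d') ht0
    (k := fun z => d' * k z + k' (h z))
    ((continuousOn_const.mul (hk.mono hsub)).add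
      (hk'.comp (hh.mono (hsub.trans sdiff_subset)) hmaps))
    (fun z hz => by
      have hz0 : z ≠ 0 := hz.2
      have h1 := hkz z (hsub hz)
      have h2 := hkz' (h z) (hmaps z hz)
      rw [inv z (hsub hz).1 (hmaps z hz).1] at h2
      rw [zpow_sub₀ hz0, zpow_one, Complex.exp_add, Complex.exp_int_mul,
        div_eq_iff (zpow_ne_zero _ hz0)]
      conv_lhs => rw [h2, h1, mul_zpow, ← zpow_mul]
      rw [h1]
      ring)
  refine ⟨d, k, ?_, hk, hkz⟩
  exact IsUnit.of_mul_eq_one d' (by linarith)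

theorem not_upperHalf_chart {r s : ℝ} (hr : 0 < r) (hs : 0 < s) {h g : ℂ → ℂ}
    (hh : ContinuousOn h (ball 0 r)) (hg : ContinuousOn g (upperHalf ∩ ball 0 s)) (h0 : h 0 = 0)
    (hM : ∀ z ∈ ball (0 : ℂ) r, h z ∈ upperHalf)
    (hne : ∀ z ∈ ball (0 : ℂ) r \ {0}, h z ≠ 0)
    (gne : ∀ z ∈ (upperHalf ∩ ball (0 : ℂ) s) \ {0}, g z ≠ 0)
    (inv : ∀ z ∈ ball (0 : ℂ) r, h z ∈ ball (0 : ℂ) s → g (h z) = z) : False := by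
  obtain ⟨k', hk', hkz'⟩ := exists_log_upperHalf hs (hg.mono sdiff_subset) gne
  have hca : ContinuousAt h 0 := hh.continuousAt (isOpen_ball.mem_nhds (mem_ball_self hr))
  have hev : ∀ᶠ z in 𝓝 (0 : ℂ), h z ∈ ball (0 : ℂ) s := by
    refine hca.eventually_mem (isOpen_ball.mem_nhds ?_)
    rw [h0]; exact mem_ball_self hs
  obtain ⟨ρ, hρ, hρs⟩ := Metric.eventually_nhds_iff_ball.1 hev
  set t := min ρ r with ht
  have ht0 : 0 < t := lt_min hρ hr
  have hsub : ball (0 : ℂ) t \ {0} ⊆ ball 0 r \ {0} :=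
    sdiff_subset_sdiff_left (ball_subset_ball (min_le_right _ _))
  have hmaps : ∀ z ∈ ball (0 : ℂ) t \ {0}, h z ∈ (upperHalf ∩ ball (0 : ℂ) s) \ {0} := fun z hz =>
    ⟨⟨hM z (hsub hz).1, hρs z (ball_subset_ball (min_le_left _ _) hz.1)⟩, hne z (hsub hz)⟩
  have := zpow_exponent_eq_zero (m := 1) ht0 (k := fun z => k' (h z))
    (hk'.comp (hh.mono (hsub.trans sdiff_subset)) hmaps)
    (fun z hz => by
      rw [← hkz' _ (hmaps z hz), inv z (hsub hz).1 (hmaps z hz).1.2, zpow_one])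
  exact one_ne_zero this

/-! ## Charts -/

/-- `F` restricts to a homeomorphism from `S` onto an open subset. -/
structure IsChart {E X : Type*} [TopologicalSpace E] [TopologicalSpace X] (S : Set E) (F : E → X) :
    Prop where
  cont : ContinuousOn F S
  inj : InjOn F S
  isOpen_image : ∀ O : Set E, IsOpen O → IsOpen (F '' (S ∩ O))

/-- A chart centred at `x`, defined on the part of the unit disc lying in `M`. -/
structure IsDiscAt {X : Type*} [TopologicalSpace X] (M : Set ℂ) (ψ : ℂ → X) (x : X) : Prop where
  chart : IsChart (M ∩ ball 0 1) ψ
  zero : ψ 0 = x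

namespace IsChart

section General

variable {E X : Type*} [TopologicalSpace E] [Nonempty E] [TopologicalSpace X] {S : Set E} {F : E → X}

theorem isOpen_range (h : IsChart S F) : IsOpen (F '' S) := by
  simpa using h.isOpen_image univ isOpen_univ

theorem inv_mem (_h : IsChart S F) {x : X} (hx : x ∈ F '' S) : Function.invFunOn F S x ∈ S :=
  Function.invFunOn_mem hx

theorem apply_inv (_h : IsChart S F) {x : X} (hx : x ∈ F '' S) : F (Function.invFunOn F S x) = x :=
  Function.invFunOn_eq hx

theorem inv_apply (h : IsChart S F) {z : E} (hz : z ∈ S) : Function.invFunOn F S (F z) = z :=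
  h.inj (h.inv_mem (mem_image_of_mem F hz)) hz (h.apply_inv (mem_image_of_mem F hz))

theorem continuousOn_inv (h : IsChart S F) : ContinuousOn (Function.invFunOn F S) (F '' S) := by
  intro x hx
  refine ContinuousAt.continuousWithinAt ?_
  rw [ContinuousAt, _root_.tendsto_nhds]
  intro O hO hxO
  refine mem_of_superset ((h.isOpen_image O hO).mem_nhds ⟨_, ⟨h.inv_mem hx, hxO⟩, h.apply_inv hx⟩) ?_
  rintro _ ⟨z, ⟨hz, hzO⟩, rfl⟩
  rwa [mem_preimage, h.inv_apply hz]

end General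

variable {X : Type*} [TopologicalSpace X] {S : Set ℂ} {F : ℂ → X}

theorem exists_disc (h : IsChart S F) {p : ℂ} (hp : p ∈ S) {M : Set ℂ}
    (hM : ∀ c : ℝ, 0 < c → ∀ w : ℂ, c * w ∈ M ↔ w ∈ M)
    (hloc : ∀ᶠ w in 𝓝 (0 : ℂ), p + w ∈ S ↔ w ∈ M) {N : Set X} (hN : N ∈ 𝓝 (F p)) :
    ∃ c : ℝ, 0 < c ∧ IsDiscAt M (fun w => F (p + c * w)) (F p) ∧
      (fun w : ℂ => F (p + c * w)) '' (M ∩ ball 0 1) ⊆ N ∧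
      ∀ w ∈ M ∩ ball (0 : ℂ) 1, p + c * w ∈ S := by
  have h1 : ∀ᶠ z in 𝓝 p, z ∈ S → F z ∈ N := by
    have := (h.cont p hp).eventually_mem hN
    exact eventually_nhdsWithin_iff.1 this
  have ht : Tendsto (fun w : ℂ => p + w) (𝓝 0) (𝓝 p) := by
    have : Continuous fun w : ℂ => p + w := by fun_prop
    simpa using this.tendsto 0
  obtain ⟨ε, hε, hεb⟩ := Metric.eventually_nhds_iff_ball.1 (hloc.and (ht.eventually h1))
  have hmem : ∀ w ∈ ball (0 : ℂ) 1, (ε : ℂ) * w ∈ ball (0 : ℂ) ε := by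
    intro w hw
    rw [mem_ball_zero_iff] at hw ⊢
    rw [norm_mul, Complex.norm_real, Real.norm_of_nonneg hε.le]
    nlinarith
  have hS : ∀ w ∈ M ∩ ball (0 : ℂ) 1, p + ε * w ∈ S := fun w hw =>
    (hεb _ (hmem w hw.2)).1.2 ((hM ε hε w).2 hw.1)
  have hε0 : (ε : ℂ) ≠ 0 := by exact_mod_cast hε.ne'
  refine ⟨ε, hε, ⟨⟨?_, ?_, ?_⟩, by simp⟩, ?_, hS⟩
  · exact h.cont.comp (by fun_prop) hS
  · intro w hw w' hw' he
    have := h.inj (hS w hw) (hS w' hw') he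
    exact mul_left_cancel₀ hε0 (add_left_cancel this)
  · intro O hO
    have : (fun w : ℂ => F (p + ε * w)) '' (M ∩ ball 0 1 ∩ O) =
        F '' (S ∩ ((fun z => (z - p) / ε) ⁻¹' (ball 0 1 ∩ O))) := by
      ext y
      constructor
      · rintro ⟨w, ⟨hw, hwO⟩, rfl⟩
        refine ⟨_, ⟨hS w hw, ?_⟩, rfl⟩
        have : (p + ε * w - p) / ε = w := by field_simp; ring
        rw [mem_preimage, this]
        exact ⟨hw.2, hwO⟩
      · rintro ⟨z, ⟨hz, hzb, hzO⟩, rfl⟩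
        have hz' : p + ε * ((z - p) / ε) = z := by field_simp; ring
        refine ⟨(z - p) / ε, ⟨⟨?_, hzb⟩, hzO⟩, by simp only [hz']⟩
        rw [← hM ε hε, ← (hεb _ (hmem _ hzb)).1, hz']
        exact hz
    rw [this]
    exact h.isOpen_image _ ((isOpen_ball.inter hO).preimage (by fun_prop))
  · rintro _ ⟨w, hw, rfl⟩
    exact (hεb _ (hmem w hw.2)).2 (hS w hw)

theorem of_isOpenEmbedding {G : S → X} (hG : IsOpenEmbedding G) (z₀ : S) :
    ∃ F : ℂ → X, IsChart S F ∧ ∀ z : S, F z = G z := by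
  classical
  have hF : ∀ z : S, (if h : (z : ℂ) ∈ S then G ⟨z, h⟩ else G z₀) = G z := fun z => by simp
  refine ⟨fun z => if h : z ∈ S then G ⟨z, h⟩ else G z₀, ⟨?_, ?_, ?_⟩, hF⟩
  · rw [continuousOn_iff_continuous_domRestrict]
    convert hG.continuous using 1
    ext z
    simp
  · intro a ha b hb hab
    simp only [ha, hb, dite_true] at hab
    exact congrArg Subtype.val (hG.injective hab)
  · intro O hO
    convert hG.isOpenMap _ (hO.preimage continuous_subtype_val) using 1
    ext y
    constructor
    · rintro ⟨z, ⟨hz, hzO⟩, rfl⟩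
      exact ⟨⟨z, hz⟩, hzO, by simp [hz]⟩
    · rintro ⟨z, hzO, rfl⟩
      exact ⟨z, ⟨z.2, hzO⟩, by simp⟩

end IsChart

theorem IsSurface.exists_chart {X : Type*} [TopologicalSpace X] (h : IsSurface X) (x : X) :
    ∃ (O : Set ℂ) (F : ℂ → X) (p : ℂ), IsOpen O ∧ IsChart (upperHalf ∩ O) F ∧
      p ∈ upperHalf ∩ O ∧ F p = x := by
  obtain ⟨U, V, hU, hx, hV, ⟨e⟩⟩ := h x
  set tp : ℂ ≃ₜ ℝ × ℝ := Complex.equivRealProdCLM.toHomeomorph with htp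
  obtain ⟨O', hO', rfl⟩ := isOpen_induced_iff.1 hV
  set S : Set ℂ := tp ⁻¹' (Subtype.val '' (Subtype.val ⁻¹' O' : Set HalfPlane)) with hS
  let a : S ≃ₜ (Subtype.val '' (Subtype.val ⁻¹' O' : Set HalfPlane) : Set (ℝ × ℝ)) :=
    tp.sets rfl
  let b := (IsEmbedding.subtypeVal (p := (· ∈ HalfPlane))).homeomorphImage (Subtype.val ⁻¹' O')
  have hG : IsOpenEmbedding fun z : S => ((e.symm (b.symm (a z)) : U) : X) :=
    hU.isOpenEmbedding_subtypeVal.comp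
      (e.symm.isOpenEmbedding.comp (b.symm.isOpenEmbedding.comp a.isOpenEmbedding))
  obtain ⟨F, hF, hFG⟩ := IsChart.of_isOpenEmbedding hG (a.symm (b (e ⟨x, hx⟩)))
  have hSO : S = upperHalf ∩ tp ⁻¹' O' := by
    ext z
    simp only [hS, mem_preimage, Subtype.image_preimage_coe, mem_inter_iff]
    rfl
  rw [hSO] at hF
  refine ⟨tp ⁻¹' O', F, (a.symm (b (e ⟨x, hx⟩)) : S), hO'.preimage tp.continuous, hF, ?_, ?_⟩
  · rw [← hSO]; exact Subtype.coe_prop _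
  · rw [hFG]; simp

theorem exists_chart_of_notMem_surfaceBoundary {X : Type*} [TopologicalSpace X] {x : X}
    (h : x ∉ surfaceBoundary X) :
    ∃ (O : Set ℂ) (F : ℂ → X) (p : ℂ), IsOpen O ∧ IsChart O F ∧ p ∈ O ∧ F p = x := by
  simp only [surfaceBoundary, mem_ofPred_eq, not_not] at h
  obtain ⟨U, V, hU, hx, hV, ⟨e⟩⟩ := h
  set tp : ℂ ≃ₜ ℝ × ℝ := Complex.equivRealProdCLM.toHomeomorph with htp
  let a : (tp ⁻¹' V) ≃ₜ V := tp.sets rfl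
  have hG : IsOpenEmbedding fun z : (tp ⁻¹' V) => ((e.symm (a z) : U) : X) :=
    hU.isOpenEmbedding_subtypeVal.comp (e.symm.isOpenEmbedding.comp a.isOpenEmbedding)
  obtain ⟨F, hF, hFG⟩ := IsChart.of_isOpenEmbedding hG (a.symm (e ⟨x, hx⟩))
  exact ⟨_, F, (a.symm (e ⟨x, hx⟩) : tp ⁻¹' V), hV.preimage tp.continuous, hF,
    Subtype.coe_prop _, by rw [hFG]; simp⟩

theorem IsChart.notMem_surfaceBoundary {X : Type*} [TopologicalSpace X] {O : Set ℂ} {F : ℂ → X}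
    (h : IsChart O F) (hO : IsOpen O) {p : ℂ} (hp : p ∈ O) : F p ∉ surfaceBoundary X := by
  simp only [surfaceBoundary, mem_ofPred_eq, not_not]
  set tp : ℂ ≃ₜ ℝ × ℝ := Complex.equivRealProdCLM.toHomeomorph with htp
  let a : (tp.symm ⁻¹' O) ≃ₜ O := tp.symm.sets rfl
  refine ⟨F '' O, tp.symm ⁻¹' O, h.isOpen_range, mem_image_of_mem F hp,
    hO.preimage tp.symm.continuous, ⟨Homeomorph.trans ?_ a.symm⟩⟩
  exact
    { toFun := fun y => ⟨Function.invFunOn F O y, h.inv_mem y.2⟩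
      invFun := fun z => ⟨F z, mem_image_of_mem F z.2⟩
      left_inv := fun y => Subtype.ext (h.apply_inv y.2)
      right_inv := fun z => Subtype.ext (h.inv_apply z.2)
      continuous_toFun :=
        (continuousOn_iff_continuous_domRestrict.1 h.continuousOn_inv).subtype_mk _
      continuous_invFun := (continuousOn_iff_continuous_domRestrict.1 h.cont).subtype_mk _ }

theorem zero_mem_upperHalf : (0 : ℂ) ∈ upperHalf := le_refl (0 : ℝ)

theorem isClosed_upperHalf : IsClosed upperHalf := isClosed_le continuous_const Complex.continuous_im

theorem smul_mem_upperHalf_iff (c : ℝ) (hc : 0 < c) (w : ℂ) :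
    (c : ℂ) * w ∈ upperHalf ↔ w ∈ upperHalf := by
  simp [upperHalf, hc]

section Disc

variable {X : Type*} [TopologicalSpace X]

theorem IsChart.exists_disc_univ {S : Set ℂ} {F : ℂ → X} (h : IsChart S F) {p : ℂ} (hp : S ∈ 𝓝 p)
    {N : Set X} (hN : N ∈ 𝓝 (F p)) :
    ∃ c : ℝ, 0 < c ∧ IsDiscAt univ (fun w => F (p + c * w)) (F p) ∧
      (fun w : ℂ => F (p + c * w)) '' (univ ∩ ball 0 1) ⊆ N ∧
      ∀ w ∈ univ ∩ ball (0 : ℂ) 1, p + c * w ∈ S := by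
  refine h.exists_disc (mem_of_mem_nhds hp) (by simp) ?_ hN
  have ht : Tendsto (fun w : ℂ => p + w) (𝓝 0) (𝓝 p) := by
    have : Continuous fun w : ℂ => p + w := by fun_prop
    simpa using this.tendsto 0
  filter_upwards [ht hp] with w hw
  simpa using hw

theorem IsChart.exists_disc_upperHalf {O : Set ℂ} {F : ℂ → X} (hO : IsOpen O)
    (h : IsChart (upperHalf ∩ O) F) {p : ℂ} (hp : p ∈ O) (him : p.im = 0)
    {N : Set X} (hN : N ∈ 𝓝 (F p)) :
    ∃ c : ℝ, 0 < c ∧ IsDiscAt upperHalf (fun w => F (p + c * w)) (F p) ∧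
      (fun w : ℂ => F (p + c * w)) '' (upperHalf ∩ ball 0 1) ⊆ N ∧
      ∀ w ∈ upperHalf ∩ ball (0 : ℂ) 1, p + c * w ∈ upperHalf ∩ O := by
  refine h.exists_disc ⟨him.ge, hp⟩ smul_mem_upperHalf_iff ?_ hN
  have ht : Tendsto (fun w : ℂ => p + w) (𝓝 0) (𝓝 p) := by
    have : Continuous fun w : ℂ => p + w := by fun_prop
    simpa using this.tendsto 0
  filter_upwards [ht (hO.mem_nhds hp)] with w hw
  have hw' : p + w ∈ O := hw
  simp [upperHalf, him, hw']

theorem IsDiscAt.mem_nhds {M : Set ℂ} {ψ : ℂ → X} {x : X} (h : IsDiscAt M ψ x) (h0 : (0 : ℂ) ∈ M) :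
    ψ '' (M ∩ ball 0 1) ∈ 𝓝 x :=
  h.chart.isOpen_range.mem_nhds ⟨0, ⟨h0, mem_ball_self one_pos⟩, h.zero⟩

theorem IsDiscAt.false_of_both {ψ θ : ℂ → X} {x : X} (hψ : IsDiscAt univ ψ x)
    (hθ : IsDiscAt upperHalf θ x) : False := by
  set φ := Function.invFunOn ψ (univ ∩ ball 0 1) with hφ
  set τ := Function.invFunOn θ (upperHalf ∩ ball 0 1) with hτ
  have m0 : (0 : ℂ) ∈ univ ∩ ball (0 : ℂ) 1 := ⟨trivial, mem_ball_self one_pos⟩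
  have m0' : (0 : ℂ) ∈ upperHalf ∩ ball (0 : ℂ) 1 := ⟨zero_mem_upperHalf, mem_ball_self one_pos⟩
  have e1 : ∀ᶠ z in 𝓝 (0 : ℂ), z ∈ univ ∩ ball (0 : ℂ) 1 → ψ z ∈ θ '' (upperHalf ∩ ball 0 1) := by
    refine eventually_nhdsWithin_iff.1 ((hψ.chart.cont 0 m0).eventually_mem ?_)
    rw [hψ.zero]; exact hθ.mem_nhds zero_mem_upperHalf
  have e2 : ∀ᶠ z in 𝓝 (0 : ℂ), z ∈ upperHalf ∩ ball (0 : ℂ) 1 → θ z ∈ ψ '' (univ ∩ ball 0 1) := by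
    refine eventually_nhdsWithin_iff.1 ((hθ.chart.cont 0 m0').eventually_mem ?_)
    rw [hθ.zero]; exact hψ.mem_nhds (mem_univ _)
  obtain ⟨r, hr, hrb⟩ := Metric.eventually_nhds_iff_ball.1
    (e1.and (isOpen_ball.mem_nhds (mem_ball_self (x := (0 : ℂ)) one_pos)))
  obtain ⟨s, hs, hsb⟩ := Metric.eventually_nhds_iff_ball.1
    (e2.and (isOpen_ball.mem_nhds (mem_ball_self (x := (0 : ℂ)) one_pos)))
  have A : ∀ z ∈ ball (0 : ℂ) r, ψ z ∈ θ '' (upperHalf ∩ ball 0 1) := fun z hz =>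
    (hrb z hz).1 ⟨trivial, (hrb z hz).2⟩
  have B : ∀ z ∈ upperHalf ∩ ball (0 : ℂ) s, θ z ∈ ψ '' (univ ∩ ball 0 1) := fun z hz =>
    (hsb z hz.2).1 ⟨hz.1, (hsb z hz.2).2⟩
  have hτx : τ x = 0 := by rw [← hθ.zero]; exact hθ.chart.inv_apply m0'
  have hφx : φ x = 0 := by rw [← hψ.zero]; exact hψ.chart.inv_apply m0
  refine not_upperHalf_chart hr hs (h := fun z => τ (ψ z)) (g := fun z => φ (θ z)) ?_ ?_ ?_ ?_ ?_ ?_ ?_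
  · exact hθ.chart.continuousOn_inv.comp (hψ.chart.cont.mono fun z hz => ⟨trivial, (hrb z hz).2⟩) A
  · exact hψ.chart.continuousOn_inv.comp
      (hθ.chart.cont.mono fun z hz => ⟨hz.1, (hsb z hz.2).2⟩) B
  · show τ (ψ 0) = 0
    rw [hψ.zero, hτx]
  · exact fun z hz => (hθ.chart.inv_mem (A z hz)).1
  · rintro z ⟨hz, hz0⟩ h
    have : θ (τ (ψ z)) = ψ z := hθ.chart.apply_inv (A z hz)
    rw [h, hθ.zero, ← hψ.zero] at this
    exact hz0 (hψ.chart.inj m0 ⟨trivial, (hrb z hz).2⟩ this).symm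
  · rintro z ⟨hz, hz0⟩ h
    have : ψ (φ (θ z)) = θ z := hψ.chart.apply_inv (B z hz)
    rw [h, hψ.zero, ← hθ.zero] at this
    exact hz0 (hθ.chart.inj m0' ⟨hz.1, (hsb z hz.2).2⟩ this).symm
  · intro z hz _
    show φ (θ (τ (ψ z))) = z
    rw [show θ (τ (ψ z)) = ψ z from hθ.chart.apply_inv (A z hz)]
    exact hψ.chart.inv_apply ⟨trivial, (hrb z hz).2⟩

theorem exists_disc_of_notMem_surfaceBoundary {x : X} (h : x ∉ surfaceBoundary X) {N : Set X}
    (hN : N ∈ 𝓝 x) : ∃ ψ : ℂ → X, IsDiscAt univ ψ x ∧ ψ '' (univ ∩ ball 0 1) ⊆ N := by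
  obtain ⟨O, F, p, hO, hF, hp, rfl⟩ := exists_chart_of_notMem_surfaceBoundary h
  obtain ⟨c, -, h1, h2, -⟩ := hF.exists_disc_univ (hO.mem_nhds hp) hN
  exact ⟨_, h1, h2⟩

theorem IsDiscAt.notMem_surfaceBoundary {ψ : ℂ → X} {x : X} (h : IsDiscAt univ ψ x) {z : ℂ}
    (hz : z ∈ ball (0 : ℂ) 1) : ψ z ∉ surfaceBoundary X := by
  have h1 := h.chart
  rw [univ_inter] at h1
  exact h1.notMem_surfaceBoundary isOpen_ball hz

theorem IsSurface.exists_disc_of_mem_surfaceBoundary (hX : IsSurface X) {x : X}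
    (h : x ∈ surfaceBoundary X) {N : Set X} (hN : N ∈ 𝓝 x) :
    ∃ ψ : ℂ → X, IsDiscAt upperHalf ψ x ∧ ψ '' (upperHalf ∩ ball 0 1) ⊆ N := by
  obtain ⟨O, F, p, hO, hF, hp, rfl⟩ := hX.exists_chart x
  have h0 : 0 ≤ p.im := hp.1
  rcases h0.eq_or_lt with him | him
  · obtain ⟨c, -, h1, h2, -⟩ := hF.exists_disc_upperHalf hO hp.2 him.symm hN
    exact ⟨_, h1, h2⟩
  · have hn : upperHalf ∩ O ∈ 𝓝 p := by
      refine inter_mem ?_ (hO.mem_nhds hp.2)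
      filter_upwards [(isOpen_lt continuous_const Complex.continuous_im).mem_nhds him] with z hz
      exact le_of_lt hz
    obtain ⟨c, -, h1, -, -⟩ := hF.exists_disc_univ hn univ_mem
    have := h1.notMem_surfaceBoundary (mem_ball_self one_pos)
    simp only [mul_zero, add_zero] at this
    exact absurd h this

theorem IsDiscAt.mem_surfaceBoundary_iff {ψ : ℂ → X} {x : X} (h : IsDiscAt upperHalf ψ x)
    {z : ℂ} (hz : z ∈ upperHalf ∩ ball (0 : ℂ) 1) : ψ z ∈ surfaceBoundary X ↔ z.im = 0 := by
  constructor
  · intro hb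
    by_contra him
    have him' : 0 < z.im := lt_of_le_of_ne hz.1 (Ne.symm him)
    have hn : upperHalf ∩ ball 0 1 ∈ 𝓝 z := by
      refine inter_mem ?_ (isOpen_ball.mem_nhds hz.2)
      filter_upwards [(isOpen_lt continuous_const Complex.continuous_im).mem_nhds him'] with z hz
      exact le_of_lt hz
    obtain ⟨c, -, h1, -, -⟩ := h.chart.exists_disc_univ hn univ_mem
    have := h1.notMem_surfaceBoundary (mem_ball_self one_pos)
    simp only [mul_zero, add_zero] at this
    exact this hb
  · intro him
    by_contra hb
    obtain ⟨θ, hθ, -⟩ := exists_disc_of_notMem_surfaceBoundary hb univ_mem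
    obtain ⟨c, -, h1, -, -⟩ := h.chart.exists_disc_upperHalf isOpen_ball hz.2 him univ_mem
    exact hθ.false_of_both h1

theorem isClosed_surfaceBoundary : IsClosed (surfaceBoundary X) := by
  rw [← isOpen_compl_iff, isOpen_iff_mem_nhds]
  intro x hx
  obtain ⟨ψ, hψ, -⟩ := exists_disc_of_notMem_surfaceBoundary hx univ_mem
  refine mem_of_superset (hψ.mem_nhds (mem_univ _)) ?_
  rintro _ ⟨z, hz, rfl⟩
  exact hψ.notMem_surfaceBoundary hz.2

/-- The two kinds of model domains for discs. -/
def IsModel (M : Set ℂ) : Prop := M = univ ∨ M = upperHalf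

theorem IsSurface.exists_disc (hX : IsSurface X) (x : X) {N : Set X} (hN : N ∈ 𝓝 x) :
    ∃ (M : Set ℂ) (ψ : ℂ → X), IsModel M ∧ IsDiscAt M ψ x ∧ ψ '' (M ∩ ball 0 1) ⊆ N := by
  by_cases hx : x ∈ surfaceBoundary X
  · obtain ⟨ψ, h1, h2⟩ := hX.exists_disc_of_mem_surfaceBoundary hx hN
    exact ⟨_, ψ, Or.inr rfl, h1, h2⟩
  · obtain ⟨ψ, h1, h2⟩ := exists_disc_of_notMem_surfaceBoundary hx hN
    exact ⟨_, ψ, Or.inl rfl, h1, h2⟩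

theorem convex_upperHalf : Convex ℝ upperHalf := convex_halfSpace_im_ge 0

theorem IsModel.convex {M : Set ℂ} (hM : IsModel M) : Convex ℝ M := by
  rcases hM with rfl | rfl
  exacts [convex_univ, convex_upperHalf]

theorem IsModel.zero_mem {M : Set ℂ} (hM : IsModel M) : (0 : ℂ) ∈ M := by
  rcases hM with rfl | rfl
  exacts [mem_univ _, zero_mem_upperHalf]

end Disc

/-! ## Arcs -/

/-- `S` is a (possibly degenerate) arc from `u` to `v`. -/
def IsArc {X : Type*} [TopologicalSpace X] (S : Set X) (u v : X) : Prop :=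
  ∃ (a b : ℝ) (γ : ℝ → X), a ≤ b ∧ ContinuousOn γ (Icc a b) ∧ InjOn γ (Icc a b) ∧
    γ a = u ∧ γ b = v ∧ S = γ '' Icc a b

namespace IsArc

variable {X : Type*} [TopologicalSpace X] {S S' : Set X} {u v w p : X}

theorem refl (u : X) : IsArc {u} u u :=
  ⟨0, 0, fun _ => u, le_rfl, continuousOn_const, by simp, rfl, rfl, by simp⟩

theorem left_mem (h : IsArc S u v) : u ∈ S := by
  obtain ⟨a, b, γ, hab, -, -, rfl, -, rfl⟩ := h
  exact mem_image_of_mem _ (left_mem_Icc.2 hab)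

theorem right_mem (h : IsArc S u v) : v ∈ S := by
  obtain ⟨a, b, γ, hab, -, -, -, rfl, rfl⟩ := h
  exact mem_image_of_mem _ (right_mem_Icc.2 hab)

theorem isCompact (h : IsArc S u v) : IsCompact S := by
  obtain ⟨a, b, γ, hab, hc, -, -, -, rfl⟩ := h
  exact isCompact_Icc.image_of_continuousOn hc

theorem isConnected (h : IsArc S u v) : IsConnected S := by
  obtain ⟨a, b, γ, hab, hc, -, -, -, rfl⟩ := h
  exact (isConnected_Icc hab).image _ hc

theorem eq_singleton (h : IsArc S u u) : S = {u} := by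
  obtain ⟨a, b, γ, hab, hc, hi, h1, h2, rfl⟩ := h
  have := hi (left_mem_Icc.2 hab) (right_mem_Icc.2 hab) (h1.trans h2.symm)
  subst this
  simp [h1]

theorem symm (h : IsArc S u v) : IsArc S v u := by
  obtain ⟨a, b, γ, hab, hc, hi, rfl, rfl, rfl⟩ := h
  have hm : ∀ t ∈ Icc (-b) (-a), -t ∈ Icc a b := fun t ht => ⟨by linarith [ht.2], by linarith [ht.1]⟩
  refine ⟨-b, -a, fun t => γ (-t), by linarith, hc.comp (by fun_prop) hm, ?_, by simp, by simp, ?_⟩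
  · intro s hs t ht hst
    exact neg_injective (hi (hm s hs) (hm t ht) hst)
  · ext y
    constructor
    · rintro ⟨t, ht, rfl⟩
      exact ⟨-t, ⟨by linarith [ht.2], by linarith [ht.1]⟩, by simp⟩
    · rintro ⟨t, ht, rfl⟩
      exact ⟨-t, hm t ht, rfl⟩

/-- Changing the parameter interval by a translation. -/
theorem exists_start (h : IsArc S u v) (a : ℝ) : ∃ (b : ℝ) (γ : ℝ → X), a ≤ b ∧
    ContinuousOn γ (Icc a b) ∧ InjOn γ (Icc a b) ∧ γ a = u ∧ γ b = v ∧ S = γ '' Icc a b := by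
  obtain ⟨a', b', γ, hab, hc, hi, rfl, rfl, rfl⟩ := h
  have hm : ∀ t ∈ Icc a (b' - a' + a), t - a + a' ∈ Icc a' b' :=
    fun t ht => ⟨by linarith [ht.1], by linarith [ht.2]⟩
  refine ⟨b' - a' + a, fun t => γ (t - a + a'), by linarith, hc.comp (by fun_prop) hm, ?_, by simp,
    by simp, ?_⟩
  · intro s hs t ht hst
    linarith [hi (hm s hs) (hm t ht) hst]
  · ext y
    constructor
    · rintro ⟨t, ht, rfl⟩
      exact ⟨t - a' + a, ⟨by linarith [ht.1], by linarith [ht.2]⟩, by simp⟩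
    · rintro ⟨t, ht, rfl⟩
      exact ⟨t - a + a', hm t ht, rfl⟩

theorem concat (h : IsArc S u v) (h' : IsArc S' v w) (hd : S ∩ S' ⊆ {v}) :
    IsArc (S ∪ S') u w := by
  obtain ⟨a, b, γ, hab, hc, hi, rfl, rfl, rfl⟩ := h
  obtain ⟨c, θ, hbc, hc', hi', h0, rfl, rfl⟩ := h'.exists_start b
  set η : ℝ → X := fun t => if t ≤ b then γ t else θ t with hη
  have h1 : EqOn η γ (Icc a b) := fun t ht => by simp [hη, ht.2]
  have h2 : EqOn η θ (Icc b c) := by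
    intro t ht
    rcases ht.1.eq_or_lt with rfl | hlt
    · simp [hη, h0]
    · simp [hη, not_le.2 hlt]
  have key : ∀ s ∈ Icc a b, ∀ t ∈ Icc b c, η s = η t → s = t := by
    intro s hs t ht hst
    rw [h1 hs, h2 ht] at hst
    have h3 : γ s = γ b := hd ⟨mem_image_of_mem _ hs, hst ▸ mem_image_of_mem _ ht⟩
    have h4 := hi hs (right_mem_Icc.2 hab) h3
    have h5 := hi' ht (left_mem_Icc.2 hbc) (by rw [← hst, h3, h0])
    rw [h4, h5]
  refine ⟨a, c, η, hab.trans hbc, ?_, ?_, h1 (left_mem_Icc.2 hab), h2 (right_mem_Icc.2 hbc), ?_⟩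
  · rw [← Icc_union_Icc_eq_Icc hab hbc]
    exact (hc.congr h1).union_of_isClosed (hc'.congr h2) isClosed_Icc isClosed_Icc
  · rw [← Icc_union_Icc_eq_Icc hab hbc]
    rintro s (hs | hs) t (ht | ht) hst
    · exact hi hs ht (by rwa [h1 hs, h1 ht] at hst)
    · exact key s hs t ht hst
    · exact (key t ht s hs hst.symm).symm
    · exact hi' hs ht (by rwa [h2 hs, h2 ht] at hst)
  · rw [← Icc_union_Icc_eq_Icc hab hbc, image_union, h1.image_eq, h2.image_eq]

theorem split (h : IsArc S u v) (hp : p ∈ S) :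
    ∃ S₁ S₂, IsArc S₁ u p ∧ IsArc S₂ p v ∧ S₁ ∪ S₂ = S ∧ S₁ ∩ S₂ = {p} := by
  obtain ⟨a, b, γ, hab, hc, hi, rfl, rfl, rfl⟩ := h
  obtain ⟨t, ht, rfl⟩ := hp
  have s1 : Icc a t ⊆ Icc a b := Icc_subset_Icc_right ht.2
  have s2 : Icc t b ⊆ Icc a b := Icc_subset_Icc_left ht.1
  refine ⟨γ '' Icc a t, γ '' Icc t b, ⟨a, t, γ, ht.1, hc.mono s1, hi.mono s1, rfl, rfl, rfl⟩,
    ⟨t, b, γ, ht.2, hc.mono s2, hi.mono s2, rfl, rfl, rfl⟩, ?_, ?_⟩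
  · rw [← image_union, Icc_union_Icc_eq_Icc ht.1 ht.2]
  · rw [← hi.image_inter s1 s2, Icc_inter_Icc_eq_singleton ht.1 ht.2, image_singleton]

theorem exists_first (h : IsArc S u v) {K : Set X} (hK : IsClosed K) (hn : (S ∩ K).Nonempty) :
    ∃ p S₁ S₂, IsArc S₁ u p ∧ IsArc S₂ p v ∧ S₁ ∪ S₂ = S ∧ S₁ ∩ S₂ = {p} ∧ S₁ ∩ K = {p} := by
  obtain ⟨a, b, γ, hab, hc, hi, rfl, rfl, rfl⟩ := h
  obtain ⟨_, ⟨t₁, ht₁, rfl⟩, hk₁⟩ := hn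
  have hcl : IsCompact (Icc a b ∩ γ ⁻¹' K) :=
    isCompact_Icc.of_isClosed_subset (hc.preimage_isClosed_of_isClosed isClosed_Icc hK)
      inter_subset_left
  obtain ⟨t, ⟨ht, htK⟩, hmin⟩ := hcl.exists_isLeast ⟨t₁, ht₁, hk₁⟩
  have s1 : Icc a t ⊆ Icc a b := Icc_subset_Icc_right ht.2
  have s2 : Icc t b ⊆ Icc a b := Icc_subset_Icc_left ht.1
  refine ⟨γ t, γ '' Icc a t, γ '' Icc t b, ⟨a, t, γ, ht.1, hc.mono s1, hi.mono s1, rfl, rfl, rfl⟩,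
    ⟨t, b, γ, ht.2, hc.mono s2, hi.mono s2, rfl, rfl, rfl⟩, ?_, ?_, ?_⟩
  · rw [← image_union, Icc_union_Icc_eq_Icc ht.1 ht.2]
  · rw [← hi.image_inter s1 s2, Icc_inter_Icc_eq_singleton ht.1 ht.2, image_singleton]
  · refine subset_antisymm ?_ (singleton_subset_iff.2 ⟨mem_image_of_mem _ (right_mem_Icc.2 ht.1), htK⟩)
    rintro _ ⟨⟨s, hs, rfl⟩, hsK⟩
    rw [mem_singleton_iff, le_antisymm hs.2 (hmin ⟨s1 hs, hsK⟩)]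

theorem trans [T2Space X] (h : IsArc S u v) (h' : IsArc S' v w) :
    ∃ S'' ⊆ S ∪ S', IsArc S'' u w := by
  obtain ⟨p, S₁, S₂, h1, -, h3, -, h5⟩ :=
    h.exists_first h'.isCompact.isClosed ⟨v, h.right_mem, h'.left_mem⟩
  have hp : p ∈ S' := (h5.symm ▸ mem_singleton p : p ∈ S₁ ∩ S').2
  obtain ⟨S₃, S₄, -, h7, h8, -⟩ := h'.split hp
  refine ⟨S₁ ∪ S₄, union_subset_union (h3 ▸ subset_union_left) (h8 ▸ subset_union_right),
    h1.concat h7 ?_⟩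
  rw [← h5]
  exact inter_subset_inter_right _ (h8 ▸ subset_union_right)

theorem exists_path (h : IsArc S u v) (huv : u ≠ v) :
    ∃ γ : Path u v, Function.Injective γ ∧ range γ = S := by
  obtain ⟨a, b, γ, hab, hc, hi, rfl, rfl, rfl⟩ := h
  have hlt : a < b := hab.lt_of_ne fun h => huv (by rw [h])
  have hm : ∀ t : I, a + t * (b - a) ∈ Icc a b := fun t =>
    ⟨by nlinarith [t.2.1], by nlinarith [t.2.2]⟩
  refine ⟨⟨⟨fun t => γ (a + t * (b - a)), ?_⟩, by simp, by simp⟩, ?_, ?_⟩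
  · exact hc.comp_continuous (by fun_prop) hm
  · intro s t hst
    have := hi (hm s) (hm t) hst
    exact Subtype.ext (mul_right_cancel₀ (sub_ne_zero.2 hlt.ne') (add_left_cancel this))
  · ext y
    constructor
    · rintro ⟨t, rfl⟩
      exact ⟨_, hm t, rfl⟩
    · rintro ⟨t, ht, rfl⟩
      have hb : 0 < b - a := sub_pos.2 hlt
      refine ⟨⟨(t - a) / (b - a), div_nonneg (by linarith [ht.1]) hb.le,
        (div_le_one hb).2 (by linarith [ht.2])⟩, ?_⟩
      show γ (a + (t - a) / (b - a) * (b - a)) = γ t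
      rw [div_mul_cancel₀ _ hb.ne']
      congr 1
      ring

theorem of_path {γ : Path u v} (hγ : Function.Injective γ) : IsArc (range γ) u v := by
  refine ⟨0, 1, γ.extend, zero_le_one, γ.continuous_extend.continuousOn, ?_, by simp, by simp, ?_⟩
  · intro s hs t ht hst
    rw [γ.extend_apply hs, γ.extend_apply ht] at hst
    exact congrArg Subtype.val (hγ hst)
  · rw [γ.image_extend_of_subset subset_rfl]

theorem image {Y : Type*} [TopologicalSpace Y] (h : IsArc S u v) {f : X → Y} (hf : ContinuousOn f S)
    (hi : InjOn f S) : IsArc (f '' S) (f u) (f v) := by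
  obtain ⟨a, b, γ, hab, hc, hi', rfl, rfl, rfl⟩ := h
  refine ⟨a, b, f ∘ γ, hab, hf.comp hc (mapsTo_image _ _), ?_, rfl, rfl, by rw [image_comp]⟩
  exact hi.comp hi' (mapsTo_image _ _)

end IsArc

/-- In an open connected set, any two points are joined by an arc, provided this holds locally. -/
theorem exists_arc {X : Type*} [TopologicalSpace X] [T2Space X]
    (hX : ∀ x : X, ∀ N ∈ 𝓝 x, ∃ U ∈ 𝓝 x, ∀ y ∈ U, ∃ S ⊆ N, IsArc S x y) {O : Set X} (hO : IsOpen O)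
    (hc : IsPreconnected O) {u v : X} (hu : u ∈ O) (hv : v ∈ O) : ∃ S ⊆ O, IsArc S u v := by
  refine hc.induction₂ (fun u v => ∃ S ⊆ O, IsArc S u v) ?_ ?_ ?_ hu hv
  · intro x hx
    obtain ⟨U, hU, h⟩ := hX x O (hO.mem_nhds hx)
    exact eventually_nhdsWithin_of_eventually_nhds (mem_of_superset hU h)
  · rintro x y z - - - ⟨S, hS, h⟩ ⟨S', hS', h'⟩
    obtain ⟨S'', h1, h2⟩ := h.trans h'
    exact ⟨S'', h1.trans (union_subset hS hS'), h2⟩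
  · rintro x y - - ⟨S, hS, h⟩
    exact ⟨S, hS, h.symm⟩

theorem IsArc.segment (w z : ℂ) : IsArc (segment ℝ w z) w z := by
  rcases eq_or_ne w z with rfl | h
  · rw [segment_same]
    exact .refl w
  refine ⟨0, 1, fun t => w + t * (z - w), zero_le_one, by fun_prop, ?_, by simp, by simp, ?_⟩
  · intro s _ t _ hst
    have := mul_right_cancel₀ (sub_ne_zero.2 h.symm) (add_left_cancel hst)
    exact_mod_cast this
  · rw [segment_eq_image']
    simp

theorem IsSurface.exists_arc {X : Type*} [TopologicalSpace X] [T2Space X] (hX : IsSurface X)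
    {O : Set X} (hO : IsOpen O) (hc : IsPreconnected O) {u v : X} (hu : u ∈ O) (hv : v ∈ O) :
    ∃ S ⊆ O, IsArc S u v := by
  refine _root_.exists_arc ?_ hO hc hu hv
  intro x N hN
  obtain ⟨M, ψ, hM, hψ, hs⟩ := hX.exists_disc x hN
  refine ⟨_, hψ.mem_nhds hM.zero_mem, ?_⟩
  rintro _ ⟨z, hz, rfl⟩
  have hsub : segment ℝ 0 z ⊆ M ∩ ball 0 1 :=
    (hM.convex.inter (convex_ball 0 1)).segment_subset ⟨hM.zero_mem, mem_ball_self one_pos⟩ hz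
  refine ⟨ψ '' segment ℝ 0 z, (image_mono hsub).trans hs, ?_⟩
  have := (IsArc.segment 0 z).image (hψ.chart.cont.mono hsub) (hψ.chart.inj.mono hsub)
  rwa [hψ.zero] at this

theorem IsSurface.locallyPathConnectedSpace {X : Type*} [TopologicalSpace X] (hX : IsSurface X) :
    LocallyPathConnectedSpace X := by
  refine ⟨fun x => ⟨fun N => ⟨fun hN => ?_, fun ⟨U, hU, hs⟩ => mem_of_superset hU.1 hs⟩⟩⟩
  obtain ⟨M, ψ, hM, hψ, hs⟩ := hX.exists_disc x hN
  refine ⟨_, ⟨hψ.mem_nhds hM.zero_mem, ?_⟩, hs⟩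
  have : IsPathConnected (M ∩ ball (0 : ℂ) 1) :=
    (hM.convex.inter (convex_ball 0 1)).isPathConnected ⟨0, hM.zero_mem, mem_ball_self one_pos⟩
  exact this.image' hψ.chart.cont

/-! ## Arcs in one-dimensional manifolds -/

section OneManifold

variable {T : Type*} [TopologicalSpace T] {S S' P : Set T} {u v w p x y : T}

theorem IsArc.isPreconnected_diff_right (h : IsArc S u v) : IsPreconnected (S \ {v}) := by
  obtain ⟨a, b, γ, hab, hc, hi, rfl, rfl, rfl⟩ := h
  have : γ '' Icc a b \ {γ b} = γ '' Ico a b := by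
    rw [← image_singleton, ← hi.image_sdiff_subset (by simpa using hab), Icc_sdiff_right]
  rw [this]
  exact isPreconnected_Ico.image _ (hc.mono Ico_subset_Icc_self)

theorem isArc_uIcc (s t : ℝ) : IsArc (uIcc s t) s t := by
  rcases le_total s t with h | h
  · rw [uIcc_of_le h]
    exact ⟨s, t, id, h, continuousOn_id, injOn_id _, rfl, rfl, by simp⟩
  · rw [uIcc_of_ge h]
    exact IsArc.symm ⟨t, s, id, h, continuousOn_id, injOn_id _, rfl, rfl, by simp⟩

variable [T2Space T]

/-- Near one of its ends, an arc in a one-dimensional manifold covers exactly one side. -/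
theorem IsArc.exists_side (h : IsArc S u v) (huv : u ≠ v) {g : ℝ → T} (hg : IsChart (Ioo (-1) 1) g)
    (h0 : g 0 = v) : ∃ s : ℝ, (s = 1 ∨ s = -1) ∧ ∃ δ, 0 < δ ∧ δ ≤ 1 ∧
      ∀ t ∈ Ioo 0 δ, g (s * t) ∈ S ∧ g (-(s * t)) ∉ S := by
  obtain ⟨a, b, γ, hab, hc, hi, rfl, rfl, rfl⟩ := h
  have hlt : a < b := hab.lt_of_ne fun h => huv (by rw [h])
  have z0 : (0 : ℝ) ∈ Ioo (-1 : ℝ) 1 := by norm_num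
  have hV : g '' Ioo (-1) 1 ∈ 𝓝 (γ b) := hg.isOpen_range.mem_nhds ⟨0, z0, h0⟩
  obtain ⟨c, ⟨hac, hcb⟩, hcV⟩ : ∃ c ∈ Ico a b, ∀ r ∈ Icc c b, γ r ∈ g '' Ioo (-1) 1 := by
    have h1 : ∀ᶠ r in 𝓝[≤] b, γ r ∈ g '' Ioo (-1) 1 := by
      have := (hc b (right_mem_Icc.2 hab)).eventually_mem hV
      rwa [nhdsWithin_Icc_eq_nhdsLE hlt] at this
    obtain ⟨l, hl, hlV⟩ := mem_nhdsLE_iff_exists_Icc_subset.1 h1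
    refine ⟨max a l, ⟨le_max_left _ _, max_lt hlt hl⟩, fun r hr => hlV ⟨(le_max_right _ _).trans hr.1, hr.2⟩⟩
  have hcsub : Icc c b ⊆ Icc a b := Icc_subset_Icc_left hac
  set k := Function.invFunOn g (Ioo (-1) 1)
  have hfc : ContinuousOn (fun r => k (γ r)) (Icc c b) := hg.continuousOn_inv.comp (hc.mono hcsub) hcV
  have hgk : ∀ r ∈ Icc c b, g (k (γ r)) = γ r := fun r hr => hg.apply_inv (hcV r hr)
  have hfi : InjOn (fun r => k (γ r)) (Icc c b) := by
    intro r hr t ht hrt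
    have : g (k (γ r)) = g (k (γ t)) := congrArg g hrt
    rw [hgk r hr, hgk t ht] at this
    exact hi (hcsub hr) (hcsub ht) this
  have hb : k (γ b) = 0 := by rw [← h0]; exact hg.inv_apply z0
  obtain ⟨s, hs, hanti⟩ : ∃ s : ℝ, (s = 1 ∨ s = -1) ∧ StrictAntiOn (fun r => s * k (γ r)) (Icc c b) := by
    rcases hfc.strictMonoOn_of_injOn_Icc' hcb.le hfi with hm | hm
    · refine ⟨-1, Or.inr rfl, fun r hr t ht hrt => ?_⟩
      have := hm hr ht hrt
      simp only at this ⊢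
      linarith
    · refine ⟨1, Or.inl rfl, fun r hr t ht hrt => ?_⟩
      have := hm hr ht hrt
      simp only at this ⊢
      linarith
  have hss : s * s = 1 := by rcases hs with rfl | rfl <;> norm_num
  have hpos : 0 < s * k (γ c) := by
    have := hanti (left_mem_Icc.2 hcb.le) (right_mem_Icc.2 hcb.le) hcb
    simpa [hb] using this
  have hncl : γ b ∉ γ '' Icc a c := by
    rintro ⟨r, hr, hrb⟩
    have := hi ⟨hr.1, hr.2.trans hcb.le⟩ (right_mem_Icc.2 hab) hrb
    linarith [hr.2]
  have hcl : IsClosed (γ '' Icc a c) :=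
    (isCompact_Icc.image_of_continuousOn (hc.mono (Icc_subset_Icc_right hcb.le))).isClosed
  have h2 : ∀ᶠ t in 𝓝 (0 : ℝ), g t ∉ γ '' Icc a c := by
    have hca : ContinuousAt g 0 := hg.cont.continuousAt (Ioo_mem_nhds z0.1 z0.2)
    exact hca.eventually_mem (by rw [h0]; exact hcl.isOpen_compl.mem_nhds hncl)
  obtain ⟨ε, hε, hε2⟩ := Metric.eventually_nhds_iff.1 h2
  refine ⟨s, hs, min (s * k (γ c)) (min ε 1), by positivity,
    (min_le_right _ _).trans (min_le_right _ _), ?_⟩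
  rintro t ⟨ht0, htd⟩
  have ht1 := htd.trans_le (min_le_left _ _)
  have ht2 := htd.trans_le ((min_le_right _ _).trans (min_le_left _ _))
  have ht3 := htd.trans_le ((min_le_right _ _).trans (min_le_right _ _))
  have hst : |s * t| = t := by rcases hs with rfl | rfl <;> simp [abs_of_pos ht0]
  constructor
  · have hmem : t ∈ Icc (s * k (γ b)) (s * k (γ c)) := by rw [hb]; exact ⟨by simpa using ht0.le, ht1.le⟩
    obtain ⟨r, hr, hrt⟩ := intermediate_value_Icc' hcb.le (continuousOn_const.mul hfc) hmem
    have h3 : s * k (γ r) = t := hrt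
    refine ⟨r, hcsub hr, ?_⟩
    rw [← h3, ← mul_assoc, hss, one_mul, hgk r hr]
  · rintro ⟨r, hr, hrt⟩
    rcases le_total r c with hrc | hrc
    · refine hε2 (y := -(s * t)) ?_ ⟨r, ⟨hr.1, hrc⟩, hrt⟩
      rw [Real.dist_eq, sub_zero, abs_neg, hst]
      exact ht2
    · have hr' : r ∈ Icc c b := ⟨hrc, hr.2⟩
      have h4 : k (γ r) = -(s * t) := by
        rw [hrt]
        refine hg.inv_apply ?_
        rw [mem_Ioo, ← abs_lt, abs_neg, hst]
        exact ht3
      have h5 := hanti.antitoneOn hr' (right_mem_Icc.2 hcb.le) hr.2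
      simp only [h4, hb] at h5
      have : s * -(s * t) = -(s * s) * t := by ring
      rw [this, hss] at h5
      linarith

theorem IsArc.mem_nhds
    (hT : ∀ x : T, ∃ g : ℝ → T, IsChart (Ioo (-1) 1) g ∧ g 0 = x)
    (h : IsArc S u v) (hp : p ∈ S) (hpu : p ≠ u) (hpv : p ≠ v) : S ∈ 𝓝 p := by
  obtain ⟨S₁, S₂, h1, h2, h3, h4⟩ := h.split hp
  obtain ⟨g, hg, h0⟩ := hT p
  obtain ⟨s, hs, δ, hδ, hδ1, H⟩ := h1.exists_side hpu.symm hg h0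
  obtain ⟨s', hs', δ', hδ', hδ1', H'⟩ := h2.symm.exists_side hpv.symm hg h0
  have hss : s' = -s := by
    set t := min δ δ' / 2
    have htp : 0 < min δ δ' := lt_min hδ hδ'
    have ht : t ∈ Ioo 0 δ := ⟨by positivity, by linarith [min_le_left δ δ', show t = min δ δ' / 2 from rfl]⟩
    have ht' : t ∈ Ioo 0 δ' := ⟨by positivity, by linarith [min_le_right δ δ', show t = min δ δ' / 2 from rfl]⟩
    by_contra hne
    have : s' = s := by
      rcases hs with rfl | rfl <;> rcases hs' with rfl | rfl <;> first | rfl | (exfalso; apply hne; norm_num)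
    subst this
    have hm : g (s' * t) ∈ S₁ ∩ S₂ := ⟨(H t ht).1, (H' t ht').1⟩
    rw [h4, mem_singleton_iff, ← h0] at hm
    have hst : |s' * t| = t := by rcases hs with rfl | rfl <;> simp [abs_of_pos ht.1]
    have := hg.inj (by rw [mem_Ioo, ← abs_lt, hst]; linarith [ht.2]) (by norm_num) hm
    rw [this] at hst
    simp at hst
    exact ht.1.ne hst
  have hsub : g '' (Ioo (-1) 1 ∩ Ioo (-(min δ δ')) (min δ δ')) ⊆ S := by
    rintro _ ⟨r, ⟨-, hr⟩, rfl⟩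
    rw [← h3]
    rcases lt_trichotomy (s * r) 0 with hlt | heq | hgt
    · right
      have := (H' |r| ⟨abs_pos.2 (by rintro rfl; simp at hlt),
        (abs_lt.2 hr).trans_le (min_le_right _ _)⟩).1
      convert this using 2
      rcases hs with rfl | rfl
      · rw [hss, abs_of_neg (by linarith)]; ring
      · rw [hss, abs_of_pos (by linarith)]; ring
    · have : r = 0 := by rcases hs with rfl | rfl <;> linarith
      rw [this, h0]
      exact Or.inl h1.right_mem
    · left
      have := (H |r| ⟨abs_pos.2 (by rintro rfl; simp at hgt),
        (abs_lt.2 hr).trans_le (min_le_left _ _)⟩).1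
      convert this using 2
      rcases hs with rfl | rfl
      · rw [abs_of_pos (by linarith)]; ring
      · rw [abs_of_neg (by linarith)]; ring
  refine mem_of_superset ((hg.isOpen_image _ isOpen_Ioo).mem_nhds ⟨0, ⟨by norm_num, ?_⟩, h0⟩) hsub
  have := lt_min hδ hδ'
  exact ⟨by linarith, this⟩

theorem IsArc.exists_extension
    (hT : ∀ x : T, ∃ g : ℝ → T, IsChart (Ioo (-1) 1) g ∧ g 0 = x)
    (h : IsArc S u v) (huv : u ≠ v) :
    ∃ S' v', IsArc S' v v' ∧ v' ≠ v ∧ S ∩ S' ⊆ {v} := by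
  obtain ⟨g, hg, h0⟩ := hT v
  obtain ⟨s, hs, δ, hδ, hδ1, H⟩ := h.exists_side huv hg h0
  have habs : ∀ r : ℝ, |s * r| = |r| := fun r => by rcases hs with rfl | rfl <;> simp
  have hsub : uIcc 0 (-(s * (δ / 2))) ⊆ Ioo (-1 : ℝ) 1 := by
    have h1 : (0 : ℝ) ∈ Ioo (-1 : ℝ) 1 := by norm_num
    have h2 : -(s * (δ / 2)) ∈ Ioo (-1 : ℝ) 1 := by
      rw [mem_Ioo, ← abs_lt, abs_neg, habs, abs_of_pos (by positivity)]
      linarith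
    exact ordConnected_Ioo.uIcc_subset h1 h2
  refine ⟨g '' uIcc 0 (-(s * (δ / 2))), g (-(s * (δ / 2))), ?_, ?_, ?_⟩
  · have := (isArc_uIcc 0 (-(s * (δ / 2)))).image (hg.cont.mono hsub) (hg.inj.mono hsub)
    rwa [h0] at this
  · rw [← h0]
    intro he
    have := hg.inj (hsub right_mem_uIcc) (hsub left_mem_uIcc) he
    have h3 := habs (δ / 2)
    rw [neg_eq_zero.1 this, abs_zero, abs_of_pos (half_pos hδ)] at h3
    linarith
  · rintro _ ⟨hS, r, hr, rfl⟩
    rw [mem_singleton_iff, ← h0]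
    by_contra hne
    have hr0 : r ≠ 0 := fun h => hne (by rw [h])
    have hr1 : r = -(s * |r|) ∧ |r| ≤ δ / 2 := by
      rcases hs with rfl | rfl
      · rw [uIcc_of_ge (by linarith)] at hr
        rw [abs_of_nonpos hr.2]
        exact ⟨by ring, by linarith [hr.1]⟩
      · rw [uIcc_of_le (by linarith)] at hr
        rw [abs_of_nonneg hr.1]
        exact ⟨by ring, by linarith [hr.2]⟩
    have := (H |r| ⟨abs_pos.2 hr0, by linarith [hr1.2]⟩).2
    rw [← hr1.1] at this
    exact this hS

end OneManifold

section Circle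

variable {T : Type*} [TopologicalSpace T] [T2Space T] {S S' P A B C : Set T} {v v' x y : T}

theorem IsArc.isOpen_diff
    (hT : ∀ x : T, ∃ g : ℝ → T, IsChart (Ioo (-1) 1) g ∧ g 0 = x)
    (h : IsArc S x v) : IsOpen (S \ {x, v}) := by
  rw [isOpen_iff_mem_nhds]
  rintro p ⟨hp, hn⟩
  simp only [mem_insert_iff, mem_singleton_iff, not_or] at hn
  refine inter_mem (h.mem_nhds hT hp hn.1 hn.2) ?_
  exact ((finite_singleton v).insert x).isClosed.isOpen_compl.mem_nhds (by simpa using hn)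

theorem IsArc.subset_of_isPreconnected
    (hT : ∀ x : T, ∃ g : ℝ → T, IsChart (Ioo (-1) 1) g ∧ g 0 = x)
    (hP : IsArc P x y) (hxy : x ≠ y) (hS : IsArc S' x v')
    (hPS : P ∩ S' ⊆ {x}) (hC : IsPreconnected C) (hx : x ∈ C) (hv : v' ∉ C) (hPC : P ∩ C ⊆ {x}) :
    C ⊆ S' := by
  have hR : IsArc (P ∪ S') y v' := hP.symm.concat hS hPS
  have hyC : y ∉ C := fun h => hxy (hPC ⟨hP.right_mem, h⟩).symm
  have key : C ⊆ (P ∪ S') \ {y, v'} := by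
    refine hC.subset_of_closure_inter_subset (hR.isOpen_diff hT) ⟨x, hx, Or.inl hP.left_mem, ?_⟩ ?_
    · simp only [mem_insert_iff, mem_singleton_iff, not_or]
      exact ⟨hxy, fun h => hv (h ▸ hx)⟩
    · rintro c ⟨hc, hcC⟩
      refine ⟨closure_minimal sdiff_subset hR.isCompact.isClosed hc, ?_⟩
      simp only [mem_insert_iff, mem_singleton_iff, not_or]
      exact ⟨fun h => hyC (h ▸ hcC), fun h => hv (h ▸ hcC)⟩
  intro c hc
  rcases (key hc).1 with h | h
  · rw [show c = x from hPC ⟨h, hc⟩]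
    exact hS.left_mem
  · exact h

theorem IsArc.total
    (hT : ∀ x : T, ∃ g : ℝ → T, IsChart (Ioo (-1) 1) g ∧ g 0 = x)
    (hP : IsArc P x y) (hxy : x ≠ y) (hS : IsArc S x v) (hPS : P ∩ S ⊆ {x})
    (hS' : IsArc S' x v') (hPS' : P ∩ S' ⊆ {x}) : S ⊆ S' ∨ S' ⊆ S := by
  by_cases hv : v' ∈ S
  · right
    by_cases hx : x = v'
    · subst hx
      rw [hS'.eq_singleton]
      exact singleton_subset_iff.2 hS.left_mem
    obtain ⟨S₁, S₂, h1, -, h3, -⟩ := hS.split hv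
    have hs : S₁ ⊆ S := h3 ▸ subset_union_left
    have := hP.subset_of_isPreconnected hT hxy h1 ((inter_subset_inter_right _ hs).trans hPS)
      hS'.isPreconnected_diff_right ⟨hS'.left_mem, hx⟩ (fun h => h.2 rfl)
      ((inter_subset_inter_right _ sdiff_subset).trans hPS')
    intro c hc
    by_cases hcv : c = v'
    · exact hcv ▸ hv
    · exact hs (this ⟨hc, hcv⟩)
  · left
    exact hP.subset_of_isPreconnected hT hxy hS' hPS' hS.isConnected.isPreconnected hS.left_mem hv hPS

theorem IsArc.exists_longer
    (hT : ∀ x : T, ∃ g : ℝ → T, IsChart (Ioo (-1) 1) g ∧ g 0 = x)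
    (hP : IsArc P x y) (hxy : x ≠ y) (hS : IsArc S x v) (hPS : P ∩ S ⊆ {x}) :
    ∃ S' v', IsArc S' x v' ∧ P ∩ S' ⊆ {x} ∧ v' ∉ P ∪ S ∧ P ∪ S' ∈ 𝓝 v := by
  have hR : IsArc (P ∪ S) y v := hP.symm.concat hS hPS
  have hyv : y ≠ v := fun h => hxy (hPS ⟨hP.right_mem, h ▸ hS.right_mem⟩).symm
  obtain ⟨E, v', hE, hne, hd⟩ := hR.exists_extension hT hyv
  have h1 : P ∩ (S ∪ E) ⊆ {x} := by
    rintro p ⟨hp, h | h⟩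
    · exact hPS ⟨hp, h⟩
    · have hpv : p = v := hd ⟨Or.inl hp, h⟩
      exact hPS ⟨hp, hpv ▸ hS.right_mem⟩
  have h2 : IsArc (S ∪ E) x v' := hS.concat hE fun p hp => hd ⟨Or.inr hp.1, hp.2⟩
  refine ⟨S ∪ E, v', h2, h1, fun h => hne (hd ⟨h, hE.right_mem⟩), ?_⟩
  exact (hP.symm.concat h2 h1).mem_nhds hT (Or.inr (Or.inl hS.right_mem)) hyv.symm hne.symm

theorem IsArc.false_of_split
    (hT : ∀ x : T, ∃ g : ℝ → T, IsChart (Ioo (-1) 1) g ∧ g 0 = x)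
    [CompactSpace T] (hP : IsArc P x y) (hxy : x ≠ y) (hA : IsClosed A)
    (hB : IsClosed B) (hAB : Disjoint A B) (hu : P ∪ (A ∪ B) = univ) (hPA : P ∩ A = {x}) :
    False := by
  have hxA : x ∈ A := (hPA.symm ▸ mem_singleton x : x ∈ P ∩ A).2
  set K : Set T := {w | ∃ S, IsArc S x w ∧ P ∩ S ⊆ {x}} with hK
  have hxK : x ∈ K := ⟨{x}, .refl x, inter_subset_right⟩
  have hKA : ∀ {S w}, IsArc S x w → P ∩ S ⊆ {x} → S ⊆ A := by
    intro S w hS hPS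
    have hsub : S ⊆ A ∪ B := by
      intro s hs
      rcases (hu.symm ▸ mem_univ s : s ∈ P ∪ (A ∪ B)) with h | h
      · exact Or.inl ((hPS ⟨h, hs⟩ : s = x) ▸ hxA)
      · exact h
    rcases isPreconnected_iff_subset_of_disjoint_closed.1 hS.isConnected.isPreconnected A B hA hB hsub
      (by rw [hAB.inter_eq, inter_empty]) with h | h
    · exact h
    · exact (disjoint_left.1 hAB hxA (h hS.left_mem)).elim
  have hcl : IsClosed K := by
    refine isClosed_of_closure_subset fun w hw => ?_
    have hwA : w ∈ A := by
      refine closure_minimal ?_ hA hw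
      rintro k ⟨S, hS, hPS⟩
      exact hKA hS hPS hS.right_mem
    by_cases hwx : w = x
    · exact hwx ▸ hxK
    have hwP : w ∉ P := fun h => hwx (hPA.subset ⟨h, hwA⟩)
    obtain ⟨g, hg, h0⟩ := hT w
    have hev : ∀ᶠ t in 𝓝 (0 : ℝ), g t ∈ Pᶜ :=
      (hg.cont.continuousAt (Ioo_mem_nhds (by norm_num) (by norm_num))).eventually_mem
        (by rw [h0]; exact hP.isCompact.isClosed.isOpen_compl.mem_nhds hwP)
    obtain ⟨ε, hε, hεP⟩ := Metric.eventually_nhds_iff.1 hev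
    set r := min ε 1 / 2
    have hr : 0 < r := by positivity
    have hrε : r < ε := by
      have := min_le_left ε 1
      have h2 : r = min ε 1 / 2 := rfl
      linarith
    have hr1 : r < 1 := by
      have := min_le_right ε 1
      have h2 : r = min ε 1 / 2 := rfl
      linarith
    have hI : Icc (-r) r ⊆ Ioo (-1) 1 := fun t ht => ⟨by linarith [ht.1], by linarith [ht.2]⟩
    have hIP : ∀ t ∈ Icc (-r) r, g t ∉ P := fun t ht =>
      hεP (by rw [Real.dist_eq, sub_zero]; exact (abs_le.2 ht).trans_lt hrε)
    have hN : g '' (Ioo (-1) 1 ∩ Ioo (-r) r) ∈ 𝓝 w :=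
      (hg.isOpen_image _ isOpen_Ioo).mem_nhds ⟨0, ⟨by norm_num, by linarith, hr⟩, h0⟩
    obtain ⟨w', ⟨t, ht, rfl⟩, S, hS, hPS⟩ := mem_closure_iff_nhds.1 hw _ hN
    have hcK : IsClosed (g '' Icc (-r) r) :=
      (isCompact_Icc.image_of_continuousOn (hg.cont.mono hI)).isClosed
    obtain ⟨p, S₁, S₂, h1, -, h3, -, h5⟩ := hS.exists_first hcK
      ⟨g t, hS.right_mem, mem_image_of_mem _ (Ioo_subset_Icc_self ht.2)⟩
    obtain ⟨t', ht', htp⟩ : p ∈ g '' Icc (-r) r := (h5.symm ▸ mem_singleton p : p ∈ S₁ ∩ _).2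
    have hsub : uIcc t' 0 ⊆ Icc (-r) r := ordConnected_Icc.uIcc_subset ht' ⟨by linarith, hr.le⟩
    have h6 := (isArc_uIcc t' 0).image (hg.cont.mono (hsub.trans hI)) (hg.inj.mono (hsub.trans hI))
    rw [htp, h0] at h6
    refine ⟨_, h1.concat h6 ?_, ?_⟩
    · rw [← h5]
      exact inter_subset_inter_right _ (image_mono hsub)
    · rintro q ⟨hq, h | ⟨s, hs, rfl⟩⟩
      · exact hPS ⟨hq, h3 ▸ Or.inl h⟩
      · exact (hIP s (hsub hs) hq).elim
  obtain ⟨S, v, hS, hPS, hKS⟩ : ∃ S v, IsArc S x v ∧ P ∩ S ⊆ {x} ∧ K ⊆ P ∪ S := by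
    refine hcl.isCompact.induction_on (p := fun s => ∃ S v, IsArc S x v ∧ P ∩ S ⊆ {x} ∧ s ⊆ P ∪ S)
      ⟨{x}, x, .refl x, inter_subset_right, empty_subset _⟩ ?_ ?_ ?_
    · rintro s t hst ⟨S, v, h1, h2, h3⟩
      exact ⟨S, v, h1, h2, hst.trans h3⟩
    · rintro s t ⟨S, v, h1, h2, h3⟩ ⟨S', v', h1', h2', h3'⟩
      rcases hP.total hT hxy h1 h2 h1' h2' with h | h
      · exact ⟨S', v', h1', h2', union_subset (h3.trans (union_subset_union_right _ h)) h3'⟩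
      · exact ⟨S, v, h1, h2, union_subset h3 (h3'.trans (union_subset_union_right _ h))⟩
    · rintro k ⟨S, hS, hPS⟩
      obtain ⟨S', v', h1, h2, -, h4⟩ := hP.exists_longer hT hxy hS hPS
      exact ⟨_, mem_nhdsWithin_of_mem_nhds h4, S', v', h1, h2, subset_rfl⟩
  obtain ⟨S', v', h1, h2, h3, -⟩ := hP.exists_longer hT hxy hS hPS
  exact h3 (hKS ⟨S', h1, h2⟩)

/-- Two points of a compact connected one-dimensional manifold split it into an arc and a
complementary connected closed set. -/
theorem exists_circle_split
    (hT : ∀ x : T, ∃ g : ℝ → T, IsChart (Ioo (-1) 1) g ∧ g 0 = x)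
    [CompactSpace T] [ConnectedSpace T] (hxy : x ≠ y) :
    ∃ P Q : Set T, IsArc P x y ∧ IsClosed Q ∧ IsPreconnected Q ∧ P ∪ Q = univ ∧ P ∩ Q = {x, y} := by
  have hloc : ∀ x : T, ∀ N ∈ 𝓝 x, ∃ U ∈ 𝓝 x, ∀ y ∈ U, ∃ S ⊆ N, IsArc S x y := by
    intro x N hN
    obtain ⟨g, hg, h0⟩ := hT x
    have hev : ∀ᶠ t in 𝓝 (0 : ℝ), g t ∈ N :=
      (hg.cont.continuousAt (Ioo_mem_nhds (by norm_num) (by norm_num))).eventually_mem (by rwa [h0])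
    obtain ⟨ε, hε, hεN⟩ := Metric.eventually_nhds_iff_ball.1 hev
    refine ⟨g '' (Ioo (-1) 1 ∩ ball 0 ε),
      (hg.isOpen_image _ isOpen_ball).mem_nhds ⟨0, ⟨by norm_num, mem_ball_self hε⟩, h0⟩, ?_⟩
    rintro _ ⟨t, ht, rfl⟩
    have hsub : uIcc 0 t ⊆ Ioo (-1) 1 ∩ ball 0 ε := by
      rw [Real.ball_eq_Ioo] at ht ⊢
      exact (ordConnected_Ioo.inter ordConnected_Ioo).uIcc_subset ⟨by norm_num, by simpa⟩ ht
    refine ⟨g '' uIcc 0 t, ?_, ?_⟩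
    · rintro _ ⟨s, hs, rfl⟩
      exact hεN _ (hsub hs).2
    · have := (isArc_uIcc 0 t).image (hg.cont.mono (hsub.trans inter_subset_left))
        (hg.inj.mono (hsub.trans inter_subset_left))
      rwa [h0] at this
  obtain ⟨P, -, hP⟩ := exists_arc hloc isOpen_univ isPreconnected_univ (mem_univ x) (mem_univ y)
  have hQ : IsClosed (P \ {x, y})ᶜ := (hP.isOpen_diff hT).isClosed_compl
  have hPQ : P ∩ (P \ {x, y})ᶜ = {x, y} := by
    ext p
    simp only [mem_inter_iff, mem_compl_iff, Set.mem_sdiff, not_and, not_not]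
    constructor
    · exact fun h => h.2 h.1
    · intro h
      refine ⟨?_, fun _ => h⟩
      rcases h with rfl | rfl
      exacts [hP.left_mem, hP.right_mem]
  have hu : P ∪ (P \ {x, y})ᶜ = univ := by
    ext p
    by_cases hp : p ∈ P <;> simp [hp]
  refine ⟨P, (P \ {x, y})ᶜ, hP, hQ, ?_, hu, hPQ⟩
  set Q := (P \ {x, y})ᶜ
  have hxQ : x ∈ P ∩ Q := hPQ ▸ mem_insert x _
  have hyQ : y ∈ P ∩ Q := hPQ ▸ mem_insert_of_mem x rfl
  rw [isPreconnected_closed_iff]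
  intro t t' ht ht' hsub hn hn'
  by_contra hemp
  rw [not_nonempty_iff_eq_empty] at hemp
  have hd : ∀ q ∈ Q, q ∈ t → q ∉ t' := fun q h1 h2 h3 => by
    have : q ∈ Q ∩ (t ∩ t') := ⟨h1, h2, h3⟩
    rw [hemp] at this
    exact this
  have hdisj : Disjoint (Q ∩ t) (Q ∩ t') :=
    disjoint_left.2 fun q h1 h2 => hd q h1.1 h1.2 h2.2
  have hcov : Q = Q ∩ t ∪ Q ∩ t' := by rw [← inter_union_distrib_left, inter_eq_left.2 hsub]
  have same : ∀ A B : Set T, IsClosed A → IsClosed B → Disjoint A B → Q = A ∪ B → B.Nonempty →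
      x ∈ A → y ∈ A → False := by
    intro A B hA hB hAB hAQ hBn hx hy
    have h1 : (univ : Set T) ⊆ (P ∪ A) ∪ B := by rw [union_assoc, ← hAQ, hu]
    have h2 := isPreconnected_closed_iff.1 (isPreconnected_univ (α := T)) (P ∪ A) B
      (hP.isCompact.isClosed.union hA) hB h1 (by rw [univ_inter]; exact ⟨x, Or.inr hx⟩)
      (by rw [univ_inter]; exact hBn)
    obtain ⟨b, -, hb | hb, hb'⟩ := h2
    · have : b ∈ P ∩ Q := ⟨hb, hAQ ▸ Or.inr hb'⟩
      rw [hPQ] at this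
      rcases this with rfl | rfl
      exacts [disjoint_left.1 hAB hx hb', disjoint_left.1 hAB hy hb']
    · exact disjoint_left.1 hAB hb hb'
  have opp : ∀ A B : Set T, IsClosed A → IsClosed B → Disjoint A B → Q = A ∪ B →
      x ∈ A → y ∈ B → False := by
    intro A B hA hB hAB hAQ hx hy
    refine hP.false_of_split hT hxy hA hB hAB (by rw [← hAQ, hu]) ?_
    refine subset_antisymm ?_ (singleton_subset_iff.2 ⟨hP.left_mem, hx⟩)
    rintro p ⟨hp, hpA⟩
    have : p ∈ P ∩ Q := ⟨hp, hAQ ▸ Or.inl hpA⟩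
    rw [hPQ] at this
    rcases this with rfl | rfl
    · rfl
    · exact (disjoint_left.1 hAB hpA hy).elim
  have hA := hQ.inter ht
  have hB := hQ.inter ht'
  have hcov' : Q = Q ∩ t' ∪ Q ∩ t := by rw [union_comm, ← hcov]
  rcases hcov.subset hxQ.2 with hx | hx <;> rcases hcov.subset hyQ.2 with hy | hy
  · exact same _ _ hA hB hdisj hcov hn' hx hy
  · exact opp _ _ hA hB hdisj hcov hx hy
  · exact opp _ _ hB hA hdisj.symm hcov' hx hy
  · exact same _ _ hB hA hdisj.symm hcov' hn hx hy

end Circle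

/-! ## Boundary circles -/

section BoundaryCircle

variable {X : Type*} [TopologicalSpace X]

theorem ofReal_mem_upperHalf (t : ℝ) : (t : ℂ) ∈ upperHalf := by
  show 0 ≤ (t : ℂ).im
  simp

theorem ofReal_mem_ball {t : ℝ} (ht : t ∈ Ioo (-1 : ℝ) 1) : (t : ℂ) ∈ ball (0 : ℂ) 1 := by
  rw [mem_ball_zero_iff, Complex.norm_real, Real.norm_eq_abs, abs_lt]
  exact ht

theorem IsDiscAt.exists_boundary_chart {ψ : ℂ → X} {p x : X} (h : IsDiscAt upperHalf ψ p)
    (hp : p ∈ connectedComponentIn (surfaceBoundary X) x) :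
    ∃ g : ℝ → connectedComponentIn (surfaceBoundary X) x, IsChart (Ioo (-1) 1) g ∧
      (g 0 : X) = p ∧ ∀ t ∈ Ioo (-1 : ℝ) 1, (g t : X) = ψ t := by
  classical
  have hmem : ∀ t ∈ Ioo (-1 : ℝ) 1, (t : ℂ) ∈ upperHalf ∩ ball (0 : ℂ) 1 := fun t ht =>
    ⟨ofReal_mem_upperHalf t, ofReal_mem_ball ht⟩
  have hcont : ContinuousOn (fun t : ℝ => ψ t) (Ioo (-1 : ℝ) 1) :=
    h.chart.cont.comp (by fun_prop) hmem
  have hb : ∀ t ∈ Ioo (-1 : ℝ) 1, ψ t ∈ connectedComponentIn (surfaceBoundary X) x := by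
    intro t ht
    have hpre : IsPreconnected ((fun t : ℝ => ψ t) '' Ioo (-1 : ℝ) 1) :=
      isPreconnected_Ioo.image _ hcont
    rw [connectedComponentIn_eq hp]
    refine hpre.subset_connectedComponentIn ⟨0, by norm_num, by simpa using h.zero⟩ ?_ ⟨t, ht, rfl⟩
    rintro _ ⟨s, hs, rfl⟩
    exact (h.mem_surfaceBoundary_iff (hmem s hs)).2 (by simp)
  set g : ℝ → connectedComponentIn (surfaceBoundary X) x :=
    fun t => if ht : t ∈ Ioo (-1 : ℝ) 1 then ⟨ψ t, hb t ht⟩ else ⟨p, hp⟩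
  have hg : ∀ t ∈ Ioo (-1 : ℝ) 1, (g t : X) = ψ t := fun t ht => by simp only [g, dif_pos ht]
  refine ⟨g, ⟨?_, ?_, ?_⟩, ?_, hg⟩
  · rw [IsInducing.subtypeVal.continuousOn_iff]
    exact hcont.congr hg
  · intro s hs t ht hst
    have := congrArg Subtype.val hst
    rw [hg s hs, hg t ht] at this
    exact_mod_cast h.chart.inj (hmem s hs) (hmem t ht) this
  · intro O hO
    have : g '' (Ioo (-1) 1 ∩ O) =
        Subtype.val ⁻¹' (ψ '' (upperHalf ∩ ball 0 1 ∩ Complex.re ⁻¹' O)) := by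
      ext q
      constructor
      · rintro ⟨t, ⟨ht, htO⟩, rfl⟩
        exact ⟨t, ⟨hmem t ht, by simpa using htO⟩, (hg t ht).symm⟩
      · rintro ⟨z, ⟨hz, hzO⟩, hzq⟩
        have him : z.im = 0 := by
          rw [← h.mem_surfaceBoundary_iff hz, hzq]
          exact connectedComponentIn_subset _ _ q.2
        have hzr : ((z.re : ℝ) : ℂ) = z := Complex.ext (by simp) (by simp [him])
        have hzI : z.re ∈ Ioo (-1 : ℝ) 1 := by
          have := hz.2
          rw [← hzr, mem_ball_zero_iff, Complex.norm_real, Real.norm_eq_abs, abs_lt] at this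
          exact this
        refine ⟨z.re, ⟨hzI, hzO⟩, Subtype.ext ?_⟩
        rw [hg _ hzI, hzr, hzq]
    rw [this]
    exact (h.chart.isOpen_image _ (hO.preimage Complex.continuous_re)).preimage continuous_subtype_val
  · rw [hg 0 (by norm_num)]
    simpa using h.zero

theorem IsSurface.exists_boundary_split [CompactSpace X] [T2Space X] (hX : IsSurface X) {x y : X}
    (hx : x ∈ surfaceBoundary X) (hy : y ∈ connectedComponentIn (surfaceBoundary X) x)
    (hxy : x ≠ y) : ∃ P Q : Set X, IsClosed P ∧ IsClosed Q ∧ IsPreconnected P ∧ IsPreconnected Q ∧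
      P ∪ Q = connectedComponentIn (surfaceBoundary X) x ∧ P ∩ Q = {x, y} ∧
      ∀ p ∈ ({x, y} : Set X), ∀ ψ, IsDiscAt upperHalf ψ p → ∃ s : ℝ, (s = 1 ∨ s = -1) ∧ ∃ δ, 0 < δ ∧
        δ ≤ 1 ∧ ∀ t ∈ Ioo 0 δ, (ψ ((s * t : ℝ) : ℂ) ∈ P ∧ ψ ((s * t : ℝ) : ℂ) ∉ Q) ∧
          ψ ((-(s * t) : ℝ) : ℂ) ∈ Q ∧ ψ ((-(s * t) : ℝ) : ℂ) ∉ P := by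
  set b := connectedComponentIn (surfaceBoundary X) x with hbdef
  have hxb : x ∈ b := mem_connectedComponentIn hx
  have hbcl : IsClosed b := by
    refine isClosed_of_closure_subset ?_
    refine isPreconnected_connectedComponentIn.closure.subset_connectedComponentIn
      (subset_closure hxb) (closure_minimal (connectedComponentIn_subset _ _) isClosed_surfaceBoundary)
  have : CompactSpace b := isCompact_iff_compactSpace.1 hbcl.isCompact
  have : ConnectedSpace b := isConnected_iff_connectedSpace.1 (isConnected_connectedComponentIn_iff.2 hx)
  have hT : ∀ p : b, ∃ g : ℝ → b, IsChart (Ioo (-1) 1) g ∧ g 0 = p := by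
    intro p
    obtain ⟨ψ, hψ, -⟩ := hX.exists_disc_of_mem_surfaceBoundary
      (connectedComponentIn_subset _ _ p.2) (univ_mem (α := X))
    obtain ⟨g, hg, h0, -⟩ := hψ.exists_boundary_chart p.2
    exact ⟨g, hg, Subtype.ext h0⟩
  have hxy' : (⟨x, hxb⟩ : b) ≠ ⟨y, hy⟩ := fun h => hxy (congrArg Subtype.val h)
  obtain ⟨P, Q, hP, hQ, hQc, hu, hi⟩ := exists_circle_split hT hxy'
  have himg : ∀ S : Set b, IsClosed S → IsClosed (Subtype.val '' S) := fun S hS =>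
    hbcl.isClosedEmbedding_subtypeVal.isClosedMap S hS
  have hi' : Subtype.val '' P ∩ Subtype.val '' Q = {x, y} := by
    rw [← image_inter Subtype.val_injective, hi, image_insert_eq, image_singleton]
  refine ⟨Subtype.val '' P, Subtype.val '' Q, himg P hP.isCompact.isClosed, himg Q hQ,
    hP.isConnected.isPreconnected.image _ continuous_subtype_val.continuousOn,
    hQc.image _ continuous_subtype_val.continuousOn, ?_, hi', ?_⟩
  · rw [← image_union, hu, image_univ, Subtype.range_coe]
  intro p hp ψ hψ
  have hpb : p ∈ b := by
    rcases hp with rfl | rfl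
    exacts [hxb, hy]
  obtain ⟨g, hg, h0, hgψ⟩ := hψ.exists_boundary_chart hpb
  have h0' : g 0 = ⟨p, hpb⟩ := Subtype.ext h0
  obtain ⟨s, hs, δ, hδ, hδ1, H⟩ : ∃ s : ℝ, (s = 1 ∨ s = -1) ∧ ∃ δ, 0 < δ ∧ δ ≤ 1 ∧
      ∀ t ∈ Ioo 0 δ, g (s * t) ∈ P ∧ g (-(s * t)) ∉ P := by
    rcases hp with rfl | rfl
    · exact hP.symm.exists_side hxy'.symm hg h0'
    · exact hP.exists_side hxy' hg h0'
  have hfin : IsClosed (({x, y} : Set X) \ {p}) :=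
    (((finite_singleton y).insert x).subset sdiff_subset).isClosed
  have hev : ∀ᶠ t in 𝓝 (0 : ℝ), (g t : X) ∈ (({x, y} : Set X) \ {p})ᶜ := by
    have hca : ContinuousAt (fun t => (g t : X)) 0 :=
      continuous_subtype_val.continuousAt.comp
        (hg.cont.continuousAt (Ioo_mem_nhds (by norm_num) (by norm_num)))
    refine hca.eventually_mem (hfin.isOpen_compl.mem_nhds ?_)
    rw [h0]
    exact fun h => h.2 rfl
  obtain ⟨ε, hε, hεN⟩ := Metric.eventually_nhds_iff.1 hev
  refine ⟨s, hs, min δ ε, lt_min hδ hε, (min_le_left _ _).trans hδ1, ?_⟩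
  rintro t ⟨ht0, ht1⟩
  have htδ := ht1.trans_le (min_le_left _ _)
  have htε := ht1.trans_le (min_le_right _ _)
  have habs : |s * t| = t := by rcases hs with rfl | rfl <;> simp [abs_of_pos ht0]
  have hI : s * t ∈ Ioo (-1 : ℝ) 1 := by rw [mem_Ioo, ← abs_lt, habs]; linarith
  have hI' : -(s * t) ∈ Ioo (-1 : ℝ) 1 := by rw [mem_Ioo, ← abs_lt, abs_neg, habs]; linarith
  rw [← hgψ _ hI, ← hgψ _ hI']
  obtain ⟨H1, H2⟩ := H t ⟨ht0, htδ⟩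
  refine ⟨⟨mem_image_of_mem _ H1, fun hQ' => ?_⟩, mem_image_of_mem _ ?_, ?_⟩
  · have hm : (g (s * t) : X) ∈ ({x, y} : Set X) := hi' ▸ ⟨mem_image_of_mem _ H1, hQ'⟩
    have h1 : g (s * t) = g 0 := by
      by_contra hne
      refine hεN (y := s * t) (by rwa [Real.dist_eq, sub_zero, habs]) ⟨hm, fun h => hne ?_⟩
      rw [h0']
      exact Subtype.ext h
    have := hg.inj hI (by norm_num) h1
    rw [this] at habs
    simp at habs
    exact ht0.ne habs
  · exact (hu.symm ▸ mem_univ (g (-(s * t))) : g (-(s * t)) ∈ P ∪ Q).resolve_left H2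
  · rintro ⟨q, hq, hqg⟩
    exact H2 (Subtype.ext hqg ▸ hq)

end BoundaryCircle

/-! ## Modifying a function inside a disc -/

section Patch

variable {X : Type*} [TopologicalSpace X] {M : Set ℂ} {ψ : ℂ → X} {g : X → ℂ} {w : ℂ → ℂ} {B : Set X}

open Classical in
/-- The function equal to `w` in the disc `ψ` and to `g` elsewhere. -/
noncomputable def patch (M : Set ℂ) (ψ : ℂ → X) (g : X → ℂ) (w : ℂ → ℂ) (p : X) : ℂ :=
  if p ∈ ψ '' (M ∩ ball 0 1) then w (Function.invFunOn ψ (M ∩ ball 0 1) p) else g p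

theorem patch_apply (hψ : IsChart (M ∩ ball 0 1) ψ) {z : ℂ} (hz : z ∈ M ∩ ball (0 : ℂ) 1) :
    patch M ψ g w (ψ z) = w z := by
  rw [patch, if_pos (mem_image_of_mem ψ hz), hψ.inv_apply hz]

theorem patch_of_notMem {p : X} (hp : p ∉ ψ '' (M ∩ ball 0 1)) : patch M ψ g w p = g p := by
  rw [patch, if_neg hp]

theorem closedBall_subset_ball_one : closedBall (0 : ℂ) (3 / 4) ⊆ ball 0 1 :=
  closedBall_subset_ball (by norm_num)

theorem continuousOn_patch [T2Space X] (hψ : IsChart (M ∩ ball 0 1) ψ) (hM : IsClosed M)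
    (hg : ContinuousOn g (B \ ψ '' (M ∩ closedBall 0 (3 / 4))))
    (hw : ContinuousOn w (M ∩ ball 0 1 ∩ ψ ⁻¹' B))
    (he : ∀ z ∈ M ∩ ball (0 : ℂ) 1, 3 / 4 < ‖z‖ → ψ z ∈ B → w z = g (ψ z)) :
    ContinuousOn (patch M ψ g w) B := by
  have hcl : IsClosed (ψ '' (M ∩ closedBall 0 (3 / 4))) :=
    (((isCompact_closedBall (0 : ℂ) (3 / 4)).inter_left hM).image_of_continuousOn
      (hψ.cont.mono (inter_subset_inter_right _ closedBall_subset_ball_one))).isClosed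
  intro p hp
  by_cases hpK : p ∈ ψ '' (M ∩ closedBall 0 (3 / 4))
  · obtain ⟨z, hz, rfl⟩ := hpK
    have hz' : z ∈ M ∩ ball (0 : ℂ) 1 := ⟨hz.1, closedBall_subset_ball_one hz.2⟩
    have hN : ψ '' (M ∩ ball 0 1) ∈ 𝓝 (ψ z) := hψ.isOpen_range.mem_nhds (mem_image_of_mem ψ hz')
    have h1 : ContinuousWithinAt (fun q => w (Function.invFunOn ψ (M ∩ ball 0 1) q))
        (ψ '' (M ∩ ball 0 1) ∩ B) (ψ z) := by
      refine ContinuousWithinAt.comp (t := M ∩ ball 0 1 ∩ ψ ⁻¹' B) ?_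
        ((hψ.continuousOn_inv (ψ z) (mem_image_of_mem ψ hz')).mono inter_subset_left) ?_
      · rw [hψ.inv_apply hz']
        exact hw z ⟨hz', hp⟩
      · rintro q ⟨hq, hqB⟩
        exact ⟨hψ.inv_mem hq, by rwa [mem_preimage, hψ.apply_inv hq]⟩
    have h2 : ContinuousWithinAt (patch M ψ g w) (ψ '' (M ∩ ball 0 1) ∩ B) (ψ z) := by
      refine h1.congr (fun q hq => ?_) ?_
      · rw [patch, if_pos hq.1]
      · rw [patch, if_pos (mem_image_of_mem ψ hz')]
    rw [inter_comm] at h2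
    exact (continuousWithinAt_inter hN).1 h2
  · have hN : (ψ '' (M ∩ closedBall 0 (3 / 4)))ᶜ ∈ 𝓝 p := hcl.isOpen_compl.mem_nhds hpK
    have heq : ∀ q ∈ B \ ψ '' (M ∩ closedBall 0 (3 / 4)), patch M ψ g w q = g q := by
      rintro q ⟨hqB, hqK⟩
      by_cases hq : q ∈ ψ '' (M ∩ ball 0 1)
      · obtain ⟨z, hz, rfl⟩ := hq
        rw [patch_apply hψ hz]
        refine he z hz ?_ hqB
        by_contra hlt
        exact hqK ⟨z, ⟨hz.1, by simpa using hlt⟩, rfl⟩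
      · exact patch_of_notMem hq
    have h2 := (hg p ⟨hp, hpK⟩).congr heq (heq p ⟨hp, hpK⟩)
    rw [sdiff_eq] at h2
    exact (continuousWithinAt_inter hN).1 h2

/-- A cut-off function. -/
noncomputable def cutoff (z : ℂ) : ℝ := max 0 (min 1 (3 - 4 * ‖z‖))

theorem continuous_cutoff : Continuous cutoff := by unfold cutoff; fun_prop

theorem cutoff_nonneg (z : ℂ) : 0 ≤ cutoff z := le_max_left _ _

theorem cutoff_le_one (z : ℂ) : cutoff z ≤ 1 := max_le zero_le_one (min_le_left _ _)

theorem cutoff_eq_one {z : ℂ} (hz : ‖z‖ ≤ 1 / 2) : cutoff z = 1 := by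
  rw [cutoff, min_eq_left (by linarith), max_eq_right zero_le_one]

theorem cutoff_eq_zero {z : ℂ} (hz : 3 / 4 ≤ ‖z‖) : cutoff z = 0 := by
  rw [cutoff, max_eq_left]
  exact (min_le_right _ _).trans (by linarith)

/-- The pole of `poleFun`. -/
noncomputable def poleAt : ℂ := Complex.I / 8

theorem poleAt_re : poleAt.re = 0 := by simp [poleAt]

theorem poleAt_im : poleAt.im = 1 / 8 := by simp [poleAt]

theorem norm_poleAt : ‖poleAt‖ = 1 / 8 := by simp [poleAt]

theorem poleAt_mem : poleAt ∈ upperHalf ∩ ball (0 : ℂ) 1 := by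
  refine ⟨?_, ?_⟩
  · show 0 ≤ poleAt.im
    rw [poleAt_im]; norm_num
  · rw [mem_ball_zero_iff, norm_poleAt]; norm_num

/-- A function on the upper half plane with a simple pole, equal to one away from the origin. -/
noncomputable def poleFun (z : ℂ) : ℂ := 1 + cutoff z * (2 * poleAt / (z - poleAt))

theorem continuousOn_poleFun : ContinuousOn poleFun {poleAt}ᶜ := by
  unfold poleFun
  refine continuousOn_const.add (ContinuousOn.mul ?_ ?_)
  · exact (Complex.continuous_ofReal.comp continuous_cutoff).continuousOn
  · exact continuousOn_const.div (by fun_prop) fun z hz => sub_ne_zero.2 hz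

theorem poleFun_eq_one {z : ℂ} (hz : 3 / 4 ≤ ‖z‖) : poleFun z = 1 := by
  simp [poleFun, cutoff_eq_zero hz]

theorem poleFun_eq_div {z : ℂ} (hz : z ≠ poleAt) :
    poleFun z = (z + (2 * cutoff z - 1 : ℝ) * poleAt) / (z - poleAt) := by
  have : z - poleAt ≠ 0 := sub_ne_zero.2 hz
  rw [poleFun]
  field_simp
  push_cast
  ring

theorem poleFun_ne_zero {z : ℂ} (hz : z ≠ poleAt) (hu : z ∈ upperHalf) : poleFun z ≠ 0 := by
  rw [poleFun_eq_div hz]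
  refine div_ne_zero (fun h => ?_) (sub_ne_zero.2 hz)
  have hz' : z = ((1 - 2 * cutoff z : ℝ) : ℂ) * poleAt := by
    push_cast at h ⊢
    linear_combination h
  have h0 := cutoff_nonneg z
  have h1 := cutoff_le_one z
  have hn : ‖z‖ ≤ 1 / 8 := by
    rw [hz', norm_mul, norm_poleAt, Complex.norm_real, Real.norm_eq_abs]
    have : |1 - 2 * cutoff z| ≤ 1 := abs_le.2 ⟨by linarith, by linarith⟩
    linarith
  rw [cutoff_eq_one (by linarith)] at hz'
  have hu' : 0 ≤ z.im := hu
  rw [hz', Complex.im_ofReal_mul] at hu'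
  rw [poleAt_im] at hu'
  norm_num at hu'

/-- A continuous square root of `poleFun` along the real axis, changing sign. -/
theorem exists_sqrt_poleFun : ∃ ρ : ℝ → ℂ, Continuous ρ ∧ (∀ t, ρ t ^ 2 = poleFun t) ∧
    (∀ t, 3 / 4 ≤ t → ρ t = 1) ∧ ∀ t, t ≤ -(3 / 4) → ρ t = -1 := by
  have hne : ∀ t : ℝ, (t : ℂ) ≠ poleAt := fun t h => by
    have := congrArg Complex.im h
    rw [poleAt_im] at this
    norm_num at this
  have hcont : Continuous fun t : ℝ => poleFun t :=
    continuousOn_poleFun.comp_continuous Complex.continuous_ofReal hne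
  set A : ℝ → ℂ := fun t => (t + poleAt) / (Real.sqrt (t ^ 2 + 1 / 64) : ℝ)
  set C : ℝ → ℂ := fun t => poleFun t ^ (2⁻¹ : ℂ)
  have hpos : ∀ t : ℝ, 0 < Real.sqrt (t ^ 2 + 1 / 64) := fun t => Real.sqrt_pos.2 (by positivity)
  have hA : Continuous A := by
    refine Continuous.div (by fun_prop) (by fun_prop) fun t => ?_
    exact_mod_cast (hpos t).ne'
  have hI : poleAt ^ 2 = -(1 / 64) := by
    rw [poleAt, div_pow, Complex.I_sq]; norm_num
  have hA2 : ∀ t : ℝ, |t| ≤ 1 / 2 → A t ^ 2 = poleFun t := by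
    intro t ht
    have h1 : ((Real.sqrt (t ^ 2 + 1 / 64) : ℝ) : ℂ) ^ 2 = (t + poleAt) * (t - poleAt) := by
      rw [← Complex.ofReal_pow, Real.sq_sqrt (by positivity)]
      push_cast
      linear_combination hI
    have h2 : (t : ℂ) - poleAt ≠ 0 := sub_ne_zero.2 (hne t)
    have h3 : (t : ℂ) + poleAt ≠ 0 := fun h => by
      have := congrArg Complex.im h
      simp [poleAt_im] at this
    rw [poleFun_eq_div (hne t), cutoff_eq_one (by simpa using ht), div_pow, h1]
    field_simp
    norm_num
  have hre : ∀ t : ℝ, 1 / 2 ≤ |t| → 0 < (poleFun t).re := by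
    intro t ht
    have ht2 : 1 / 4 ≤ t ^ 2 := by
      rw [← sq_abs]; nlinarith
    have h2 : (t : ℂ) - poleAt ≠ 0 := sub_ne_zero.2 (hne t)
    have h3 : (t : ℂ) + poleAt ≠ 0 := fun h => by
      have := congrArg Complex.im h
      simp [poleAt_im] at this
    have : poleFun t = 1 + ((cutoff t * 2 / (t ^ 2 + 1 / 64) : ℝ) : ℂ) * (poleAt * (t + poleAt)) := by
      have h4 : ((t : ℂ) ^ 2 + 1 / 64) = (t + poleAt) * (t - poleAt) := by linear_combination hI
      rw [poleFun]
      push_cast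
      rw [h4]
      field_simp
    rw [this, Complex.add_re, Complex.re_ofReal_mul, Complex.mul_re]
    simp only [Complex.one_re, poleAt_re, poleAt_im, Complex.add_re, Complex.add_im, Complex.ofReal_re,
      Complex.ofReal_im]
    have h5 : cutoff t * 2 / (t ^ 2 + 1 / 64) ≤ 8 := by
      rw [div_le_iff₀ (by positivity)]
      nlinarith [cutoff_le_one t]
    nlinarith
  have hC : ContinuousOn C {t | 1 / 2 ≤ |t|} := by
    refine hcont.continuousOn.cpow continuousOn_const fun t ht => ?_
    exact Or.inl (hre t ht)
  have hC2 : ∀ t, C t ^ 2 = poleFun t := fun t => Complex.cpow_nat_inv_pow _ two_ne_zero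
  have hAre : ∀ t : ℝ, (A t).re = t / Real.sqrt (t ^ 2 + 1 / 64) := fun t => by
    show ((t + poleAt) / (Real.sqrt (t ^ 2 + 1 / 64) : ℝ) : ℂ).re = _
    rw [Complex.div_ofReal_re, Complex.add_re, poleAt_re, Complex.ofReal_re, add_zero]
  have hCA : C (1 / 2) = A (1 / 2) := by
    show poleFun _ ^ (2⁻¹ : ℂ) = _
    rw [← hA2 (1 / 2) (by rw [abs_of_pos] <;> norm_num)]
    refine Complex.sq_cpow_two_inv ?_
    rw [hAre]
    exact div_pos (by norm_num) (hpos _)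
  have hCA' : -C (-(1 / 2)) = A (-(1 / 2)) := by
    show -poleFun _ ^ (2⁻¹ : ℂ) = _
    rw [← hA2 (-(1 / 2)) (by rw [abs_neg, abs_of_pos] <;> norm_num), ← neg_sq, Complex.sq_cpow_two_inv,
      neg_neg]
    rw [Complex.neg_re, hAre, ← neg_div]
    exact div_pos (by norm_num) (hpos _)
  refine ⟨fun t => if t ≤ -(1 / 2) then -C t else if t ≤ 1 / 2 then A t else C t, ?_, ?_, ?_, ?_⟩
  · refine continuous_if_le continuous_id continuous_const ?_ ?_ ?_
    · refine (hC.mono fun t ht => ?_).neg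
      have : t ≤ -(1 / 2) := ht
      exact le_abs.2 (Or.inr (show (1 / 2 : ℝ) ≤ -t by linarith))
    · refine Continuous.continuousOn (continuous_if_le continuous_id continuous_const hA.continuousOn
        (hC.mono fun t ht => (show (1 / 2 : ℝ) ≤ t from ht).trans (le_abs_self t)) ?_)
      rintro t rfl
      exact hCA.symm
    · rintro t rfl
      rw [if_pos (by norm_num)]
      exact hCA'
  · intro t
    simp only
    split_ifs with h1 h2
    · rw [neg_sq, hC2]
    · exact hA2 t (abs_le.2 ⟨by linarith, h2⟩)
    · exact hC2 t
  · intro t ht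
    simp only
    rw [if_neg (by linarith), if_neg (by linarith)]
    show poleFun _ ^ (2⁻¹ : ℂ) = _
    rw [poleFun_eq_one (by simpa using le_abs.2 (Or.inl ht)), Complex.one_cpow]
  · intro t ht
    simp only
    rw [if_pos (by linarith)]
    show -poleFun _ ^ (2⁻¹ : ℂ) = _
    rw [poleFun_eq_one (by simpa using le_abs.2 (Or.inr (by linarith : 3 / 4 ≤ -t))), Complex.one_cpow]

end Patch

/-! ## Functions with a simple zero or pole -/

section Simple

variable {X : Type*} [TopologicalSpace X]

theorem IsDiscAt.affine_of_iff {M N : Set ℂ} {θ : ℂ → X} {p : X} (h : IsDiscAt M θ p) {b : ℂ} {c : ℝ}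
    (hc : 0 < c) (hb : ‖b‖ + c ≤ 1) (hMN : ∀ w ∈ ball (0 : ℂ) 1, b + c * w ∈ M ↔ w ∈ N) :
    IsDiscAt N (fun w => θ (b + c * w)) (θ b) := by
  have hc' : (c : ℂ) ≠ 0 := by exact_mod_cast hc.ne'
  have hmem : ∀ w ∈ N ∩ ball (0 : ℂ) 1, b + c * w ∈ M ∩ ball (0 : ℂ) 1 := by
    rintro w ⟨hwN, hw⟩
    refine ⟨(hMN w hw).2 hwN, ?_⟩
    rw [mem_ball_zero_iff] at hw ⊢
    have h1 : ‖(c : ℂ) * w‖ < c := by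
      rw [norm_mul, Complex.norm_real, Real.norm_eq_abs, abs_of_pos hc]
      nlinarith
    linarith [norm_add_le b (c * w)]
  refine ⟨⟨?_, ?_, ?_⟩, by simp⟩
  · exact h.chart.cont.comp (by fun_prop) hmem
  · intro w hw w' hw' he
    have := h.chart.inj (hmem w hw) (hmem w' hw') he
    exact mul_left_cancel₀ hc' (add_left_cancel this)
  · intro O hO
    let a : ℂ ≃ₜ ℂ := (Homeomorph.mulLeft₀ (c : ℂ) hc').trans (Homeomorph.addLeft b)
    have ha : ∀ w, a w = b + c * w := fun w => rfl
    have := h.chart.isOpen_image _ (a.isOpenMap _ (isOpen_ball.inter hO : IsOpen (ball (0 : ℂ) 1 ∩ O)))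
    convert this using 1
    ext q
    constructor
    · rintro ⟨w, ⟨hw, hwO⟩, rfl⟩
      exact ⟨a w, ⟨hmem w hw, w, ⟨hw.2, hwO⟩, rfl⟩, rfl⟩
    · rintro ⟨_, ⟨hM, w, ⟨hw, hwO⟩, rfl⟩, rfl⟩
      exact ⟨w, ⟨⟨(hMN w hw).1 hM.1, hw⟩, hwO⟩, rfl⟩

theorem IsDiscAt.affine {θ : ℂ → X} {p : X} (h : IsDiscAt univ θ p) {b : ℂ} {c : ℝ} (hc : 0 < c)
    (hb : ‖b‖ + c ≤ 1) : IsDiscAt univ (fun w => θ (b + c * w)) (θ b) :=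
  h.affine_of_iff hc hb fun _ _ => Iff.rfl

/-- `f` has a simple zero or a simple pole at `p`, up to a factor with a logarithm. -/
def IsSimple (f : X → ℂ) (p : X) : Prop :=
  ∃ (θ : ℂ → X) (r : ℝ) (d : ℤ) (k : ℂ → ℂ), IsDiscAt univ θ p ∧ 0 < r ∧ r ≤ 1 ∧ IsUnit d ∧
    ContinuousOn k (ball 0 r \ {0}) ∧
    ∀ z ∈ ball (0 : ℂ) r \ {0}, f (θ z) = z ^ d * Complex.exp (k z)

theorem IsDiscAt.ne {θ : ℂ → X} {p : X} (h : IsDiscAt univ θ p) {z : ℂ}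
    (hz : z ∈ ball (0 : ℂ) 1 \ {0}) : θ z ≠ p := fun he =>
  hz.2 (h.chart.inj ⟨trivial, hz.1⟩ ⟨trivial, mem_ball_self one_pos⟩ (he.trans h.zero.symm))

theorem IsDiscAt.continuousOn_comp {θ : ℂ → X} {p : X} (h : IsDiscAt univ θ p) {f : X → ℂ}
    (hf : ContinuousOn f {p}ᶜ) : ContinuousOn (fun z => f (θ z)) (ball 0 1 \ {0}) :=
  hf.comp (h.chart.cont.mono fun _ hz => ⟨trivial, hz.1⟩) fun _ hz => h.ne hz

/-- The transition map between two discs around the same point. -/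
theorem IsDiscAt.exists_transition {θ θ' : ℂ → X} {p : X} (h : IsDiscAt univ θ p)
    (h' : IsDiscAt univ θ' p) {r : ℝ} (hr : 0 < r) (hr1 : r ≤ 1) :
    ∃ s : ℝ, 0 < s ∧ s ≤ 1 ∧ ∃ (d : ℤ) (k τ : ℂ → ℂ), IsUnit d ∧ ContinuousOn k (ball 0 s \ {0}) ∧
      ContinuousOn τ (ball 0 s) ∧ (∀ z ∈ ball (0 : ℂ) s, τ z ∈ ball (0 : ℂ) r) ∧
      (∀ z ∈ ball (0 : ℂ) s, θ (τ z) = θ' z) ∧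
      ∀ z ∈ ball (0 : ℂ) s \ {0}, τ z ≠ 0 ∧ τ z = z ^ d * Complex.exp (k z) := by
  have key : ∀ {θ θ' : ℂ → X} (_ : IsDiscAt univ θ p) (_ : IsDiscAt univ θ' p) {r : ℝ} (_ : 0 < r)
      (_ : r ≤ 1), ∃ s : ℝ, 0 < s ∧ s ≤ 1 ∧ ∀ z ∈ ball (0 : ℂ) s, θ' z ∈ θ '' (univ ∩ ball 0 r) := by
    intro θ θ' h h' r hr hr1
    have hop : IsOpen (θ '' (univ ∩ ball 0 r)) := by
      have := h.chart.isOpen_image (ball 0 r) isOpen_ball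
      rwa [inter_assoc, inter_eq_self_of_subset_right (ball_subset_ball hr1)] at this
    have hc : ContinuousAt θ' 0 := h'.chart.cont.continuousAt
      (by rw [univ_inter]; exact ball_mem_nhds _ one_pos)
    have := hc.eventually_mem (hop.mem_nhds ⟨0, ⟨trivial, mem_ball_self hr⟩, h.zero.trans h'.zero.symm⟩)
    obtain ⟨ε, hε, hb⟩ := Metric.eventually_nhds_iff_ball.1 this
    exact ⟨min ε 1, by positivity, min_le_right _ _,
      fun z hz => hb z (ball_subset_ball (min_le_left _ _) hz)⟩
  obtain ⟨s, hs, hs1, hsb⟩ := key h h' hr hr1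
  obtain ⟨s', hs', hs1', hsb'⟩ := key h' h one_pos le_rfl
  have hsub : ∀ {r : ℝ}, r ≤ 1 → univ ∩ ball (0 : ℂ) r ⊆ univ ∩ ball 0 1 := fun hr =>
    inter_subset_inter_right _ (ball_subset_ball hr)
  set τ : ℂ → ℂ := fun z => Function.invFunOn θ (univ ∩ ball 0 1) (θ' z)
  set g : ℂ → ℂ := fun z => Function.invFunOn θ' (univ ∩ ball 0 1) (θ z)
  have hτ : ContinuousOn τ (ball 0 s) := by
    refine h.chart.continuousOn_inv.comp (h'.chart.cont.mono ?_) fun z hz => ?_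
    · rw [univ_inter]; exact ball_subset_ball hs1
    · exact image_mono (hsub hr1) (hsb z hz)
  have hg : ContinuousOn g (ball 0 s') := by
    refine h'.chart.continuousOn_inv.comp (h.chart.cont.mono ?_) fun z hz => ?_
    · rw [univ_inter]; exact ball_subset_ball hs1'
    · exact hsb' z hz
  have hθτ : ∀ z ∈ ball (0 : ℂ) s, θ (τ z) = θ' z := fun z hz =>
    h.chart.apply_inv (image_mono (hsub hr1) (hsb z hz))
  have hθg : ∀ z ∈ ball (0 : ℂ) s', θ' (g z) = θ z := fun z hz => h'.chart.apply_inv (hsb' z hz)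
  have hτ0 : τ 0 = 0 := by
    show Function.invFunOn θ (univ ∩ ball 0 1) (θ' 0) = 0
    rw [h'.zero, ← h.zero, h.chart.inv_apply ⟨trivial, mem_ball_self one_pos⟩]
  have hτne : ∀ z ∈ ball (0 : ℂ) s \ {0}, τ z ≠ 0 := fun z hz he => by
    have := hθτ z hz.1
    rw [he, h.zero] at this
    exact h'.ne ⟨ball_subset_ball hs1 hz.1, hz.2⟩ this.symm
  have hgne : ∀ z ∈ ball (0 : ℂ) s' \ {0}, g z ≠ 0 := fun z hz he => by
    have := hθg z hz.1
    rw [he, h'.zero] at this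
    exact h.ne ⟨ball_subset_ball hs1' hz.1, hz.2⟩ this.symm
  obtain ⟨d, k, hd, hk, hdk⟩ := exists_isUnit_zpow_mul_exp hs hs' hτ hg hτ0 hτne hgne (fun z hz _ => by
    show Function.invFunOn θ' (univ ∩ ball 0 1) (θ (τ z)) = z
    rw [hθτ z hz, h'.chart.inv_apply ⟨trivial, ball_subset_ball hs1 hz⟩])
  refine ⟨s, hs, hs1, d, k, τ, hd, hk, hτ, fun z hz => ?_, hθτ, fun z hz => ⟨hτne z hz, hdk z hz⟩⟩
  obtain ⟨y, hy, hyz⟩ := hsb z hz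
  show Function.invFunOn θ (univ ∩ ball 0 1) (θ' z) ∈ _
  rw [← hyz, h.chart.inv_apply (hsub hr1 hy)]
  exact hy.2

theorem IsSimple.exists_disc {f : X → ℂ} {p : X} (h : IsSimple f p) (hf : ContinuousOn f {p}ᶜ)
    (h0 : ∀ q, q ≠ p → f q ≠ 0) {θ' : ℂ → X} (h' : IsDiscAt univ θ' p) :
    ∃ (d : ℤ) (k : ℂ → ℂ), IsUnit d ∧ ContinuousOn k (ball 0 1 \ {0}) ∧
      ∀ z ∈ ball (0 : ℂ) 1 \ {0}, f (θ' z) = z ^ d * Complex.exp (k z) := by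
  obtain ⟨θ, r, d, k, hθ, hr, hr1, hd, hk, hdk⟩ := h
  obtain ⟨s, hs, hs1, d', k', τ, hd', hk', hτ, hτr, hθτ, hτk⟩ := hθ.exists_transition h' hr hr1
  obtain ⟨m, l, hl, hml⟩ := exists_zpow_mul_exp one_pos (h'.continuousOn_comp hf)
    fun z hz => h0 _ (h'.ne hz)
  refine ⟨m, l, ?_, hl, hml⟩
  have hss : ball (0 : ℂ) s \ {0} ⊆ ball 0 1 \ {0} := sdiff_subset_sdiff_left (ball_subset_ball hs1)
  have hmap : MapsTo τ (ball 0 s \ {0}) (ball 0 r \ {0}) := fun z hz =>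
    ⟨hτr z hz.1, (hτk z hz).1⟩
  have : m - d' * d = 0 := by
    refine zpow_exponent_eq_zero hs (k := fun z => d * k' z + k (τ z) - l z) ?_ ?_
    · exact ((continuousOn_const.mul hk').add (hk.comp (hτ.mono sdiff_subset) hmap)).sub (hl.mono hss)
    · intro z hz
      have hz0 : z ≠ 0 := hz.2
      have h1 := hml z (hss hz)
      rw [← hθτ z hz.1, hdk _ (hmap hz), (hτk z hz).2, mul_zpow, ← zpow_mul, ← Complex.exp_int_mul] at h1
      rw [← (hτk z hz).2] at h1
      rw [Complex.exp_sub, Complex.exp_add, zpow_sub₀ hz0, div_eq_div_iff (zpow_ne_zero _ hz0)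
        (Complex.exp_ne_zero _), ← h1]
      ring
  rw [sub_eq_zero.1 this]
  exact hd'.mul hd

theorem continuousOn_one_sub_cutoff_mul {k : ℂ → ℂ} (hk : ContinuousOn k (ball 0 1 \ {0})) :
    ContinuousOn (fun z => (1 - cutoff z) * k z) (ball 0 1) := by
  intro z hz
  by_cases h : z = 0
  · subst h
    have : (fun z : ℂ => (1 - cutoff z : ℂ) * k z) =ᶠ[𝓝 0] fun _ => 0 := by
      filter_upwards [ball_mem_nhds (0 : ℂ) (show (0 : ℝ) < 1 / 2 by norm_num)] with z hz
      rw [cutoff_eq_one (by simpa using (mem_ball_zero_iff.1 hz).le)]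
      simp
    exact (continuousAt_const.congr this.symm).continuousWithinAt
  · have h1 : ContinuousAt k z := hk.continuousAt
      ((isOpen_ball.sdiff isClosed_singleton).mem_nhds ⟨hz, h⟩)
    exact ((continuousAt_const.sub
      (Complex.continuous_ofReal.comp continuous_cutoff).continuousAt).mul h1).continuousWithinAt

/-- There is a function nonvanishing outside `p`, simple at `p` and equal to `f₀` outside `O`. -/
def HasSimple (O : Set X) (f₀ : X → ℂ) (p : X) : Prop :=
  ∃ f : X → ℂ, ContinuousOn f {p}ᶜ ∧ (∀ q, q ≠ p → f q ≠ 0) ∧ (∀ q ∉ O, f q = f₀ q) ∧ IsSimple f p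

theorem HasSimple.move [T2Space X] {O : Set X} {f₀ : X → ℂ} {p : X} (h : HasSimple O f₀ p) {θ : ℂ → X}
    (hθ : IsDiscAt univ θ p) (hO : θ '' (univ ∩ ball 0 1) ⊆ O) {b : ℂ} (hb : ‖b‖ < 1 / 2) :
    HasSimple O f₀ (θ b) := by
  obtain ⟨f, hf, hf0, hfO, hs⟩ := h
  obtain ⟨d, k, hd, hk, hdk⟩ := hs.exists_disc hf hf0 hθ
  have hb1 : b ∈ ball (0 : ℂ) 1 := by rw [mem_ball_zero_iff]; linarith
  set w : ℂ → ℂ := fun z => (z - cutoff z * b) ^ d * Complex.exp ((1 - cutoff z) * k z) with hw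
  have hsub : ∀ z, z ≠ b → z - cutoff z * b ≠ 0 := by
    intro z hz he
    have he' := sub_eq_zero.1 he
    have : ‖z‖ ≤ ‖b‖ := by
      conv_lhs => rw [he']
      rw [norm_mul, Complex.norm_real, Real.norm_eq_abs, abs_of_nonneg (cutoff_nonneg z)]
      nlinarith [cutoff_le_one z, norm_nonneg b]
    rw [cutoff_eq_one (by linarith)] at he'
    exact hz (by simpa using he')
  have hzb : ∀ z, θ z ≠ θ b → z ≠ b := fun z hz he => hz (he ▸ rfl)
  have hw0 : ∀ z, z ≠ b → w z ≠ 0 := fun z hz =>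
    mul_ne_zero (zpow_ne_zero _ (hsub z hz)) (Complex.exp_ne_zero _)
  refine ⟨patch univ θ f w, ?_, ?_, ?_, ?_⟩
  · refine continuousOn_patch hθ.chart isClosed_univ ?_ ?_ ?_
    · refine hf.mono fun q hq hqp => hq.2 ⟨0, ⟨trivial, mem_closedBall_self (by norm_num)⟩, ?_⟩
      rw [hθ.zero, hqp]
    · refine ContinuousOn.mul ?_ ?_
      · refine ContinuousOn.zpow₀ (Continuous.continuousOn ?_) _ fun z hz => Or.inl (hsub z (hzb z hz.2))
        exact continuous_id.sub
          ((Complex.continuous_ofReal.comp continuous_cutoff).mul continuous_const)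
      · exact Complex.continuous_exp.comp_continuousOn
          ((continuousOn_one_sub_cutoff_mul hk).mono fun z hz => hz.1.2)
    · intro z hz h34 _
      have hz0 : z ∈ ball (0 : ℂ) 1 \ {0} := ⟨hz.2, fun h => by
        rw [mem_singleton_iff.1 h, norm_zero] at h34; linarith⟩
      rw [hdk z hz0, hw]
      simp only
      rw [cutoff_eq_zero h34.le]
      simp
  · intro q hq
    by_cases hqθ : q ∈ θ '' (univ ∩ ball 0 1)
    · obtain ⟨z, hz, rfl⟩ := hqθ
      rw [patch_apply hθ.chart hz]
      exact hw0 z (hzb z hq)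
    · rw [patch_of_notMem hqθ]
      refine hf0 q fun h => hqθ ⟨0, ⟨trivial, mem_ball_self one_pos⟩, ?_⟩
      rw [hθ.zero, h]
  · intro q hq
    rw [patch_of_notMem fun h => hq (hO h)]
    exact hfO q hq
  · set c : ℝ := 1 / 2 - ‖b‖ with hc
    have hc0 : 0 < c := by linarith
    refine ⟨_, 1, d, fun _ => d * Real.log c, hθ.affine (b := b) hc0 (by linarith), one_pos, le_rfl, hd,
      continuousOn_const, fun z hz => ?_⟩
    have hz1 : ‖z‖ < 1 := mem_ball_zero_iff.1 hz.1
    have h1 : ‖b + c * z‖ ≤ 1 / 2 := by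
      have : ‖(c : ℂ) * z‖ ≤ c := by
        rw [norm_mul, Complex.norm_real, Real.norm_eq_abs, abs_of_pos hc0]
        nlinarith
      linarith [norm_add_le b (c * z)]
    have h2 : b + c * z ∈ univ ∩ ball (0 : ℂ) 1 := ⟨trivial, by rw [mem_ball_zero_iff]; linarith⟩
    rw [patch_apply hθ.chart h2, hw]
    simp only
    rw [cutoff_eq_one h1, Complex.exp_int_mul, ← Complex.ofReal_exp, Real.exp_log hc0]
    simp [mul_zpow, mul_comm]

theorem HasSimple.of_isPreconnected [T2Space X] {O : Set X} {f₀ : X → ℂ} (hO : IsOpen O)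
    (hc : IsPreconnected O) (hb : ∀ q ∈ O, q ∉ surfaceBoundary X) {p p' : X} (hp : p ∈ O)
    (hp' : p' ∈ O) (h : HasSimple O f₀ p) : HasSimple O f₀ p' := by
  refine (hc.induction₂ (fun p q => HasSimple O f₀ p ↔ HasSimple O f₀ q) ?_
    (fun x y z _ _ _ h1 h2 => h1.trans h2) (fun x y _ _ h => h.symm) hp hp').1 h
  intro q hq
  obtain ⟨θ, hθ, hθO⟩ := exists_disc_of_notMem_surfaceBoundary (hb q hq) (hO.mem_nhds hq)
  have hop : IsOpen (θ '' (univ ∩ ball 0 1 ∩ ball 0 (1 / 4))) := hθ.chart.isOpen_image _ isOpen_ball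
  have hm : θ '' (univ ∩ ball 0 1 ∩ ball 0 (1 / 4)) ∈ 𝓝 q :=
    hop.mem_nhds ⟨0, ⟨⟨trivial, mem_ball_self one_pos⟩, mem_ball_self (by norm_num)⟩, hθ.zero⟩
  filter_upwards [mem_nhdsWithin_of_mem_nhds hm]
  rintro _ ⟨b, ⟨-, hb4⟩, rfl⟩
  rw [mem_ball_zero_iff] at hb4
  refine ⟨fun h => h.move hθ hθO (by linarith), fun h => ?_⟩
  have hd := hθ.affine (b := b) (c := 1 / 2) (by norm_num) (by linarith)
  have := h.move hd (b := -2 * b) ?_ ?_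
  · convert this using 1
    rw [← hθ.zero]
    congr 1
    push_cast
    ring
  · rintro _ ⟨w, ⟨-, hw⟩, rfl⟩
    refine hθO ⟨_, ⟨trivial, ?_⟩, rfl⟩
    rw [mem_ball_zero_iff] at hw ⊢
    have : ‖((1 / 2 : ℝ) : ℂ) * w‖ ≤ 1 / 2 := by
      rw [norm_mul, Complex.norm_real, Real.norm_eq_abs, abs_of_pos (by norm_num)]
      linarith
    linarith [norm_add_le b (((1 / 2 : ℝ) : ℂ) * w)]
  · rw [norm_mul]
    norm_num
    linarith

end Simple

section Dual

variable {X : Type*} [TopologicalSpace X]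

theorem exists_isDiscAt_poleAt {ψ : ℂ → X} {x : X} (h : IsDiscAt upperHalf ψ x) :
    IsDiscAt univ (fun w => ψ (poleAt + (1 / 8 : ℝ) * w)) (ψ poleAt) := by
  refine h.affine_of_iff (by norm_num) (by rw [norm_poleAt]; norm_num) fun w hw => ?_
  refine ⟨fun _ => trivial, fun _ => ?_⟩
  have h1 := Complex.abs_im_le_norm w
  rw [mem_ball_zero_iff] at hw
  have h2 := abs_le.1 (h1.trans hw.le)
  show 0 ≤ (poleAt + (1 / 8 : ℝ) * w).im
  rw [Complex.add_im, poleAt_im, Complex.im_ofReal_mul]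
  linarith

/-- The points of the small disc around the pole. -/
theorem poleAt_add_mem {w : ℂ} (hw : w ∈ ball (0 : ℂ) 1) :
    ‖poleAt + (1 / 8 : ℝ) * w‖ < 1 / 2 ∧ 0 < (poleAt + (1 / 8 : ℝ) * w).im := by
  rw [mem_ball_zero_iff] at hw
  constructor
  · have : ‖((1 / 8 : ℝ) : ℂ) * w‖ ≤ 1 / 8 := by
      rw [norm_mul, Complex.norm_real, Real.norm_eq_abs, abs_of_pos (by norm_num)]
      linarith
    have h2 := norm_add_le poleAt (((1 / 8 : ℝ) : ℂ) * w)
    rw [norm_poleAt] at h2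
    linarith
  · have h2 := abs_lt.1 ((Complex.abs_im_le_norm w).trans_lt hw)
    rw [Complex.add_im, poleAt_im, Complex.im_ofReal_mul]
    linarith

/-- A function with a simple pole in a half disc. -/
noncomputable def dipole (ψ : ℂ → X) : X → ℂ := patch upperHalf ψ (fun _ => 1) poleFun

theorem ne_poleAt {ψ : ℂ → X} {z : ℂ} (h : ψ z ≠ ψ poleAt) : z ≠ poleAt := fun he => h (he ▸ rfl)

theorem continuousOn_dipole [T2Space X] {ψ : ℂ → X} {x : X} (h : IsDiscAt upperHalf ψ x) :
    ContinuousOn (dipole ψ) {ψ poleAt}ᶜ := by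
  refine continuousOn_patch h.chart isClosed_upperHalf continuousOn_const ?_ ?_
  · exact continuousOn_poleFun.mono fun z hz => ne_poleAt hz.2
  · intro z _ hz _
    exact poleFun_eq_one hz.le

theorem dipole_ne_zero {ψ : ℂ → X} {x : X} (h : IsDiscAt upperHalf ψ x) {q : X} (hq : q ≠ ψ poleAt) :
    dipole ψ q ≠ 0 := by
  by_cases hqψ : q ∈ ψ '' (upperHalf ∩ ball 0 1)
  · obtain ⟨z, hz, rfl⟩ := hqψ
    rw [dipole, patch_apply h.chart hz]
    exact poleFun_ne_zero (ne_poleAt hq) hz.1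
  · rw [dipole, patch_of_notMem hqψ]
    exact one_ne_zero

theorem exists_dipole_eq {ψ : ℂ → X} {x : X} (h : IsDiscAt upperHalf ψ x) :
    ∃ k : ℂ → ℂ, ContinuousOn k (ball 0 1 \ {0}) ∧ ∀ z ∈ ball (0 : ℂ) 1 \ {0},
      dipole ψ (ψ (poleAt + (1 / 8 : ℝ) * z)) = z ^ (-1 : ℤ) * Complex.exp (k z) := by
  have him : ∀ w ∈ ball (0 : ℂ) 1 \ {0}, 0 < (2 * Complex.I + w).im := fun w hw => by
    have h2 := abs_lt.1 ((Complex.abs_im_le_norm w).trans_lt (mem_ball_zero_iff.1 hw.1))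
    simp
    linarith
  refine ⟨fun w => Complex.log (2 * Complex.I + w), ?_, fun w hw => ?_⟩
  · exact ContinuousOn.clog (by fun_prop) fun w hw => Or.inr (him w hw).ne'
  · have h1 := poleAt_add_mem hw.1
    have hw0 : w ≠ 0 := hw.2
    rw [dipole, patch_apply h.chart ⟨h1.2.le, by rw [mem_ball_zero_iff]; linarith⟩, poleFun_eq_div,
      cutoff_eq_one h1.1.le, Complex.exp_log]
    · rw [poleAt, zpow_neg_one]
      push_cast
      rw [show Complex.I / 8 + 1 / 8 * w - Complex.I / 8 = w / 8 by ring]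
      field_simp
      ring
    · intro he
      have := him w hw
      rw [he] at this
      simp at this
    · simpa using hw0

theorem isSimple_dipole {ψ : ℂ → X} {x : X} (h : IsDiscAt upperHalf ψ x) :
    IsSimple (dipole ψ) (ψ poleAt) := by
  obtain ⟨k, hk, hdk⟩ := exists_dipole_eq h
  exact ⟨_, 1, -1, k, exists_isDiscAt_poleAt h, one_pos, le_rfl, by simp, hk, hdk⟩

/-- A nowhere vanishing function equal to a product of dipole functions outside `O`. -/
theorem exists_dipole_mul_dipole [T2Space X] {ψ ψ' : ℂ → X} {x y : X} (h : IsDiscAt upperHalf ψ x)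
    (h' : IsDiscAt upperHalf ψ' y) {O : Set X} (hO : IsOpen O) (hc : IsPreconnected O)
    (hb : ∀ q ∈ O, q ∉ surfaceBoundary X) (hψ : ψ poleAt ∈ O)
    (hψ' : ∀ z ∈ upperHalf ∩ ball (0 : ℂ) 1, 0 < z.im → ψ' z ∈ O) :
    ∃ (d : ℤ) (F : X → ℂ), IsUnit d ∧ Continuous F ∧ (∀ q, F q ≠ 0) ∧
      ∀ q ∉ O, F q = dipole ψ q * dipole ψ' q ^ d := by
  have hpO : ψ' poleAt ∈ O := hψ' _ poleAt_mem (by rw [poleAt_im]; norm_num)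
  have h1 : HasSimple O (dipole ψ) (ψ poleAt) := ⟨dipole ψ, continuousOn_dipole h,
    fun q hq => dipole_ne_zero h hq, fun q _ => rfl, isSimple_dipole h⟩
  obtain ⟨f, hf, hf0, hfO, hs⟩ := h1.of_isPreconnected hO hc hb hψ hpO
  have hθ := exists_isDiscAt_poleAt h'
  set θ : ℂ → X := fun w => ψ' (poleAt + (1 / 8 : ℝ) * w) with hθdef
  obtain ⟨d, k, hd, hk, hdk⟩ := hs.exists_disc hf hf0 hθ
  obtain ⟨l, hl, hdl⟩ := exists_dipole_eq h'
  set w : ℂ → ℂ := fun z => Complex.exp ((1 - cutoff z) * (k z + d * l z))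
  set G : X → ℂ := fun q => f q * dipole ψ' q ^ d
  have hG : ∀ z ∈ ball (0 : ℂ) 1 \ {0}, G (θ z) = Complex.exp (k z + d * l z) := by
    intro z hz
    have hz0 : z ≠ 0 := hz.2
    show f (θ z) * dipole ψ' (θ z) ^ d = _
    rw [hdk z hz, hdl z hz, mul_zpow, ← zpow_mul, Complex.exp_add, ← Complex.exp_int_mul, neg_one_mul,
      zpow_neg]
    field_simp
  have hθO : θ '' (univ ∩ ball 0 1) ⊆ O := by
    rintro _ ⟨z, ⟨-, hz⟩, rfl⟩
    have h1 := poleAt_add_mem hz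
    exact hψ' _ ⟨h1.2.le, by rw [mem_ball_zero_iff]; linarith⟩ h1.2
  refine ⟨d, patch univ θ G w, hd, ?_, ?_, ?_⟩
  · rw [← continuousOn_univ]
    refine continuousOn_patch hθ.chart isClosed_univ ?_ ?_ ?_
    · have hsub : univ \ θ '' (univ ∩ closedBall 0 (3 / 4)) ⊆ {ψ' poleAt}ᶜ := by
        rintro q ⟨-, hq⟩ rfl
        exact hq ⟨0, ⟨trivial, mem_closedBall_self (by norm_num)⟩, hθ.zero⟩
      exact (hf.mono hsub).mul (((continuousOn_dipole h').mono hsub).zpow₀ _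
        fun q hq => Or.inl (dipole_ne_zero h' (hsub hq)))
    · refine Complex.continuous_exp.comp_continuousOn ((continuousOn_one_sub_cutoff_mul
        (hk.add (continuousOn_const.mul hl))).mono fun z hz => hz.1.2)
    · intro z hz h34 _
      rw [hG z ⟨hz.2, fun h => by rw [mem_singleton_iff.1 h, norm_zero] at h34; linarith⟩]
      show Complex.exp _ = _
      rw [cutoff_eq_zero h34.le]
      simp
  · intro q
    by_cases hq : q ∈ θ '' (univ ∩ ball 0 1)
    · obtain ⟨z, hz, rfl⟩ := hq
      rw [patch_apply hθ.chart hz]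
      exact Complex.exp_ne_zero _
    · rw [patch_of_notMem hq]
      have hqp : q ≠ ψ' poleAt := by
        rintro rfl
        exact hq ⟨0, ⟨trivial, mem_ball_self one_pos⟩, hθ.zero⟩
      exact mul_ne_zero (hf0 q hqp) (zpow_ne_zero _ (dipole_ne_zero h' hqp))
  · intro q hq
    rw [patch_of_notMem fun h => hq (hθO h)]
    show f q * _ = _
    rw [hfO q hq]

theorem mem_nhdsWithin_connectedComponentIn_surfaceBoundary (hX : IsSurface X) {x p : X}
    (hp : p ∈ connectedComponentIn (surfaceBoundary X) x) :
    connectedComponentIn (surfaceBoundary X) x ∈ 𝓝[surfaceBoundary X] p := by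
  obtain ⟨ψ, hψ, -⟩ := hX.exists_disc_of_mem_surfaceBoundary
    (connectedComponentIn_subset _ _ hp) univ_mem
  obtain ⟨g, -, -, hg⟩ := hψ.exists_boundary_chart hp
  refine mem_of_superset (inter_mem_nhdsWithin _ (hψ.mem_nhds zero_mem_upperHalf)) ?_
  rintro _ ⟨hq, z, hz, rfl⟩
  have him := (hψ.mem_surfaceBoundary_iff hz).1 hq
  have hz' : z = (z.re : ℂ) := Complex.ext (by simp) (by simpa using him)
  have h1 : |z.re| < 1 := (Complex.abs_re_le_norm z).trans_lt (mem_ball_zero_iff.1 hz.2)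
  rw [hz', ← hg z.re (abs_lt.1 h1)]
  exact (g z.re).2

theorem exists_sign_sqrt {ψ : ℂ → X} {p : X} (h : IsDiscAt upperHalf ψ p) {P Q : Set X} {s : ℝ}
    (hs : s = 1 ∨ s = -1) (H : ∀ t ∈ Ioo (0 : ℝ) 1, (ψ ((s * t : ℝ) : ℂ) ∈ P ∧ ψ ((s * t : ℝ) : ℂ) ∉ Q) ∧
      ψ ((-(s * t) : ℝ) : ℂ) ∈ Q ∧ ψ ((-(s * t) : ℝ) : ℂ) ∉ P) {d : ℤ} (hd : IsUnit d) {g : X → ℂ}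
    (hgP : ∀ q ∈ P, g q = 1) (hgP' : ∀ q ∉ P, g q = -1) :
    ∃ w : ℂ → ℂ, Continuous w ∧ (∀ z ∈ upperHalf ∩ ball (0 : ℂ) 1, ψ z ∈ surfaceBoundary X →
      w z ^ 2 = dipole ψ (ψ z) ^ d) ∧ ∀ z ∈ upperHalf ∩ ball (0 : ℂ) 1, 3 / 4 < ‖z‖ →
      ψ z ∈ surfaceBoundary X → w z = g (ψ z) := by
  obtain ⟨ρ, hρ, hρ2, hρ1, hρ1'⟩ := exists_sqrt_poleFun
  have hρ0 : ∀ t, ρ t ≠ 0 := fun t h0 => by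
    have h1 := hρ2 t
    rw [h0] at h1
    refine poleFun_ne_zero (z := t) (fun h => ?_) (ofReal_mem_upperHalf t) (by rw [← h1]; simp)
    have := congrArg Complex.im h
    rw [poleAt_im] at this
    norm_num at this
  have hs0 : (s : ℂ) ≠ 0 := by rcases hs with rfl | rfl <;> norm_num
  have hs2 : (s : ℂ) ^ 2 = 1 := by rcases hs with rfl | rfl <;> norm_num
  have hsd : (1 : ℂ) ^ d = 1 ∧ (-1 : ℂ) ^ d = -1 := by
    rcases Int.isUnit_iff.1 hd with rfl | rfl <;> norm_num
  refine ⟨fun z => (s * ρ z.re) ^ d, ?_, ?_, ?_⟩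
  · exact (continuous_const.mul (hρ.comp Complex.continuous_re)).zpow₀ _
      fun z => Or.inl (mul_ne_zero hs0 (hρ0 _))
  · intro z hz hb
    have him := (h.mem_surfaceBoundary_iff hz).1 hb
    have hz' : z = (z.re : ℂ) := Complex.ext (by simp) (by simpa using him)
    rw [dipole, patch_apply h.chart hz]
    conv_rhs => rw [hz', ← hρ2]
    rw [← zpow_natCast, ← zpow_mul, ← zpow_natCast, ← zpow_mul, mul_comm d, zpow_mul, zpow_mul]
    congr 1
    simp only [Nat.cast_ofNat, zpow_ofNat]
    rw [mul_pow, hs2, one_mul]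
  · intro z hz h34 hb
    have him := (h.mem_surfaceBoundary_iff hz).1 hb
    have hz' : z = (z.re : ℂ) := Complex.ext (by simp) (by simpa using him)
    have habs : ‖z‖ = |z.re| := by
      conv_lhs => rw [hz']
      rw [Complex.norm_real, Real.norm_eq_abs]
    have hlt : |z.re| < 1 := habs ▸ mem_ball_zero_iff.1 hz.2
    rw [habs] at h34
    have hmem : |z.re| ∈ Ioo (0 : ℝ) 1 := ⟨by linarith, hlt⟩
    obtain ⟨⟨a1, a2⟩, a3, a4⟩ := H _ hmem
    have key : (z.re = s * |z.re| ∧ s * ρ z.re = 1) ∨ (z.re = -(s * |z.re|) ∧ s * ρ z.re = -1) := by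
      rcases le_total 0 z.re with h0 | h0
      · rw [abs_of_nonneg h0] at h34 ⊢
        rw [hρ1 _ h34.le]
        rcases hs with rfl | rfl
        · left; norm_num
        · right; norm_num
      · rw [abs_of_nonpos h0] at h34 ⊢
        rw [hρ1' _ (by linarith)]
        rcases hs with rfl | rfl
        · right; norm_num
        · left; norm_num
    show (s * ρ z.re) ^ d = _
    rcases key with ⟨k1, k2⟩ | ⟨k1, k2⟩
    · rw [k2, hsd.1, hgP]
      rw [hz', k1]
      exact a1
    · rw [k2, hsd.2, hgP']
      rw [hz', k1]
      exact a4

/-- The function dual to a curve crossing the surface from `x` to `y`, with its square root along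
the boundary. -/
theorem exists_dual_function [CompactSpace X] [T2Space X] (hX : IsSurface X) {x y : X}
    (hx : x ∈ surfaceBoundary X) (hy : y ∈ connectedComponentIn (surfaceBoundary X) x)
    (hxy : x ≠ y) {O W : Set X} (hO : IsOpen O) (hc : IsPreconnected O)
    (hb : ∀ q ∈ O, q ∉ surfaceBoundary X) (hWx : W ∈ 𝓝 x) (hWy : W ∈ 𝓝 y)
    (hWO : W \ surfaceBoundary X ⊆ O) (hOW : O ⊆ W) :
    ∃ (P Q : Set X) (F r : X → ℂ), IsPreconnected P ∧ IsPreconnected Q ∧ x ∈ P ∧ x ∈ Q ∧ y ∈ P ∧ y ∈ Q ∧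
      P ∪ Q = connectedComponentIn (surfaceBoundary X) x ∧ P ∩ Q = {x, y} ∧ Continuous F ∧ (∀ q, F q ≠ 0) ∧
      (∀ q ∉ W, F q = 1) ∧ ContinuousOn r (surfaceBoundary X) ∧
      (∀ q ∈ surfaceBoundary X, r q ^ 2 = F q) ∧ (∀ q ∈ P, q ∉ W → r q = 1) ∧
      ∀ q ∈ surfaceBoundary X, q ∉ P → q ∉ W → r q = -1 := by
  classical
  obtain ⟨P, Q, hP, hQ, hPc, hQc, hu, hi, hflip⟩ := hX.exists_boundary_split hx hy hxy
  have hPQ : ∀ p ∈ ({x, y} : Set X), p ∈ P ∧ p ∈ Q := fun p hp => by rwa [← hi] at hp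
  have hxm : x ∈ ({x, y} : Set X) := by simp
  have hym : y ∈ ({x, y} : Set X) := by simp
  have hPb : P ⊆ surfaceBoundary X := fun q hq =>
    connectedComponentIn_subset _ _ (hu ▸ Or.inl hq : q ∈ connectedComponentIn (surfaceBoundary X) x)
  have hdisc : ∀ p ∈ ({x, y} : Set X), ∀ N ∈ 𝓝 p, ∃ ψ, IsDiscAt upperHalf ψ p ∧
      ψ '' (upperHalf ∩ ball 0 1) ⊆ N ∧ ∃ s : ℝ, (s = 1 ∨ s = -1) ∧ ∀ t ∈ Ioo (0 : ℝ) 1,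
        (ψ ((s * t : ℝ) : ℂ) ∈ P ∧ ψ ((s * t : ℝ) : ℂ) ∉ Q) ∧
          ψ ((-(s * t) : ℝ) : ℂ) ∈ Q ∧ ψ ((-(s * t) : ℝ) : ℂ) ∉ P := by
    intro p hp N hN
    obtain ⟨ψ, hψ, hψN⟩ := hX.exists_disc_of_mem_surfaceBoundary (hPb (hPQ p hp).1) hN
    obtain ⟨s, hs, δ, hδ, hδ1, H⟩ := hflip p hp ψ hψ
    have hd := hψ.affine_of_iff (N := upperHalf) (b := 0) hδ (by simpa using hδ1)
      fun w _ => by rw [zero_add]; exact smul_mem_upperHalf_iff δ hδ w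
    rw [hψ.zero] at hd
    refine ⟨_, hd, ?_, s, hs, fun t ht => ?_⟩
    · rintro _ ⟨w, ⟨hw, hw1⟩, rfl⟩
      refine hψN ⟨_, ⟨?_, ?_⟩, rfl⟩
      · rw [zero_add]; exact (smul_mem_upperHalf_iff δ hδ w).2 hw
      · rw [mem_ball_zero_iff] at hw1 ⊢
        rw [zero_add, norm_mul, Complex.norm_real, Real.norm_eq_abs, abs_of_pos hδ]
        nlinarith [norm_nonneg w]
    · have := H (δ * t) ⟨mul_pos hδ ht.1, by nlinarith [ht.2]⟩
      have e1 : (0 : ℂ) + δ * ((s * t : ℝ) : ℂ) = ((s * (δ * t) : ℝ) : ℂ) := by push_cast; ring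
      have e2 : (0 : ℂ) + δ * ((-(s * t) : ℝ) : ℂ) = ((-(s * (δ * t)) : ℝ) : ℂ) := by push_cast; ring
      simp only [e1, e2]
      exact this
  obtain ⟨Ux, Uy, hUx, hUy, hxU, hyU, hUd⟩ := t2_separation hxy
  obtain ⟨ψ, hψ, hψN, s, hs, H⟩ := hdisc x hxm (W ∩ Ux) (inter_mem hWx (hUx.mem_nhds hxU))
  obtain ⟨ψ', hψ', hψN', s', hs', H'⟩ := hdisc y hym (W ∩ Uy) (inter_mem hWy (hUy.mem_nhds hyU))
  have hin : ∀ {ψ : ℂ → X} {p : X}, IsDiscAt upperHalf ψ p → ψ '' (upperHalf ∩ ball 0 1) ⊆ W →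
      ∀ z ∈ upperHalf ∩ ball (0 : ℂ) 1, 0 < z.im → ψ z ∈ O := fun h hN z hz him =>
    hWO ⟨hN (mem_image_of_mem _ hz), fun hb => him.ne' ((h.mem_surfaceBoundary_iff hz).1 hb)⟩
  obtain ⟨d, F, hd, hF, hF0, hFO⟩ := exists_dipole_mul_dipole hψ hψ' hO hc hb
    (hin hψ (hψN.trans inter_subset_left) _ poleAt_mem (by rw [poleAt_im]; norm_num))
    (hin hψ' (hψN'.trans inter_subset_left))
  set g : X → ℂ := fun q => if q ∈ P then 1 else -1
  have hgP : ∀ q ∈ P, g q = 1 := fun q hq => if_pos hq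
  have hgP' : ∀ q ∉ P, g q = -1 := fun q hq => if_neg hq
  obtain ⟨w, hw, hw2, hwg⟩ := exists_sign_sqrt hψ hs H isUnit_one hgP hgP'
  obtain ⟨w', hw', hw2', hwg'⟩ := exists_sign_sqrt hψ' hs' H' hd hgP hgP'
  have hdis : ∀ q ∈ ψ '' (upperHalf ∩ ball 0 1), q ∉ ψ' '' (upperHalf ∩ ball 0 1) := fun q h1 h2 =>
    disjoint_left.1 hUd (hψN h1).2 (hψN' h2).2
  have hg : ContinuousOn g (surfaceBoundary X \ {x, y}) := by
    rintro p ⟨hp, hpxy⟩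
    by_cases hpP : p ∈ P
    · have hpQ : p ∉ Q := fun hpQ => hpxy (hi ▸ ⟨hpP, hpQ⟩)
      have hpc : p ∈ connectedComponentIn (surfaceBoundary X) x := hu ▸ Or.inl hpP
      have h1 := inter_mem (mem_nhdsWithin_connectedComponentIn_surfaceBoundary hX hpc)
        (mem_nhdsWithin_of_mem_nhds (hQ.isOpen_compl.mem_nhds hpQ))
      have h2 : g =ᶠ[𝓝[surfaceBoundary X] p] fun _ => 1 := by
        filter_upwards [h1] with q hq
        rw [← hu] at hq
        exact hgP q (hq.1.resolve_right hq.2)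
      exact (continuousWithinAt_const.congr_of_eventuallyEq h2 (hgP p hpP)).mono sdiff_subset
    · have h2 : g =ᶠ[𝓝 p] fun _ => -1 := by
        filter_upwards [hP.isOpen_compl.mem_nhds hpP] with q hq using hgP' q hq
      exact (continuousAt_const.congr h2.symm).continuousWithinAt
  have hrx : ContinuousOn (patch upperHalf ψ g w) (surfaceBoundary X \ {y}) := by
    refine continuousOn_patch hψ.chart isClosed_upperHalf (hg.mono ?_) hw.continuousOn ?_
    · rintro q ⟨⟨hq, hqy⟩, hqψ⟩
      refine ⟨hq, ?_⟩
      rintro (rfl | rfl)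
      · exact hqψ ⟨0, ⟨zero_mem_upperHalf, mem_closedBall_self (by norm_num)⟩, hψ.zero⟩
      · exact hqy rfl
    · intro z hz h34 hzb
      exact hwg z hz h34 hzb.1
  have hr : ContinuousOn (patch upperHalf ψ' (patch upperHalf ψ g w) w') (surfaceBoundary X) := by
    refine continuousOn_patch hψ'.chart isClosed_upperHalf (hrx.mono ?_) hw'.continuousOn ?_
    · rintro q ⟨hq, hqψ⟩
      refine ⟨hq, ?_⟩
      rintro rfl
      exact hqψ ⟨0, ⟨zero_mem_upperHalf, mem_closedBall_self (by norm_num)⟩, hψ'.zero⟩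
    · intro z hz h34 hzb
      rw [patch_of_notMem fun h => hdis _ h (mem_image_of_mem _ hz)]
      exact hwg' z hz h34 hzb
  have hnot : ∀ q ∉ W, q ∉ ψ '' (upperHalf ∩ ball 0 1) ∧ q ∉ ψ' '' (upperHalf ∩ ball 0 1) :=
    fun q hq => ⟨fun h => hq (hψN h).1, fun h => hq (hψN' h).1⟩
  refine ⟨P, Q, F, _, hPc, hQc, (hPQ x hxm).1, (hPQ x hxm).2, (hPQ y hym).1, (hPQ y hym).2, hu, hi, hF,
    hF0, ?_, hr, ?_, ?_, ?_⟩
  · intro q hq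
    rw [hFO q fun h => hq (hOW h), dipole, dipole, patch_of_notMem (hnot q hq).1,
      patch_of_notMem (hnot q hq).2, one_zpow, one_mul]
  · intro q hq
    rw [hFO q fun h => hb q h hq]
    by_cases h1 : q ∈ ψ' '' (upperHalf ∩ ball 0 1)
    · have h2 : dipole ψ q = 1 := patch_of_notMem fun h => hdis q h h1
      rw [h2, one_mul]
      obtain ⟨z, hz, rfl⟩ := h1
      rw [patch_apply hψ'.chart hz, hw2' z hz hq]
    · have h2 : dipole ψ' q = 1 := patch_of_notMem h1
      rw [patch_of_notMem h1, h2, one_zpow, mul_one]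
      by_cases h3 : q ∈ ψ '' (upperHalf ∩ ball 0 1)
      · obtain ⟨z, hz, rfl⟩ := h3
        rw [patch_apply hψ.chart hz, hw2 z hz hq, zpow_one]
      · rw [patch_of_notMem h3, dipole, patch_of_notMem h3]
        by_cases hqP : q ∈ P
        · rw [hgP q hqP]; norm_num
        · rw [hgP' q hqP]; norm_num
  · intro q hqP hq
    rw [patch_of_notMem (hnot q hq).2, patch_of_notMem (hnot q hq).1, hgP q hqP]
  · intro q _ hqP hq
    rw [patch_of_notMem (hnot q hq).2, patch_of_notMem (hnot q hq).1, hgP' q hqP]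

end Dual

theorem IsSurface.exists_notMem_surfaceBoundary {X : Type*} [TopologicalSpace X] (hX : IsSurface X) (x : X)
    {N : Set X} (hN : N ∈ 𝓝 x) : ∃ q ∈ N, q ∉ surfaceBoundary X := by
  by_cases hx : x ∈ surfaceBoundary X
  · obtain ⟨ψ, h1, h2⟩ := hX.exists_disc_of_mem_surfaceBoundary hx hN
    refine ⟨_, h2 (mem_image_of_mem ψ poleAt_mem), fun h => ?_⟩
    have := (h1.mem_surfaceBoundary_iff poleAt_mem).1 h
    rw [poleAt_im] at this
    norm_num at this
  · exact ⟨x, mem_of_mem_nhds hN, hx⟩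

theorem IsSurface.isPreconnected_diff_surfaceBoundary {X : Type*} [TopologicalSpace X] [T2Space X]
    (hX : IsSurface X) {W : Set X} (hW : IsOpen W) (hc : IsPreconnected W) :
    IsPreconnected (W \ surfaceBoundary X) := by
  set R : X → X → Prop := fun p q => ∃ N ∈ 𝓝 p, ∃ N' ∈ 𝓝 q, ∀ a ∈ N, a ∈ W \ surfaceBoundary X →
    ∀ b ∈ N', b ∈ W \ surfaceBoundary X → ∃ C ⊆ W \ surfaceBoundary X, IsPreconnected C ∧ a ∈ C ∧ b ∈ C
  have hR : ∀ p ∈ W, ∀ q ∈ W, R p q := by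
    intro p hp q hq
    refine hc.induction₂ R ?_ ?_ ?_ hp hq
    · intro x hx
      obtain ⟨M, ψ, hM, hψ, hψW⟩ := hX.exists_disc x (hW.mem_nhds hx)
      have key : ∀ a ∈ ψ '' (M ∩ ball 0 1), a ∈ W \ surfaceBoundary X →
          ∀ b ∈ ψ '' (M ∩ ball 0 1), b ∈ W \ surfaceBoundary X →
          ∃ C ⊆ W \ surfaceBoundary X, IsPreconnected C ∧ a ∈ C ∧ b ∈ C := by
        rcases hM with rfl | rfl
        · intro a ha _ b hb _
          refine ⟨_, ?_, ((convex_univ.inter (convex_ball (0 : ℂ) 1)).isPreconnected.image ψ hψ.chart.cont),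
            ha, hb⟩
          rintro _ ⟨z, hz, rfl⟩
          exact ⟨hψW (mem_image_of_mem _ hz), hψ.notMem_surfaceBoundary hz.2⟩
        · rintro _ ⟨a, ha, rfl⟩ ha' _ ⟨b, hb, rfl⟩ hb'
          have him : ∀ a ∈ upperHalf ∩ ball (0 : ℂ) 1, ψ a ∉ surfaceBoundary X → 0 < a.im :=
            fun a ha h => lt_of_le_of_ne ha.1 fun h' => h ((hψ.mem_surfaceBoundary_iff ha).2 h'.symm)
          have hcv : Convex ℝ ({z : ℂ | 0 < z.im} ∩ ball 0 1) :=
            (convex_halfSpace_im_gt 0).inter (convex_ball _ _)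
          have hsub : {z : ℂ | 0 < z.im} ∩ ball 0 1 ⊆ upperHalf ∩ ball 0 1 := fun z hz =>
            ⟨(show 0 < z.im from hz.1).le, hz.2⟩
          refine ⟨_, ?_, hcv.isPreconnected.image ψ (hψ.chart.cont.mono hsub),
            mem_image_of_mem _ ⟨him a ha ha'.2, ha.2⟩, mem_image_of_mem _ ⟨him b hb hb'.2, hb.2⟩⟩
          rintro _ ⟨z, hz, rfl⟩
          exact ⟨hψW (mem_image_of_mem _ (hsub hz)), fun h =>
            (show 0 < z.im from hz.1).ne' ((hψ.mem_surfaceBoundary_iff (hsub hz)).1 h)⟩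
      have hN : ∀ y ∈ ψ '' (M ∩ ball 0 1), ψ '' (M ∩ ball 0 1) ∈ 𝓝 y := fun y hy =>
        hψ.chart.isOpen_range.mem_nhds hy
      filter_upwards [mem_nhdsWithin_of_mem_nhds (hψ.mem_nhds hM.zero_mem)] with y hy
      exact ⟨_, hψ.mem_nhds hM.zero_mem, _, hN y hy, key⟩
    · rintro x y z hx hy hz ⟨N, hN, N', hN', h⟩ ⟨N₁, hN₁, N₁', hN₁', h'⟩
      obtain ⟨c, ⟨⟨hc1, hc2⟩, hcW⟩, hcb⟩ := hX.exists_notMem_surfaceBoundary y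
        (inter_mem (inter_mem hN' hN₁) (hW.mem_nhds hy))
      refine ⟨N, hN, N₁', hN₁', fun a ha haW b hb hbW => ?_⟩
      obtain ⟨C, hC, hCc, ha1, hc1⟩ := h a ha haW c hc1 ⟨hcW, hcb⟩
      obtain ⟨C', hC', hCc', ha1', hc1'⟩ := h' c hc2 ⟨hcW, hcb⟩ b hb hbW
      exact ⟨C ∪ C', union_subset hC hC', hCc.union c hc1 ha1' hCc', Or.inl ha1, Or.inr hc1'⟩
    · rintro x y _ _ ⟨N, hN, N', hN', h⟩
      refine ⟨N', hN', N, hN, fun a ha haW b hb hbW => ?_⟩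
      obtain ⟨C, h1, h2, h3, h4⟩ := h b hb hbW a ha haW
      exact ⟨C, h1, h2, h4, h3⟩
  refine isPreconnected_of_forall_pair fun a ha b hb => ?_
  obtain ⟨N, hN, N', hN', h⟩ := hR a ha.1 b hb.1
  obtain ⟨C, h1, h2, h3, h4⟩ := h a (mem_of_mem_nhds hN) ha b (mem_of_mem_nhds hN') hb
  exact ⟨C, h1, h3, h4, h2⟩

/-! ## Crossing argument in the square -/

theorem false_of_sign_square {S T : Set (ℝ × ℝ)} (hS : IsClosed S) (hT : IsClosed T)
    (hST : S ∪ T = univ) {f : ℝ × ℝ → ℝ} (hf : ContinuousOn f (S ∩ T))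
    (hf1 : ∀ p ∈ S ∩ T, f p = 1 ∨ f p = -1) (hbot : ∀ t ∈ Icc (0 : ℝ) 1, ((0 : ℝ), t) ∈ S)
    (htop : ∀ t ∈ Icc (0 : ℝ) 1, ((1 : ℝ), t) ∈ T)
    (hleft : ∀ s ∈ Icc (0 : ℝ) 1, (s, (0 : ℝ)) ∈ S ∩ T ∧ f (s, 0) = 1)
    (hright : ∀ s ∈ Icc (0 : ℝ) 1, (s, (1 : ℝ)) ∈ S ∩ T ∧ f (s, 1) = -1) : False := by
  have z0 : (0 : ℝ) ∈ Icc (0 : ℝ) 1 := by simp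
  have z1 : (1 : ℝ) ∈ Icc (0 : ℝ) 1 := by simp
  have hSne : S.Nonempty := ⟨_, hbot 0 z0⟩
  have hTne : T.Nonempty := ⟨_, htop 0 z0⟩
  obtain ⟨τ, hτ⟩ := ContinuousMap.exists_restrict_eq (hS.inter hT)
    (⟨_, continuousOn_iff_continuous_domRestrict.1 hf⟩ : C((S ∩ T : Set (ℝ × ℝ)), ℝ))
  have hτ' : ∀ p ∈ S ∩ T, τ p = f p := fun p hp => by
    have := congrArg (fun g => g ⟨p, hp⟩) hτ
    simpa using this
  set u : ℝ × ℝ → ℝ := fun p => infDist p T - infDist p S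
  have hu : Continuous u := (continuous_infDist_pt T).sub (continuous_infDist_pt S)
  have huS : ∀ p ∈ S, 0 ≤ u p := fun p hp => by
    show 0 ≤ infDist p T - infDist p S
    rw [infDist_zero_of_mem hp, sub_zero]; exact infDist_nonneg
  have huT : ∀ p ∈ T, u p ≤ 0 := fun p hp => by
    show infDist p T - infDist p S ≤ 0
    rw [infDist_zero_of_mem hp, zero_sub, neg_nonpos]; exact infDist_nonneg
  have hu0 : ∀ p, u p = 0 → p ∈ S ∩ T := by
    intro p hp
    have hp' : infDist p T - infDist p S = 0 := hp
    rcases (hST ▸ mem_univ p : p ∈ S ∪ T) with h | h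
    · rw [infDist_zero_of_mem h, sub_zero] at hp'
      exact ⟨h, (hT.mem_iff_infDist_zero hTne).2 hp'⟩
    · rw [infDist_zero_of_mem h, zero_sub, neg_eq_zero] at hp'
      exact ⟨(hS.mem_iff_infDist_zero hSne).2 hp', h⟩
  set ω : ℝ × ℝ → ℂ := fun p => τ p + u p * Complex.I
  have hre : ∀ p, (ω p).re = τ p := fun p => by simp [ω]
  have him : ∀ p, (ω p).im = u p := fun p => by simp [ω]
  have hω : Continuous ω := by fun_prop
  have hω0 : ∀ p, ω p ≠ 0 := by
    intro p hp
    have h1 := hre p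
    have h2 := him p
    rw [hp, Complex.zero_re] at h1
    rw [hp, Complex.zero_im] at h2
    have hm := hu0 p h2.symm
    rcases hf1 p hm with h | h <;> rw [hτ' p hm, h] at h1 <;> norm_num at h1
  obtain ⟨K, hK, hKω⟩ := exists_log_of_simplyConnected hω hω0
  have hωp : ∀ p ∈ S ∩ T, ω p = f p := fun p hp => by
    have h0 : u p = 0 := le_antisymm (huT p hp.2) (huS p hp.1)
    show (τ p : ℂ) + u p * Complex.I = _
    rw [h0, hτ' p hp]
    simp
  have hl : ∀ s ∈ Icc (0 : ℝ) 1, ω (s, 0) = 1 := fun s hs => by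
    rw [hωp _ (hleft s hs).1, (hleft s hs).2]; simp
  have hr : ∀ s ∈ Icc (0 : ℝ) 1, ω (s, 1) = -1 := fun s hs => by
    rw [hωp _ (hright s hs).1, (hright s hs).2]; simp
  have e1 : K (0, 0) = K (1, 0) := eq_of_exp_eq_const (k := fun s : ℝ => K (s, 0)) (S := Icc 0 1) (c := 1)
    isPreconnected_Icc (hK.comp (by fun_prop)).continuousOn (fun s hs => by rw [hKω, hl s hs]) z0 z1
  have e2 : K (0, 1) = K (1, 1) := eq_of_exp_eq_const (k := fun s : ℝ => K (s, 1)) (S := Icc 0 1) (c := -1)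
    isPreconnected_Icc (hK.comp (by fun_prop)).continuousOn (fun s hs => by rw [hKω, hr s hs]) z0 z1
  have key : ∀ (c : ℂ) (s : ℝ), c ≠ 0 → (∀ t ∈ Icc (0 : ℝ) 1, 0 ≤ (c * ω (s, t)).re) →
      (∀ w : ℂ, w ≠ 0 → 0 ≤ (c * w).re → c * w ∈ Complex.slitPlane) →
      K (s, 0) - Complex.log (c * ω (s, 0)) = K (s, 1) - Complex.log (c * ω (s, 1)) := by
    intro c s hc hre hsl
    refine eq_of_exp_eq_const (k := fun t : ℝ => K (s, t) - Complex.log (c * ω (s, t))) (S := Icc 0 1)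
      (c := c⁻¹) isPreconnected_Icc ?_ (fun t ht => ?_) z0 z1
    · refine (hK.comp (by fun_prop)).continuousOn.sub (ContinuousOn.clog ?_ fun t ht =>
        hsl _ (hω0 _) (hre t ht))
      exact (continuous_const.mul (hω.comp (by fun_prop))).continuousOn
    · rw [Complex.exp_sub, hKω, Complex.exp_log (mul_ne_zero hc (hω0 _))]
      field_simp [hω0 (s, t)]
  have hslit : ∀ w : ℂ, w ≠ 0 → 0 ≤ w.re → w ∈ Complex.slitPlane := by
    intro w hw h0
    rcases h0.eq_or_lt with h | h
    · exact Or.inr fun h' => hw (Complex.ext h.symm h')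
    · exact Or.inl h
  have k1 := key (-Complex.I) 0 (by simp) (fun t ht => by
    have := huS _ (hbot t ht)
    rw [← him] at this
    simpa using this) (fun w hw h => hslit _ (by simpa using hw) h)
  have k2 := key Complex.I 1 (by simp) (fun t ht => by
    have := huT _ (htop t ht)
    rw [← him] at this
    simpa using this) (fun w hw h => hslit _ (by simpa using hw) h)
  rw [hl 0 z0, hr 0 z0, mul_one, neg_mul_neg, mul_one, Complex.log_I, Complex.log_neg_I, e1, e2] at k1
  rw [hl 1 z1, hr 1 z1, mul_one, mul_neg_one, Complex.log_I, Complex.log_neg_I] at k2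
  have h3 : (2 : ℂ) * (Real.pi * Complex.I) = 0 := by linear_combination k1 - k2
  have := Real.pi_ne_zero
  simp [Complex.I_ne_zero] at h3

namespace IsMetricDouble

variable {X : Type*} [MetricSpace X] {B : Set X} {D : Type*} [MetricSpace D] {ip im : X → D}

theorem swap (h : IsMetricDouble X B D ip im) : IsMetricDouble X B D im ip where
  isom_p := h.isom_m
  isom_m := h.isom_p
  surj := by rw [union_comm]; exact h.surj
  agree z hz := (h.agree z hz).symm
  dist_mix a b := by
    rw [dist_comm, h.dist_mix]
    refine iInf_congr fun z => ?_
    rw [dist_comm b, dist_comm _ a, add_comm]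

theorem dist_le_dist_mix (h : IsMetricDouble X B D ip im) (hB : B.Nonempty) (a b : X) :
    dist a b ≤ dist (ip a) (im b) := by
  have := hB.to_subtype
  rw [h.dist_mix]
  exact le_ciInf fun z => dist_triangle _ _ _

theorem eq_of_ip_eq_im (h : IsMetricDouble X B D ip im) (hB : B.Nonempty) (hBc : IsClosed B) {a b : X}
    (hab : ip a = im b) : a = b ∧ a ∈ B := by
  have h0 : dist (ip a) (im b) = 0 := by rw [hab, dist_self]
  refine ⟨dist_le_zero.1 (h0 ▸ h.dist_le_dist_mix hB a b), ?_⟩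
  have := hB.to_subtype
  rw [hBc.mem_iff_infDist_zero hB]
  refine le_antisymm ?_ infDist_nonneg
  rw [← h0, h.dist_mix]
  exact le_ciInf fun z => (infDist_le_dist_of_mem z.2).trans (le_add_of_nonneg_right dist_nonneg)

/-- The folding map. -/
theorem exists_fold (h : IsMetricDouble X B D ip im) (hB : B.Nonempty) (hBc : IsClosed B) :
    ∃ π : D → X, Continuous π ∧ (∀ a, π (ip a) = a) ∧ ∀ a, π (im a) = a := by
  have hex : ∀ u : D, ∃ a, ip a = u ∨ im a = u := fun u => by
    rcases (h.surj ▸ mem_univ u : u ∈ range ip ∪ range im) with ⟨a, ha⟩ | ⟨a, ha⟩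
    exacts [⟨a, Or.inl ha⟩, ⟨a, Or.inr ha⟩]
  choose π hπ using hex
  have hp : ∀ a, π (ip a) = a := fun a => by
    rcases hπ (ip a) with h1 | h1
    · exact h.isom_p.injective h1
    · exact (h.eq_of_ip_eq_im hB hBc h1.symm).1.symm
  have hm : ∀ a, π (im a) = a := fun a => by
    rcases hπ (im a) with h1 | h1
    · exact (h.eq_of_ip_eq_im hB hBc h1).1
    · exact h.isom_m.injective h1
  refine ⟨π, ?_, hp, hm⟩
  have : LipschitzWith 1 π := by
    refine LipschitzWith.of_dist_le_mul fun u v => ?_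
    rw [NNReal.coe_one, one_mul]
    rcases hπ u with hu | hu <;> rcases hπ v with hv | hv
    · conv_rhs => rw [← hu, ← hv]
      rw [h.isom_p.dist_eq]
    · conv_rhs => rw [← hu, ← hv]
      exact h.dist_le_dist_mix hB _ _
    · conv_rhs => rw [← hu, ← hv]
      exact h.swap.dist_le_dist_mix hB _ _
    · conv_rhs => rw [← hu, ← hv]
      rw [h.isom_m.dist_eq]
  exact this.continuous

/-- The two copies of a path on which the dual function is trivial, joining boundary points with
different signs, are not homotopic. -/
theorem not_homotopic [CompactSpace X] (h : IsMetricDouble X B D ip im) (hBc : IsClosed B) {F r : X → ℂ}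
    (hF : Continuous F) (hF0 : ∀ q, F q ≠ 0) (hr : ContinuousOn r B) (hrF : ∀ q ∈ B, r q ^ 2 = F q)
    {p p' : X} (hp : p ∈ B) (hp' : p' ∈ B) (γ : Path p p') (hγ : ∀ t, F (γ t) = 1) (hrp : r p = 1)
    (hrp' : r p' = -1) (H : I × I → D) (hH : Continuous H) (h0 : ∀ t, H (0, t) = ip (γ t))
    (h1 : ∀ t, H (1, t) = im (γ t)) (hl : ∀ s, H (s, 0) = ip p) (hr' : ∀ s, H (s, 1) = ip p') :
    False := by
  have hB : B.Nonempty := ⟨p, hp⟩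
  obtain ⟨π, hπ, hπp, hπm⟩ := h.exists_fold hB hBc
  set G : ℝ × ℝ → D := fun z => H (projIcc 0 1 zero_le_one z.1, projIcc 0 1 zero_le_one z.2)
  have hG : Continuous G := hH.comp ((continuous_projIcc.comp continuous_fst).prodMk
    (continuous_projIcc.comp continuous_snd))
  have e0 : projIcc (0 : ℝ) 1 zero_le_one 0 = 0 := projIcc_left _
  have e1 : projIcc (0 : ℝ) 1 zero_le_one 1 = 1 := projIcc_right _
  have G0 : ∀ t : ℝ, G (0, t) = ip (γ (projIcc 0 1 zero_le_one t)) := fun t => by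
    simp only [G, e0, h0]
  have G1 : ∀ t : ℝ, G (1, t) = im (γ (projIcc 0 1 zero_le_one t)) := fun t => by
    simp only [G, e1, h1]
  have Gl : ∀ s : ℝ, G (s, 0) = ip p := fun s => by simp only [G, e0, hl]
  have Gr : ∀ s : ℝ, G (s, 1) = ip p' := fun s => by simp only [G, e1, hr']
  have hFp : F p = 1 := by have := hγ 0; rwa [γ.source] at this
  have hFp' : F p' = 1 := by have := hγ 1; rwa [γ.target] at this
  obtain ⟨K, hK, hKF⟩ := exists_log_of_simplyConnected (hF.comp (hπ.comp hG)) fun z => hF0 _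
  simp only [Function.comp_apply] at hKF
  have z0 : (0 : ℝ) ∈ (univ : Set ℝ) := trivial
  have kl : ∀ s : ℝ, K (s, 0) = K (0, 0) := fun s =>
    eq_of_exp_eq_const (k := fun s : ℝ => K (s, 0)) (S := univ) (c := 1) isPreconnected_univ
      (hK.comp (by fun_prop)).continuousOn (fun s _ => by rw [hKF, Gl, hπp, hFp]) trivial trivial
  have kr : ∀ s : ℝ, K (s, 1) = K (0, 1) := fun s =>
    eq_of_exp_eq_const (k := fun s : ℝ => K (s, 1)) (S := univ) (c := 1) isPreconnected_univ
      (hK.comp (by fun_prop)).continuousOn (fun s _ => by rw [hKF, Gr, hπp, hFp']) trivial trivial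
  have kb : K (0, 1) = K (0, 0) :=
    eq_of_exp_eq_const (k := fun t : ℝ => K (0, t)) (S := univ) (c := 1) isPreconnected_univ
      (hK.comp (by fun_prop)).continuousOn (fun s _ => by rw [hKF, G0, hπp, hγ]) trivial trivial
  have hK00 : Complex.exp (K (0, 0)) = 1 := by rw [hKF, Gl, hπp, hFp]
  set g : ℝ × ℝ → ℂ := fun z => Complex.exp ((K z - K (0, 0)) / 2)
  have hg : Continuous g := by fun_prop
  have hg2 : ∀ z, g z ^ 2 = F (π (G z)) := fun z => by
    rw [← Complex.exp_nat_mul, ← hKF]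
    have : ((2 : ℕ) : ℂ) * ((K z - K (0, 0)) / 2) = K z - K (0, 0) := by push_cast; ring
    rw [this, Complex.exp_sub, hK00, div_one]
  have gl : ∀ s : ℝ, g (s, 0) = 1 := fun s => by simp only [g, kl s]; simp
  have gr : ∀ s : ℝ, g (s, 1) = 1 := fun s => by simp only [g, kr s, kb]; simp
  have hST : ∀ z ∈ G ⁻¹' range ip ∩ G ⁻¹' range im, π (G z) ∈ B := by
    rintro z ⟨⟨a, ha⟩, b, hb⟩
    have := h.eq_of_ip_eq_im hB hBc (ha.trans hb.symm)
    rw [← ha, hπp]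
    exact this.2
  have hr0 : ∀ q ∈ B, r q ≠ 0 := fun q hq h0 => hF0 q (by rw [← hrF q hq, h0]; norm_num)
  set f : ℝ × ℝ → ℝ := fun z => (g z / r (π (G z))).re
  have hsq : ∀ z ∈ G ⁻¹' range ip ∩ G ⁻¹' range im, (g z / r (π (G z))) ^ 2 = 1 := fun z hz => by
    rw [div_pow, hg2, hrF _ (hST z hz), div_self (hF0 _)]
  have hip : ∀ q ∈ B, ip q ∈ range ip ∩ range im := fun q hq => ⟨⟨q, rfl⟩, q, (h.agree q hq).symm⟩
  refine false_of_sign_square (S := G ⁻¹' range ip) (T := G ⁻¹' range im) (f := f)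
    ((isCompact_range h.isom_p.continuous).isClosed.preimage hG)
    ((isCompact_range h.isom_m.continuous).isClosed.preimage hG) ?_ ?_ ?_ ?_ ?_ ?_ ?_
  · rw [← preimage_union, h.surj, preimage_univ]
  · refine Complex.continuous_re.comp_continuousOn (hg.continuousOn.div ?_ fun z hz => hr0 _ (hST z hz))
    exact hr.comp (hπ.comp hG).continuousOn hST
  · intro z hz
    rcases mul_self_eq_one_iff.1 ((sq _).symm.trans (hsq z hz)) with h' | h'
    · left; simp only [f, h', Complex.one_re]
    · right; simp only [f, h', Complex.neg_re, Complex.one_re]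
  · intro t _
    rw [mem_preimage, G0]
    exact ⟨_, rfl⟩
  · intro t _
    rw [mem_preimage, G1]
    exact ⟨_, rfl⟩
  · intro s _
    refine ⟨?_, ?_⟩
    · show G (s, 0) ∈ range ip ∩ range im
      rw [Gl]
      exact hip p hp
    · simp only [f, gl, Gl, hπp, hrp, div_one, Complex.one_re]
  · intro s _
    refine ⟨?_, ?_⟩
    · show G (s, 1) ∈ range ip ∩ range im
      rw [Gr]
      exact hip p' hp'
    · simp only [f, gr, Gr, hπp, hrp']
      norm_num

end IsMetricDouble

theorem Path.Homotopic.of_trans_right {X : Type*} [TopologicalSpace X] {u v w : X} {p q : Path u v}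
    {r : Path v w} (h : (p.trans r).Homotopic (q.trans r)) : p.Homotopic q := by
  rw [← Path.Homotopic.Quotient.eq] at h ⊢
  simp only [Path.Homotopic.Quotient.mk_trans] at h
  have := congrArg (fun a => a.trans (Path.Homotopic.Quotient.mk r).symm) h
  simpa using this

theorem homotopic_map_of_homotopic_const {X C : Type*} [TopologicalSpace X] [TopologicalSpace C] {f : C(C, X)}
    {y : X} (hf : f.Homotopic (ContinuousMap.const _ y)) {p q : C} (a b : Path p q) :
    (a.map f.continuous).Homotopic (b.map f.continuous) := by
  obtain ⟨H⟩ := hf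
  have ha := Path.Homotopic.map_trans_evalAt H a
  have hb := Path.Homotopic.map_trans_evalAt H b
  have : (a.map (ContinuousMap.const C y).continuous) = b.map (ContinuousMap.const C y).continuous := by
    ext t; rfl
  rw [← this] at hb
  exact (ha.trans hb.symm).of_trans_right

theorem Circle1.mem_iff {w : EuclideanSpace ℝ (Fin 2)} : w ∈ Circle1 ↔ w 0 ^ 2 + w 1 ^ 2 = 1 := by
  rw [Circle1, mem_sphere_zero_iff_norm, EuclideanSpace.norm_eq, Real.sqrt_eq_one]
  simp [Fin.sum_univ_two]

theorem Circle1.bound (w : Circle1) : -1 ≤ w.1 0 ∧ w.1 0 ≤ 1 := by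
  have := Circle1.mem_iff.1 w.2
  constructor <;> nlinarith [sq_nonneg (w.1 1)]

/-- The half circles. -/
noncomputable def Circle1.half (s : ℝ) (hs : s ^ 2 = 1) : C(I, Circle1) where
  toFun t := ⟨!₂[2 * (t : ℝ) - 1, s * √(1 - (2 * (t : ℝ) - 1) ^ 2)], by
    rw [Circle1.mem_iff]
    have h : (0 : ℝ) ≤ 1 - (2 * (t : ℝ) - 1) ^ 2 := by nlinarith [t.2.1, t.2.2]
    simp [mul_pow, hs, Real.sq_sqrt h]⟩
  continuous_toFun := by
    refine Continuous.subtype_mk ?_ _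
    refine (PiLp.continuous_toLp 2 _).comp (continuous_pi fun i => ?_)
    fin_cases i <;> simp <;> fun_prop

theorem isNonContractibleJordanCurve_of_not_homotopic {X : Type*} [TopologicalSpace X] [T2Space X]
    {u v : X} {α β : Path u v} (hα : Function.Injective α) (hβ : Function.Injective β)
    (hd : range α ∩ range β ⊆ {u, v}) (hn : ¬ α.Homotopic β) :
    IsNonContractibleJordanCurve (range α ∪ range β) := by
  set τ : Circle1 → I := fun w => ⟨(1 + w.1 0) / 2, by
    constructor <;> linarith [(Circle1.bound w).1, (Circle1.bound w).2]⟩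
  have hτ : Continuous τ := by
    refine Continuous.subtype_mk ?_ _
    have : Continuous fun w : Circle1 => w.1 0 := (EuclideanSpace.proj (𝕜 := ℝ) (0 : Fin 2)).continuous.comp continuous_subtype_val
    fun_prop
  have h1c : Continuous fun w : Circle1 => w.1 1 := (EuclideanSpace.proj (𝕜 := ℝ) (1 : Fin 2)).continuous.comp continuous_subtype_val
  have hends : ∀ w : Circle1, w.1 1 = 0 → τ w = 0 ∨ τ w = 1 := by
    intro w hw
    have := Circle1.mem_iff.1 w.2
    rw [hw] at this
    have h2 : (w.1 0 - 1) * (w.1 0 + 1) = 0 := by nlinarith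
    rcases mul_eq_zero.1 h2 with h | h
    · right; ext; simp only [τ, Icc.coe_one]; linarith
    · left; ext; simp only [τ, Icc.coe_zero]; linarith
  classical
  set Φ : Circle1 → X := fun w => if 0 ≤ w.1 1 then α (τ w) else β (τ w)
  have hagree : ∀ w : Circle1, w.1 1 = 0 → α (τ w) = β (τ w) := by
    intro w hw
    rcases hends w hw with h | h <;> simp [h]
  have hΦ : Continuous Φ :=
    Continuous.if_le (α.continuous.comp hτ) (β.continuous.comp hτ) continuous_const h1c
      fun w hw => hagree w hw.symm
  have hΦα : ∀ w : Circle1, 0 ≤ w.1 1 → Φ w = α (τ w) := fun w hw => if_pos hw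
  have hΦβ : ∀ w : Circle1, w.1 1 ≤ 0 → Φ w = β (τ w) := fun w hw => by
    rcases hw.lt_or_eq with h | h
    · exact if_neg (not_le.2 h)
    · rw [hΦα w h.ge, hagree w h]
  have hτinj : ∀ w w' : Circle1, τ w = τ w' → 0 ≤ w.1 1 * w'.1 1 → w = w' := by
    intro w w' h hs
    have h0 : w.1 0 = w'.1 0 := by
      have := congrArg Subtype.val h
      simp only [τ] at this
      linarith
    have e := Circle1.mem_iff.1 w.2
    have e' := Circle1.mem_iff.1 w'.2
    have h1 : w.1 1 = w'.1 1 := by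
      rw [h0] at e
      have : w.1 1 ^ 2 = w'.1 1 ^ 2 := by linarith
      rcases sq_eq_sq_iff_eq_or_eq_neg.1 this with h | h
      · exact h
      · rw [h] at hs ⊢
        have : w'.1 1 = 0 := by nlinarith
        rw [this]; simp
    ext i
    fin_cases i <;> assumption
  have hmix : ∀ w w' : Circle1, 0 ≤ w.1 1 → w'.1 1 ≤ 0 → Φ w = Φ w' → w = w' := by
    intro w w' hw hw' h
    have hww := h
    rw [hΦα w hw, hΦβ w' hw'] at h
    have hmem := hd ⟨⟨_, rfl⟩, ⟨_, h.symm⟩⟩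
    have ht : τ w = τ w' ∧ (τ w = 0 ∨ τ w = 1) := by
      rcases hmem with h' | h'
      · have a1 : τ w = 0 := hα (h'.trans α.source.symm)
        have a2 : τ w' = 0 := hβ ((h.symm.trans h').trans β.source.symm)
        exact ⟨a1.trans a2.symm, Or.inl a1⟩
      · have a1 : τ w = 1 := hα (h'.trans α.target.symm)
        have a2 : τ w' = 1 := hβ ((h.symm.trans h').trans β.target.symm)
        exact ⟨a1.trans a2.symm, Or.inr a1⟩
    refine hτinj w w' ht.1 ?_
    have : w.1 1 = 0 := by
      have e := Circle1.mem_iff.1 w.2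
      have : (w.1 0) ^ 2 = 1 := by
        rcases ht.2 with h | h
        · have := congrArg Subtype.val h
          simp only [τ, Icc.coe_zero] at this
          have : w.1 0 = -1 := by linarith
          rw [this]; norm_num
        · have := congrArg Subtype.val h
          simp only [τ, Icc.coe_one] at this
          have : w.1 0 = 1 := by linarith
          rw [this]; norm_num
      nlinarith
    rw [this, zero_mul]
  have hinj : Function.Injective Φ := by
    intro w w' h
    rcases le_total 0 (w.1 1) with hw | hw <;> rcases le_total 0 (w'.1 1) with hw' | hw'
    · exact hτinj w w' (hα (by rwa [hΦα w hw, hΦα w' hw'] at h)) (mul_nonneg hw hw')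
    · exact hmix w w' hw hw' h
    · exact (hmix w' w hw' hw h.symm).symm
    · exact hτinj w w' (hβ (by rwa [hΦβ w hw, hΦβ w' hw'] at h)) (mul_nonneg_of_nonpos_of_nonpos hw hw')
  set a := Circle1.half 1 (by norm_num)
  set b := Circle1.half (-1) (by norm_num)
  have hτa : ∀ t, τ (a t) = t := fun t => by ext; simp [τ, a, Circle1.half]
  have hτb : ∀ t, τ (b t) = t := fun t => by ext; simp [τ, b, Circle1.half]
  have hΦa : ∀ t, Φ (a t) = α t := fun t => by
    rw [hΦα, hτa]; simp [a, Circle1.half]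
  have hΦb : ∀ t, Φ (b t) = β t := fun t => by
    rw [hΦβ, hτb]; simp [b, Circle1.half]
  have hrange : range Φ = range α ∪ range β := by
    ext q
    constructor
    · rintro ⟨w, rfl⟩
      rcases le_total 0 (w.1 1) with hw | hw
      · exact Or.inl ⟨_, (hΦα w hw).symm⟩
      · exact Or.inr ⟨_, (hΦβ w hw).symm⟩
    · rintro (⟨t, rfl⟩ | ⟨t, rfl⟩)
      exacts [⟨_, hΦa t⟩, ⟨_, hΦb t⟩]
  have : CompactSpace Circle1 := isCompact_iff_compactSpace.1 (isCompact_sphere _ _)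
  have hemb : IsClosedEmbedding Φ := hΦ.isClosedEmbedding hinj
  rw [← hrange]
  refine ⟨⟨hemb.isEmbedding.toHomeomorph.symm⟩, ?_⟩
  rintro f hf hfr ⟨y, hy⟩
  have hfe : IsClosedEmbedding f := f.continuous.isClosedEmbedding hf
  set e : Circle1 ≃ₜ range f := hfe.isEmbedding.toHomeomorph
  have hmem : ∀ w, Φ w ∈ range f := fun w => by rw [hfr]; exact ⟨w, rfl⟩
  set h : C(Circle1, Circle1) := ⟨fun w => e.symm ⟨Φ w, hmem w⟩,
    e.symm.continuous.comp (hΦ.subtype_mk hmem)⟩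
  have hfh : ∀ w, f (h w) = Φ w := fun w => by
    have := congrArg Subtype.val (e.apply_symm_apply ⟨Φ w, hmem w⟩)
    exact this
  have ha0 : a 0 = b 0 := hinj (by rw [hΦa, hΦb]; simp)
  have ha1 : a 1 = b 1 := hinj (by rw [hΦa, hΦb]; simp)
  set pa : Path (a 0) (a 1) := ⟨a, rfl, rfl⟩
  set pb : Path (a 0) (a 1) := ⟨b, ha0.symm, ha1.symm⟩
  have key := homotopic_map_of_homotopic_const hy (pa.map h.continuous) (pb.map h.continuous)
  have c0 : u = f (h (a 0)) := by rw [hfh, hΦa]; simp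
  have c1 : v = f (h (a 1)) := by rw [hfh, hΦa]; simp
  have key2 := key.pathCast c0 c1
  apply hn
  convert key2 using 1
  · ext t
    exact ((hfh (a t)).trans (hΦa t)).symm
  · ext t
    exact ((hfh (b t)).trans (hΦb t)).symm

theorem IsLengthSpace.exists_path {X : Type*} [MetricSpace X] (h : IsLengthSpace X) {a b : X} {ρ : ℝ}
    (hab : dist a b < ρ) : ∃ γ : Path a b, ∀ t, dist a (γ t) < ρ := by
  have h1 : (⨅ γ : Path a b, pathLength γ) < ENNReal.ofReal ρ := by
    rw [← h a b, edist_dist]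
    exact (ENNReal.ofReal_lt_ofReal_iff (dist_nonneg.trans_lt hab)).2 hab
  obtain ⟨γ, hγ⟩ := iInf_lt_iff.1 h1
  refine ⟨γ, fun t => ?_⟩
  have h2 : edist (γ 0) (γ t) ≤ pathLength γ := eVariationOn.edist_le _ (mem_univ _) (mem_univ _)
  rw [γ.source, edist_dist] at h2
  exact (ENNReal.ofReal_lt_ofReal_iff (dist_nonneg.trans_lt hab)).1 (h2.trans_lt hγ)

theorem IsLengthSpace.exists_isPreconnected {X : Type*} [MetricSpace X] (h : IsLengthSpace X) {a b : X} {ρ : ℝ}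
    (hab : dist a b < ρ) : ∃ S ⊆ ball a ρ, IsPreconnected S ∧ a ∈ S ∧ b ∈ S := by
  obtain ⟨γ, hγ⟩ := h.exists_path hab
  refine ⟨range γ, ?_, isPreconnected_range γ.continuous, ⟨0, γ.source⟩, ⟨1, γ.target⟩⟩
  rintro _ ⟨t, rfl⟩
  rw [mem_ball, dist_comm]
  exact hγ t

/-- A short arc between boundary points on which the dual function is trivial but which changes the
sign of its root gives a short non-contractible Jordan curve in the double. -/
theorem IsMetricDouble.exists_isNonContractibleJordanCurve {X : Type*} [MetricSpace X] [CompactSpace X]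
    (hX : IsSurface X) (hl : IsLengthSpace X) {D : Type*} [MetricSpace D] {ip im : X → D}
    (h : IsMetricDouble X (surfaceBoundary X) D ip im) {F r : X → ℂ} (hF : Continuous F)
    (hF0 : ∀ q, F q ≠ 0) (hr : ContinuousOn r (surfaceBoundary X))
    (hrF : ∀ q ∈ surfaceBoundary X, r q ^ 2 = F q) {u v : X} (hu : u ∈ surfaceBoundary X)
    (hv : v ∈ surfaceBoundary X) {ρ : ℝ} (huv : dist u v < ρ) (hF1 : ∀ q, dist u q < ρ → F q = 1)
    (hru : r u = 1) (hrv : r v = -1) :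
    ∃ J : Set D, IsNonContractibleJordanCurve J ∧ diam J ≤ 2 * ρ := by
  have hBc : IsClosed (surfaceBoundary X) := isClosed_surfaceBoundary
  have := hX.locallyPathConnectedSpace
  obtain ⟨S₀, hS₀, hS₀c, hu₀, hv₀⟩ := hl.exists_isPreconnected huv
  obtain ⟨S, hS, hSa⟩ := hX.exists_arc (isOpen_ball.connectedComponentIn (F := ball u ρ) (x := u))
    isPreconnected_connectedComponentIn (mem_connectedComponentIn (hS₀ hu₀))
    (hS₀c.subset_connectedComponentIn hu₀ hS₀ hv₀)
  replace hS := hS.trans (connectedComponentIn_subset _ _)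
  have hcl : ∀ c : ℂ, IsClosed (surfaceBoundary X ∩ r ⁻¹' {c}) := fun c =>
    hr.preimage_isClosed_of_isClosed hBc isClosed_singleton
  obtain ⟨p', S₁, S₂, hS₁, -, hS12, -, hp'⟩ := hSa.exists_first (hcl (-1)) ⟨v, hSa.right_mem, hv, hrv⟩
  have hp'm : p' ∈ surfaceBoundary X ∩ r ⁻¹' {-1} := (hp'.ge rfl).2
  obtain ⟨p, S₃, S₄, hS₃, -, hS34, -, hp⟩ := hS₁.symm.exists_first (hcl 1) ⟨u, hS₁.left_mem, hu, hru⟩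
  have hpm : p ∈ surfaceBoundary X ∩ r ⁻¹' {1} := (hp.ge rfl).2
  have h31 : S₃ ⊆ S₁ := hS34 ▸ subset_union_left
  have h3S : S₃ ⊆ ball u ρ := h31.trans ((hS12 ▸ subset_union_left).trans hS)
  have hF3 : ∀ q ∈ S₃, F q = 1 := fun q hq => hF1 q (by rw [dist_comm]; exact h3S hq)
  have hB3 : ∀ q ∈ S₃, q ∈ surfaceBoundary X → q = p ∨ q = p' := by
    intro q hq hqB
    have hsq := hrF q hqB
    rw [hF3 q hq] at hsq
    rcases mul_self_eq_one_iff.1 ((sq _).symm.trans hsq) with h1 | h1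
    · exact Or.inl (hp.le ⟨hq, hqB, h1⟩)
    · exact Or.inr (hp'.le ⟨h31 hq, hqB, h1⟩)
  have hne : p ≠ p' := fun h1 => by
    have e1 : r p = 1 := hpm.2
    have e2 : r p' = -1 := hp'm.2
    rw [← h1, e1] at e2
    norm_num at e2
  obtain ⟨γ, hγ, hγr⟩ := hS₃.symm.exists_path hne
  have hγm : ∀ t, γ t ∈ S₃ := fun t => hγr ▸ mem_range_self t
  set α : Path (ip p) (ip p') := γ.map h.isom_p.continuous
  set β : Path (ip p) (ip p') := (γ.map h.isom_m.continuous).cast (h.agree p hpm.1) (h.agree p' hp'm.1)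
  have hα : ∀ t, α t = ip (γ t) := fun t => rfl
  have hβ : ∀ t, β t = im (γ t) := fun t => rfl
  have hBne : (surfaceBoundary X).Nonempty := ⟨u, hu⟩
  refine ⟨_, isNonContractibleJordanCurve_of_not_homotopic (α := α) (β := β) ?_ ?_ ?_ ?_, ?_⟩
  · exact h.isom_p.injective.comp hγ
  · exact h.isom_m.injective.comp hγ
  · rintro _ ⟨⟨s, rfl⟩, t, ht⟩
    rw [hα, hβ] at ht
    obtain ⟨h1, h2⟩ := h.eq_of_ip_eq_im hBne hBc ht.symm
    rw [hα]
    rcases hB3 _ (hγm s) h2 with h3 | h3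
    · exact Or.inl (by rw [h3])
    · exact Or.inr (by rw [h3]; rfl)
  · rintro ⟨H⟩
    refine h.not_homotopic hBc hF hF0 hr hrF hpm.1 hp'm.1 γ (fun t => hF3 _ (hγm t)) hpm.2 hp'm.2 H
      H.continuous (fun t => ?_) (fun t => ?_) (fun s => ?_) fun s => ?_
    · exact H.apply_zero t
    · exact H.apply_one t
    · exact H.source s
    · exact H.target s
  · have hd : ∀ q ∈ S₃, dist q u < ρ := fun q hq => h3S hq
    have hmix : ∀ s t, dist (ip (γ s)) (im (γ t)) ≤ 2 * ρ := by
      intro s t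
      rw [h.dist_mix]
      refine (ciInf_le ⟨0, ?_⟩ (⟨u, hu⟩ : surfaceBoundary X)).trans ?_
      · rintro _ ⟨z, rfl⟩
        positivity
      · have h1 := hd _ (hγm s)
        have h2 := hd _ (hγm t)
        rw [dist_comm] at h2
        show dist (γ s) u + dist u (γ t) ≤ _
        linarith
    have hsame : ∀ s t, dist (γ s) (γ t) ≤ 2 * ρ := by
      intro s t
      have h1 := hd _ (hγm s)
      have h2 := hd _ (hγm t)
      have := dist_triangle_right (γ s) (γ t) u
      linarith
    refine diam_le_of_forall_dist_le (by linarith [dist_nonneg.trans_lt huv]) ?_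
    rintro _ (⟨s, rfl⟩ | ⟨s, rfl⟩) _ (⟨t, rfl⟩ | ⟨t, rfl⟩)
    · rw [hα, hα, h.isom_p.dist_eq]; exact hsame s t
    · exact hmix s t
    · rw [dist_comm]; exact hmix t s
    · rw [hβ, hβ, h.isom_m.dist_eq]; exact hsame s t

theorem RegularDoubleSeq.exists_le_diam {D : ℕ → Type} [∀ n, MetricSpace (D n)] (h : RegularDoubleSeq D)
    (hJ : ∀ n, ∃ J : Set (D n), IsNonContractibleJordanCurve J) :
    ∃ δ > 0, ∀ᶠ n in atTop, ∀ J : Set (D n), IsNonContractibleJordanCurve J → δ ≤ diam J := by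
  have hs : ∀ n, ∃ J : Set (D n), IsNonContractibleJordanCurve J ∧
      ∀ J' : Set (D n), IsNonContractibleJordanCurve J' → diam J < diam J' + 1 / (n + 1) := by
    intro n
    set A : Set ℝ := {d | ∃ J : Set (D n), IsNonContractibleJordanCurve J ∧ diam J = d}
    have hA : A.Nonempty := let ⟨J, hJ⟩ := hJ n; ⟨_, J, hJ, rfl⟩
    have hb : BddBelow A := ⟨0, by rintro _ ⟨J, -, rfl⟩; exact diam_nonneg⟩
    obtain ⟨_, ⟨J, hJ, rfl⟩, hlt⟩ := exists_lt_of_csInf_lt hA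
      (lt_add_of_pos_right (sInf A) (Nat.one_div_pos_of_nat (α := ℝ) (n := n)))
    exact ⟨J, hJ, fun J' hJ' => hlt.trans_le (by gcongr; exact csInf_le hb ⟨J', hJ', rfl⟩)⟩
  choose J hJ hJm using hs
  have hpos := h J hJ
  set δ := ⨅ n, diam (J n)
  refine ⟨δ / 2, half_pos hpos, ?_⟩
  filter_upwards [(tendsto_one_div_add_atTop_nhds_zero_nat (𝕜 := ℝ)).eventually_lt_const (half_pos hpos)] with n hn J' hJ'
  have h1 := hJm n J' hJ'
  have h2 : δ ≤ diam (J n) := ciInf_le ⟨0, by rintro _ ⟨n, rfl⟩; exact diam_nonneg⟩ n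
  linarith

theorem continuousOn_of_eq_on_components {X Y : Type*} [TopologicalSpace X] [T2Space X] (hX : IsSurface X) [TopologicalSpace Y]
    {r : X → Y} (hr : ∀ p ∈ surfaceBoundary X, ∀ q ∈ connectedComponentIn (surfaceBoundary X) p, r q = r p) :
    ContinuousOn r (surfaceBoundary X) := by
  intro p hp
  refine (continuousWithinAt_const (b := r p)).congr_of_eventuallyEq ?_ rfl
  filter_upwards [mem_nhdsWithin_connectedComponentIn_surfaceBoundary hX (mem_connectedComponentIn hp)]
    with q hq using hr p hp q hq

/-- The double of a surface along at least two boundary components contains a non-contractible Jordan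
curve. -/
theorem IsMetricDouble.exists_isNonContractibleJordanCurve_of_two_le_ncard {X : Type*} [MetricSpace X] [CompactSpace X]
    (hX : IsSurface X) (hl : IsLengthSpace X) {D : Type*} [MetricSpace D] {ip im : X → D}
    (h : IsMetricDouble X (surfaceBoundary X) D ip im) (hq : 2 ≤ (surfaceBoundaryComponents X).ncard) :
    ∃ J : Set D, IsNonContractibleJordanCurve J := by
  obtain ⟨_, ⟨u, hu, rfl⟩, _, ⟨v, hv, rfl⟩, hne⟩ :=
    (one_lt_ncard (finite_of_ncard_pos (by omega))).1 (by omega : 1 < (surfaceBoundaryComponents X).ncard)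
  classical
  set b := connectedComponentIn (surfaceBoundary X) u
  set r : X → ℂ := fun q => if q ∈ b then 1 else -1
  have hrc : ContinuousOn r (surfaceBoundary X) := by
    refine continuousOn_of_eq_on_components hX fun p hp q hq => ?_
    have : q ∈ b ↔ p ∈ b := by
      have e1 := connectedComponentIn_eq hq
      constructor
      · intro h
        rw [show b = _ from connectedComponentIn_eq h, ← e1]
        exact mem_connectedComponentIn hp
      · intro h
        rw [show b = _ from connectedComponentIn_eq h]
        exact hq
    simp only [r, this]
  have hr2 : ∀ q ∈ surfaceBoundary X, r q ^ 2 = 1 := by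
    intro q _
    by_cases hq : q ∈ b <;> simp [r, hq]
  obtain ⟨J, hJ, -⟩ := h.exists_isNonContractibleJordanCurve hX hl (F := fun _ => 1) (r := r)
    continuous_const (by simp) hrc hr2 hu hv (ρ := dist u v + 1) (by linarith) (by simp)
    (if_pos (mem_connectedComponentIn hu)) (if_neg fun hv' => hne (connectedComponentIn_eq hv'))
  exact ⟨J, hJ⟩

/-- Paths with the same endpoints inside the homeomorphic image of a convex set are homotopic. -/
theorem Path.homotopic_of_convex_chart {X E : Type*} [TopologicalSpace X] [AddCommGroup E]
    [Module ℝ E] [TopologicalSpace E] [ContinuousAdd E] [ContinuousSMul ℝ E]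
    {s : Set E} (hs : Convex ℝ s) {ψ : E → X} {φ : X → E} (hψ : ContinuousOn ψ s)
    (hφ : ContinuousOn φ (ψ '' s)) (hφψ : ∀ z ∈ s, φ (ψ z) = z) {x y : X} (γ γ' : Path x y)
    (hγ : range γ ⊆ ψ '' s) (hγ' : range γ' ⊆ ψ '' s) : γ.Homotopic γ' := by
  have hmem : ∀ w ∈ ψ '' s, φ w ∈ s := by rintro _ ⟨z, hz, rfl⟩; rwa [hφψ z hz]
  have hψφ : ∀ w ∈ ψ '' s, ψ (φ w) = w := by rintro _ ⟨z, hz, rfl⟩; rw [hφψ z hz]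
  have h1 : ∀ u, γ u ∈ ψ '' s := fun u => hγ (mem_range_self u)
  have h2 : ∀ u, γ' u ∈ ψ '' s := fun u => hγ' (mem_range_self u)
  have c1 : Continuous fun u => φ (γ u) := hφ.comp_continuous γ.continuous h1
  have c2 : Continuous fun u => φ (γ' u) := hφ.comp_continuous γ'.continuous h2
  refine ⟨{ toFun := fun p => ψ ((1 - (p.1 : ℝ)) • φ (γ p.2) + (p.1 : ℝ) • φ (γ' p.2))
            continuous_toFun := ?_
            map_zero_left := ?_
            map_one_left := ?_
            prop' := ?_ }⟩
  · refine hψ.comp_continuous ?_ ?_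
    · exact ((continuous_const.sub (continuous_subtype_val.comp continuous_fst)).smul
        (c1.comp continuous_snd)).add
        ((continuous_subtype_val.comp continuous_fst).smul (c2.comp continuous_snd))
    · intro p
      exact hs (hmem _ (h1 _)) (hmem _ (h2 _)) (sub_nonneg.2 p.1.2.2) p.1.2.1 (by ring)
  · intro u
    simp [hψφ _ (h1 u)]
  · intro u
    simp [hψφ _ (h2 u)]
  · intro t u hu
    have hx := hψφ _ (h1 0)
    have hy := hψφ _ (h1 1)
    rw [γ.source] at hx
    rw [γ.target] at hy
    rcases hu with rfl | hu
    · simp [← add_smul, hx]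
    · rw [mem_singleton_iff] at hu
      subst hu
      simp [← add_smul, hy]

theorem IsArc.homotopic {X : Type*} [TopologicalSpace X] [T2Space X] {S : Set X} {u v : X}
    (hS : IsArc S u v) {x y : X} (γ γ' : Path x y) (hγ : range γ ⊆ S) (hγ' : range γ' ⊆ S) :
    γ.Homotopic γ' := by
  obtain ⟨a, b, g, hab, hg, hinj, -, -, rfl⟩ := hS
  refine Path.homotopic_of_convex_chart (convex_Icc a b) (φ := Function.invFunOn g (Icc a b)) hg ?_
    (fun z hz => hinj (Function.invFunOn_mem ⟨z, hz, rfl⟩) hz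
      (Function.invFunOn_eq ⟨z, hz, rfl⟩)) γ γ' hγ hγ'
  rw [continuousOn_iff_isClosed]
  intro t ht
  refine ⟨g '' (Icc a b ∩ t), ((isCompact_Icc.inter_right ht).image_of_continuousOn
    (hg.mono inter_subset_left)).isClosed, ?_⟩
  ext w
  constructor
  · rintro ⟨hw, z, hz, rfl⟩
    refine ⟨⟨z, ⟨hz, ?_⟩, rfl⟩, ⟨z, hz, rfl⟩⟩
    have := hinj (Function.invFunOn_mem ⟨z, hz, rfl⟩) hz (Function.invFunOn_eq ⟨z, hz, rfl⟩)
    rw [mem_preimage, this] at hw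
    exact hw
  · rintro ⟨⟨z, hz, rfl⟩, hw⟩
    have := hinj (Function.invFunOn_mem ⟨z, hz.1, rfl⟩) hz.1
      (Function.invFunOn_eq ⟨z, hz.1, rfl⟩)
    refine ⟨?_, hw⟩
    rw [mem_preimage, this]
    exact hz.2

theorem IsChart.homotopic {X : Type*} [TopologicalSpace X] {E : Type*} [NormedAddCommGroup E]
    [NormedSpace ℝ E] {S : Set E} {F : E → X} (h : IsChart S F) (hS : Convex ℝ S) {x y : X}
    (γ γ' : Path x y) (hγ : range γ ⊆ F '' S) (hγ' : range γ' ⊆ F '' S) : γ.Homotopic γ' :=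
  Path.homotopic_of_convex_chart hS h.cont h.continuousOn_inv (fun _ hz => h.inv_apply hz)
    γ γ' hγ hγ'

/-- Every point of a surface has arbitrarily small neighborhoods in which all paths with the same
endpoints are homotopic. -/
theorem IsSurface.exists_nhds_homotopic {X : Type*} [TopologicalSpace X] (hX : IsSurface X) (x : X)
    {N : Set X} (hN : N ∈ 𝓝 x) : ∃ U ∈ 𝓝 x, U ⊆ N ∧ IsPathConnected U ∧ ∀ (u v : X) (γ γ' : Path u v),
      range γ ⊆ U → range γ' ⊆ U → γ.Homotopic γ' := by
  obtain ⟨M, ψ, hM, hψ, hsub⟩ := hX.exists_disc x hN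
  have hc : Convex ℝ (M ∩ ball (0 : ℂ) 1) := hM.convex.inter (convex_ball _ _)
  refine ⟨_, hψ.mem_nhds hM.zero_mem, hsub, ?_, fun u v γ γ' h h' => hψ.chart.homotopic hc γ γ' h h'⟩
  exact (hc.isPathConnected ⟨0, hM.zero_mem, mem_ball_self one_pos⟩).image' hψ.chart.cont

/-- Induction principle for paths: a homotopy invariant property which holds for small paths and
is stable under concatenation holds for all paths. -/
theorem Path.induction_small {X : Type*} [TopologicalSpace X] (P : ∀ {x y : X}, Path x y → Prop)
    (hP : ∀ {x y : X} (γ γ' : Path x y), γ.Homotopic γ' → P γ → P γ')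
    (htrans : ∀ {x y z : X} (γ : Path x y) (γ' : Path y z), P γ → P γ' → P (γ.trans γ'))
    (hloc : ∀ x : X, ∃ U ∈ 𝓝 x, ∀ {u v : X} (γ : Path u v), range γ ⊆ U → P γ)
    {x y : X} (γ : Path x y) : P γ := by
  choose U hU hUP using hloc
  obtain ⟨t, ht0, hmono, ⟨n, hn⟩, ht⟩ :=
    exists_monotone_Icc_subset_open_cover_unitInterval (c := fun p : X => γ ⁻¹' interior (U p))
      (fun p => isOpen_interior.preimage γ.continuous)
      (fun s _ => mem_iUnion.2 ⟨γ s, mem_interior_iff_mem_nhds.2 (hU _)⟩)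
  have key : ∀ k, P (γ.subpath 0 (t k)) := by
    intro k
    induction k with
    | zero =>
      rw [ht0]
      refine hUP (γ 0) _ ?_
      rw [Path.range_subpath]
      rintro _ ⟨s, hs, rfl⟩
      have : s = 0 := by simpa using hs
      rw [this]
      exact mem_of_mem_nhds (hU _)
    | succ k ih =>
      refine hP _ _ ⟨Path.Homotopy.subpathTransSubpath γ 0 (t k) (t (k + 1))⟩ (htrans _ _ ih ?_)
      obtain ⟨p, hp⟩ := ht k
      refine hUP p _ ?_
      rw [Path.range_subpath_of_le _ _ _ (hmono (Nat.le_succ k))]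
      rintro _ ⟨s, hs, rfl⟩
      exact interior_subset (hp hs)
  have h1 := key n
  rw [hn n le_rfl] at h1
  rcases γ with ⟨f, h0, h1'⟩
  subst h0 h1'
  rw [Path.subpath_zero_one] at h1
  exact h1

theorem unitInterval.relation_of_local_of_gap {K : Set I} (hK : IsClosed K) (h0 : 0 ∈ K)
    (h1 : 1 ∈ K) {R : I → I → Prop}
    (htrans : ∀ r ∈ K, ∀ s ∈ K, ∀ t ∈ K, R r s → R s t → R r t)
    (hsymm : ∀ s ∈ K, ∀ t ∈ K, R s t → R t s)
    (hloc : ∀ s ∈ K, ∀ᶠ t in 𝓝[K] s, R s t)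
    (hgap : ∀ s ∈ K, ∀ t ∈ K, s < t → Ioo s t ∩ K = ∅ → R s t) : R 0 1 := by
  have hself : ∀ s ∈ K, R s s := fun s hs => (hloc s hs).self_of_nhdsWithin hs
  set A : Set I := {s | s ∈ K ∧ R 0 s} with hA
  have hA0 : (0 : I) ∈ A := ⟨h0, hself 0 h0⟩
  have hlub := isLUB_sSup A
  set s := sSup A with hs
  have hsc : s ∈ closure A := hlub.mem_closure ⟨0, hA0⟩
  have hsK : s ∈ K := hK.closure_subset_iff.2 (fun _ h => h.1) hsc
  have hRs : R 0 s := by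
    obtain ⟨O, hO, hOs⟩ := mem_nhdsWithin_iff_exists_mem_nhds_inter.1 (hloc s hsK)
    obtain ⟨t, htO, htA⟩ := mem_closure_iff_nhds.1 hsc O hO
    exact htrans 0 h0 t htA.1 s hsK htA.2 (hsymm s hsK t htA.1 (hOs ⟨htO, htA.1⟩))
  by_contra hcon
  have hs1 : s < 1 := by
    refine lt_of_le_of_ne s.2.2 ?_
    intro h
    have : s = 1 := Subtype.ext (by simpa using congrArg Subtype.val h)
    exact hcon (this ▸ hRs)
  have hglb := isGLB_sInf (K ∩ Ioi s)
  have hne : (K ∩ Ioi s).Nonempty := ⟨1, h1, hs1⟩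
  set t := sInf (K ∩ Ioi s) with ht
  have htc : t ∈ closure (K ∩ Ioi s) := hglb.mem_closure hne
  have htK : t ∈ K := hK.closure_subset_iff.2 inter_subset_left htc
  have hst : s ≤ t := hglb.2 fun r hr => hr.2.le
  have hmax : ∀ r ∈ K, s < r → ¬ R s r := fun r hr hsr h =>
    (hlub.1 (⟨hr, htrans 0 h0 s hsK r hr hRs h⟩ : r ∈ A)).not_gt hsr
  rcases hst.eq_or_lt with h | h
  · obtain ⟨O, hO, hOs⟩ := mem_nhdsWithin_iff_exists_mem_nhds_inter.1 (hloc s hsK)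
    rw [← h] at htc
    obtain ⟨r, hrO, hrK⟩ := mem_closure_iff_nhds.1 htc O hO
    exact hmax r hrK.1 hrK.2 (hOs ⟨hrO, hrK.1⟩)
  · refine hmax t htK h (hgap s hsK t htK h ?_)
    rw [eq_empty_iff_forall_notMem]
    rintro r ⟨hr, hrK⟩
    exact (hglb.1 ⟨hrK, hr.1⟩).not_gt hr.2

theorem unitInterval.exists_ordConnected_subset {s : I} {N : Set I} (hN : N ∈ 𝓝 s) :
    ∃ V ∈ 𝓝 s, V ⊆ N ∧ OrdConnected V := by
  obtain ⟨ε, hε, hs⟩ := Metric.mem_nhds_iff.1 hN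
  refine ⟨ball s ε, ball_mem_nhds s hε, hs, ⟨fun a ha b hb c hc => ?_⟩⟩
  rw [mem_ball, Subtype.dist_eq, Real.dist_eq, abs_lt] at *
  have h1 : (a : ℝ) ≤ c := hc.1
  have h2 : (c : ℝ) ≤ b := hc.2
  constructor <;> linarith

theorem Path.subpath_injective {X : Type*} [TopologicalSpace X] {u v : X} {γ : Path u v}
    (hγ : Function.Injective γ) {s t : I} (hst : s ≠ t) :
    Function.Injective (γ.subpath s t) := by
  intro a b hab
  have h1 := congrArg Subtype.val (hγ hab)
  rw [Icc.coe_convexComb, Icc.coe_convexComb] at h1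
  have h2 : (t : ℝ) - s ≠ 0 := sub_ne_zero.2 fun h => hst (Subtype.ext h.symm)
  apply Subtype.ext
  apply mul_right_cancel₀ h2
  linarith

theorem IsArc.exists_path_subset {X : Type*} [TopologicalSpace X] {S : Set X} {u v : X}
    (h : IsArc S u v) : ∃ δ : Path u v, range δ ⊆ S := by
  obtain ⟨a, b, γ, hab, hγ, -, rfl, rfl, rfl⟩ := h
  have hp : IsPathConnected (γ '' Icc a b) := ((convex_Icc a b).isPathConnected (nonempty_Icc.2 hab)).image' hγ
  obtain ⟨δ, hδ⟩ := hp.joinedIn _ ⟨a, left_mem_Icc.2 hab, rfl⟩ _ ⟨b, right_mem_Icc.2 hab, rfl⟩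
  exact ⟨δ, range_subset_iff.2 hδ⟩

section

variable {X : Type*} [TopologicalSpace X] [T2Space X]

/-- In a surface without non-contractible Jordan curves, injective paths with the same endpoints
are homotopic. -/
theorem IsSurface.homotopic_of_injective (hX : IsSurface X)
    (hJ : ∀ J : Set X, ¬ IsNonContractibleJordanCurve J) {u v : X} {α β : Path u v}
    (hα : Function.Injective α) (hβ : Function.Injective β) : α.Homotopic β := by
  have huv : u ≠ v := fun h => zero_ne_one (α := I) (hα (by rw [α.source, α.target, h]))
  have hSβ : IsArc (range β) u v := IsArc.of_path hβ
  have hcl : IsClosed (range β) := (isCompact_range β.continuous).isClosed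
  have hsmall : ∀ s' t', range (β.subpath s' t') ⊆ range β := fun s' t' => by
    rw [Path.range_subpath]; exact image_subset_range _ _
  have hjoin : ∀ w ∈ range β, ∀ w' ∈ range β, ∃ δ : Path w w', range δ ⊆ range β := by
    rintro _ ⟨s', rfl⟩ _ ⟨t', rfl⟩
    exact ⟨β.subpath s' t', hsmall _ _⟩
  have key := unitInterval.relation_of_local_of_gap (K := α ⁻¹' range β)
    (hcl.preimage α.continuous) (by simp [α.source])
    (by simp [α.target])
    (R := fun s t => ∀ δ : Path (α s) (α t), range δ ⊆ range β → (α.subpath s t).Homotopic δ)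
    ?_ ?_ ?_ ?_
  · have h2 := key (β.cast α.source α.target) (by rfl)
    rw [Path.subpath_zero_one] at h2
    exact h2
  · intro r hr s hs t ht h1 h2 δ hδ
    obtain ⟨δ₁, hδ₁⟩ := hjoin _ hr _ hs
    obtain ⟨δ₂, hδ₂⟩ := hjoin _ hs _ ht
    have h3 : (α.subpath r t).Homotopic ((α.subpath r s).trans (α.subpath s t)) :=
      ⟨(Path.Homotopy.subpathTransSubpath α r s t).symm⟩
    refine h3.trans (((h1 δ₁ hδ₁).hcomp (h2 δ₂ hδ₂)).trans ?_)
    refine hSβ.homotopic _ _ ?_ hδ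
    rw [Path.trans_range]
    exact union_subset hδ₁ hδ₂
  · intro s hs t ht h δ hδ
    have := h δ.symm (by rwa [Path.symm_range])
    have h2 := Path.Homotopic.symm₂ this
    rwa [Path.symm_symm, Path.symm_subpath] at h2
  · intro s hs
    obtain ⟨s', hs'⟩ := hs
    obtain ⟨U, hU, -, -, hhom⟩ := hX.exists_nhds_homotopic (α s) (univ_mem (f := 𝓝 (α s)))
    have hV : β ⁻¹' U ∈ 𝓝 s' := β.continuous.continuousAt.preimage_mem_nhds (by rwa [hs'])
    obtain ⟨V, hVn, hVU, hVo⟩ : ∃ V ∈ 𝓝 s', V ⊆ β ⁻¹' U ∧ OrdConnected V :=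
      unitInterval.exists_ordConnected_subset hV
    obtain ⟨T, hTn, hTU, hTo⟩ : ∃ V ∈ 𝓝 s, V ⊆ α ⁻¹' U ∧ OrdConnected V :=
      unitInterval.exists_ordConnected_subset (α.continuous.continuousAt.preimage_mem_nhds hU)
    have hemb : IsClosedEmbedding β := β.continuous.isClosedEmbedding hβ
    have hW : ∀ᶠ w in 𝓝 (α s), ∀ t', β t' = w → t' ∈ V := by
      have h3 : V ∈ comap β (𝓝 (β s')) := by rwa [← hemb.isEmbedding.isInducing.nhds_eq_comap]
      rw [hs'] at h3
      obtain ⟨W, hW, hWV⟩ := h3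
      filter_upwards [hW] with w hw t' ht'
      exact hWV (by rwa [mem_preimage, ht'])
    filter_upwards [self_mem_nhdsWithin, mem_nhdsWithin_of_mem_nhds hTn,
      mem_nhdsWithin_of_mem_nhds (α.continuous.continuousAt.eventually hW)] with t ht htT htW
    intro δ hδ
    obtain ⟨t', ht'⟩ := ht
    have ht'V := htW t' ht'
    have h1 : (α.subpath s t).Homotopic ((β.subpath s' t').cast hs'.symm ht'.symm) := by
      refine hhom _ _ _ _ ?_ ?_
      · rw [Path.range_subpath]
        exact image_subset_iff.2 ((hTo.uIcc_subset (mem_of_mem_nhds hTn) htT).trans hTU)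
      · change range (β.subpath s' t') ⊆ U
        rw [Path.range_subpath]
        exact image_subset_iff.2 ((hVo.uIcc_subset (mem_of_mem_nhds hVn) ht'V).trans hVU)
    exact h1.trans (hSβ.homotopic _ _ (hsmall s' t') hδ)
  · intro s hs t ht hst hgap δ hδ
    obtain ⟨s', hs'⟩ := hs
    obtain ⟨t', ht'⟩ := ht
    have hne : s' ≠ t' := by
      rintro rfl
      exact hst.ne (hα (hs'.symm.trans ht'))
    set β' : Path (α s) (α t) := (β.subpath s' t').cast hs'.symm ht'.symm with hβ'
    have hβ'r : range β' ⊆ range β := hsmall s' t'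
    refine Path.Homotopic.trans ?_ (hSβ.homotopic β' δ hβ'r hδ)
    by_contra hn
    refine hJ _ (isNonContractibleJordanCurve_of_not_homotopic
      (Path.subpath_injective hα hst.ne) (Path.subpath_injective hβ hne : Function.Injective β')
      ?_ hn)
    rintro w ⟨hw, hw'⟩
    rw [Path.range_subpath_of_le _ _ _ hst.le] at hw
    obtain ⟨r, hr, rfl⟩ := hw
    rcases eq_or_ne r s with rfl | hrs
    · exact Or.inl rfl
    rcases eq_or_ne r t with rfl | hrt
    · exact Or.inr rfl
    have hmem : r ∈ Ioo s t ∩ α ⁻¹' range β :=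
      ⟨⟨lt_of_le_of_ne hr.1 hrs.symm, lt_of_le_of_ne hr.2 hrt⟩, hβ'r hw'⟩
    rw [hgap] at hmem
    exact hmem.elim

theorem IsSurface.homotopic_of_isArc (hX : IsSurface X)
    (hJ : ∀ J : Set X, ¬ IsNonContractibleJordanCurve J) {u v : X} {S S' : Set X}
    (hS : IsArc S u v) (hS' : IsArc S' u v) {δ δ' : Path u v} (hδ : range δ ⊆ S)
    (hδ' : range δ' ⊆ S') : δ.Homotopic δ' := by
  rcases eq_or_ne u v with rfl | huv
  · rw [hS'.eq_singleton, ← hS.eq_singleton] at hδ'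
    exact hS.homotopic _ _ hδ hδ'
  · obtain ⟨α, hα, rfl⟩ := hS.exists_path huv
    obtain ⟨β, hβ, rfl⟩ := hS'.exists_path huv
    exact (hS.homotopic _ _ hδ le_rfl).trans
      ((hX.homotopic_of_injective hJ hα hβ).trans (hS'.homotopic _ _ le_rfl hδ'))

theorem IsSurface.exists_isArc_homotopic (hX : IsSurface X)
    (hJ : ∀ J : Set X, ¬ IsNonContractibleJordanCurve J) {u v : X} (γ : Path u v) :
    ∃ (S : Set X) (δ : Path u v), IsArc S u v ∧ range δ ⊆ S ∧ γ.Homotopic δ := by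
  have : LocallyPathConnectedSpace X := hX.locallyPathConnectedSpace
  refine Path.induction_small (fun {u v} γ => ∃ (S : Set X) (δ : Path u v), IsArc S u v ∧
    range δ ⊆ S ∧ γ.Homotopic δ) ?_ ?_ ?_ γ
  · rintro x y γ γ' h ⟨S, δ, hS, hδ, h'⟩
    exact ⟨S, δ, hS, hδ, h.symm.trans h'⟩
  · rintro x y z γ γ' ⟨S, δ, hS, hδ, h⟩ ⟨S', δ', hS', hδ', h'⟩
    obtain ⟨p, S₁, S₂, hS₁, hS₂, hu, -, h₁⟩ := hS.exists_first hS'.isCompact.isClosed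
      ⟨y, hS.right_mem, hS'.left_mem⟩
    have hp : p ∈ S' := (h₁.symm ▸ mem_singleton p : p ∈ S₁ ∩ S').2
    obtain ⟨T₁, T₂, hT₁, hT₂, hT, -⟩ := hS'.split hp
    obtain ⟨d₁, hd₁⟩ := hS₁.exists_path_subset
    obtain ⟨d₂, hd₂⟩ := hS₂.exists_path_subset
    obtain ⟨e₁, he₁⟩ := hT₁.exists_path_subset
    obtain ⟨e₂, he₂⟩ := hT₂.exists_path_subset
    have hcat : IsArc (S₁ ∪ T₂) x z := hS₁.concat hT₂ (fun w hw => by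
      rw [← h₁]
      exact ⟨hw.1, hT ▸ Or.inr hw.2⟩)
    refine ⟨_, d₁.trans e₂, hcat, ?_, ?_⟩
    · rw [Path.trans_range]
      exact union_subset_union hd₁ he₂
    · have h2 : δ.Homotopic (d₁.trans d₂) := hS.homotopic _ _ hδ (by
        rw [Path.trans_range, ← hu]; exact union_subset_union hd₁ hd₂)
      have h3 : δ'.Homotopic (e₁.trans e₂) := hS'.homotopic _ _ hδ' (by
        rw [Path.trans_range, ← hT]; exact union_subset_union he₁ he₂)
      have h4 : d₂.Homotopic e₁.symm := hX.homotopic_of_isArc hJ hS₂ hT₁.symm hd₂ (by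
        rwa [Path.symm_range])
      have h5 := h.trans h2
      have h6 := h'.trans h3
      rw [← Path.Homotopic.Quotient.eq] at *
      simp only [Path.Homotopic.Quotient.mk_trans, Path.Homotopic.Quotient.mk_symm] at *
      rw [h5, h6, h4, Path.Homotopic.Quotient.trans_assoc,
        ← Path.Homotopic.Quotient.trans_assoc _ _ (Path.Homotopic.Quotient.mk e₂),
        Path.Homotopic.Quotient.symm_trans, Path.Homotopic.Quotient.refl_trans]
  · intro x
    obtain ⟨N, hN, -, -, hhom⟩ := hX.exists_nhds_homotopic x (univ_mem (f := 𝓝 x))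
    have hO : IsOpen (connectedComponentIn (interior N) x) := isOpen_interior.connectedComponentIn
    have hsub : connectedComponentIn (interior N) x ⊆ N :=
      (connectedComponentIn_subset _ _).trans interior_subset
    refine ⟨_, hO.mem_nhds (mem_connectedComponentIn (mem_interior_iff_mem_nhds.2 hN)), ?_⟩
    intro u v γ hγ
    obtain ⟨S, hSO, hS⟩ := hX.exists_arc hO isPreconnected_connectedComponentIn
      (hγ ⟨0, γ.source⟩) (hγ ⟨1, γ.target⟩)
    obtain ⟨δ, hδ⟩ := hS.exists_path_subset
    exact ⟨S, δ, hS, hδ, hhom _ _ _ _ (hγ.trans hsub) ((hδ.trans hSO).trans hsub)⟩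

/-- A surface of positive first Betti number contains a non-contractible Jordan curve. -/
theorem IsSurface.exists_isNonContractibleJordanCurve (hX : IsSurface X) (h : 1 ≤ h1Rank X) :
    ∃ J : Set X, IsNonContractibleJordanCurve J := by
  by_contra! hJ
  have hnull : ∀ (x : X) (γ : Path x x), γ.Homotopic (Path.refl x) := by
    intro x γ
    obtain ⟨S, δ, hS, hδ, hh⟩ := hX.exists_isArc_homotopic hJ γ
    have : δ = Path.refl x := by
      ext t
      have := hδ (mem_range_self t)
      rw [hS.eq_singleton] at this
      exact this
    rwa [this] at hh
  have hz : h1Rank X = 0 := by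
    unfold h1Rank
    have : ∀ x : X,
        (Module.rank ℤ (Additive (Abelianization (FundamentalGroup X x)))).toNat = 0 := by
      intro x
      have hs : Subsingleton (FundamentalGroup X x) := by
        refine ⟨fun p q => ?_⟩
        induction p using Path.Homotopic.Quotient.ind with | mk γ
        induction q using Path.Homotopic.Quotient.ind with | mk γ'
        exact Path.Homotopic.Quotient.eq.2 ((hnull x γ).trans (hnull x γ').symm)
      have hs2 : Subsingleton (Abelianization (FundamentalGroup X x)) :=
        (QuotientGroup.mk_surjective (s := commutator (FundamentalGroup X x))).subsingleton
      have hs3 : Subsingleton (Additive (Abelianization (FundamentalGroup X x))) := hs2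
      rw [rank_subsingleton']
      simp
    simp only [this]
    rcases isEmpty_or_nonempty X with hE | hE
    · simp
    · exact ciSup_const
  omega

end

theorem IsMetricDouble.isNonContractibleJordanCurve_image {X D : Type*} [MetricSpace X]
    [MetricSpace D] {B : Set X} {ip im : X → D} (h : IsMetricDouble X B D ip im)
    (hB : B.Nonempty) (hBc : IsClosed B) {J : Set X} (hJ : IsNonContractibleJordanCurve J) :
    IsNonContractibleJordanCurve (ip '' J) := by
  obtain ⟨π, hπ, hπp, -⟩ := h.exists_fold hB hBc
  refine ⟨hJ.1.map fun f => (h.isom_p.isEmbedding.homeomorphImage J).symm.trans f, ?_⟩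
  rintro f hf hr ⟨y, H⟩
  have hfJ : ∀ w, ∃ a ∈ J, ip a = f w := fun w => by
    have := mem_range_self (f := f) w
    rwa [hr] at this
  refine hJ.2 ((⟨π, hπ⟩ : C(D, X)).comp f) ?_ ?_ ⟨π y, ?_⟩
  · intro w w' hw
    obtain ⟨a, -, ha⟩ := hfJ w
    obtain ⟨a', -, ha'⟩ := hfJ w'
    have h1 : π (f w) = π (f w') := hw
    rw [← ha, ← ha', hπp, hπp] at h1
    exact hf (by rw [← ha, ← ha', h1])
  · ext a
    constructor
    · rintro ⟨w, rfl⟩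
      obtain ⟨a, haJ, ha⟩ := hfJ w
      change π (f w) ∈ J
      rwa [← ha, hπp]
    · intro ha
      obtain ⟨w, hw⟩ : ip a ∈ range f := hr ▸ mem_image_of_mem ip ha
      exact ⟨w, show π (f w) = a by rw [hw, hπp]⟩
  · exact (ContinuousMap.Homotopic.refl (⟨π, hπ⟩ : C(D, X))).comp H

section

variable {X : Type*} [TopologicalSpace X]

theorem Path.exists_log {x y : X} {F : X → ℂ} (γ : Path x y) (hF : ContinuousOn F (range γ))
    (hF0 : ∀ q ∈ range γ, F q ≠ 0) :
    ∃ k : I → ℂ, Continuous k ∧ ∀ t, Complex.exp (k t) = F (γ t) := by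
  have hm : ∀ t, γ.extend t ∈ range γ := fun t => by
    rw [← γ.extend_range]; exact mem_range_self t
  obtain ⟨k, hk, he⟩ := exists_log_of_simplyConnected (A := ℝ) (f := fun t => F (γ.extend t))
    (hF.comp_continuous γ.continuous_extend hm) (fun t => hF0 _ (hm t))
  exact ⟨fun t => k t, hk.comp continuous_subtype_val, fun t => by rw [he, Path.extend_apply γ t.2]⟩

theorem sub_eq_sub_of_exp_eq_exp {k k' : I → ℂ} (hk : Continuous k) (hk' : Continuous k')
    (h : ∀ t, Complex.exp (k t) = Complex.exp (k' t)) : k 1 - k 0 = k' 1 - k' 0 := by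
  have := eq_of_exp_eq_const (isPreconnected_univ (α := I)) (k := fun t => k t - k' t) (c := 1)
    (hk.sub hk').continuousOn (fun t _ => by rw [Complex.exp_sub, h, div_self (Complex.exp_ne_zero _)])
    (mem_univ 0) (mem_univ 1)
  linear_combination -this

/-- The change of the logarithm of a non-vanishing function along homotopy classes of paths. -/
theorem exists_log_change {F : X → ℂ} (hF : Continuous F) (hF0 : ∀ q, F q ≠ 0) :
    ∃ ω : ∀ {x y : X}, Path.Homotopic.Quotient x y → ℂ,
      (∀ {x y z : X} (p : Path.Homotopic.Quotient x y) (q : Path.Homotopic.Quotient y z),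
        ω (p.trans q) = ω p + ω q) ∧
      ∀ {x y : X} (γ : Path x y) (k : I → ℂ), Continuous k →
        (∀ t, Complex.exp (k t) = F (γ t)) → ω (Path.Homotopic.Quotient.mk γ) = k 1 - k 0 := by
  choose κ hκ hκe using fun {x y : X} (γ : Path x y) =>
    γ.exists_log hF.continuousOn (fun q _ => hF0 q)
  have hinv : ∀ {x y : X} (γ γ' : Path x y), γ.Homotopic γ' →
      κ γ 1 - κ γ 0 = κ γ' 1 - κ γ' 0 := by
    rintro x y γ γ' ⟨H⟩
    obtain ⟨K, hK, hKe⟩ := exists_log_of_simplyConnected (A := ℝ × ℝ)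
      (f := fun p => F (H (projIcc 0 1 zero_le_one p.1, projIcc 0 1 zero_le_one p.2)))
      (hF.comp (H.continuous.comp (by fun_prop))) (fun _ => hF0 _)
    have hKI : ∀ s t : I, Complex.exp (K (s, t)) = F (H (s, t)) := fun s t => by
      rw [hKe]; simp
    have h0 := sub_eq_sub_of_exp_eq_exp (hκ γ) (k' := fun t : I => K ((0 : I), t))
      (by fun_prop) (fun t => by rw [hKI, hκe]; simp)
    have h1 := sub_eq_sub_of_exp_eq_exp (hκ γ') (k' := fun t : I => K ((1 : I), t))
      (by fun_prop) (fun t => by rw [hKI, hκe]; simp)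
    have e0 := eq_of_exp_eq_const (isPreconnected_univ (α := I)) (k := fun s : I => K (s, (0 : I)))
      (c := F x) (by fun_prop) (fun s _ => by rw [hKI, Path.Homotopy.source])
      (mem_univ 0) (mem_univ 1)
    have e1 := eq_of_exp_eq_const (isPreconnected_univ (α := I)) (k := fun s : I => K (s, (1 : I)))
      (c := F y) (by fun_prop) (fun s _ => by rw [hKI, Path.Homotopy.target])
      (mem_univ 0) (mem_univ 1)
    linear_combination h0 - h1 + e1 - e0
  refine ⟨fun {x y} p => Quotient.lift (fun γ : Path x y => κ γ 1 - κ γ 0) (fun _ _ h => hinv _ _ h) p,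
    ?_, ?_⟩
  · intro x y z p q
    induction p using Path.Homotopic.Quotient.ind with | mk γ
    induction q using Path.Homotopic.Quotient.ind with | mk γ'
    change κ (γ.trans γ') 1 - κ (γ.trans γ') 0 = (κ γ 1 - κ γ 0) + (κ γ' 1 - κ γ' 0)
    set k := κ (γ.trans γ') with hk
    have hkc : Continuous k := hκ _
    set k₁ : I → ℂ := fun t => k ⟨t / 2, by constructor <;> linarith [t.2.1, t.2.2]⟩ with hk₁
    set k₂ : I → ℂ := fun t => k ⟨(1 + t) / 2, by constructor <;> linarith [t.2.1, t.2.2]⟩ with hk₂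
    have h1 := sub_eq_sub_of_exp_eq_exp (hκ γ) (k' := k₁) (by fun_prop) (fun t => by
      have ht : (t : ℝ) / 2 ≤ 1 / 2 := by linarith [t.2.2]
      rw [hκe, hk₁]
      simp only
      rw [hk, hκe, Path.trans_apply, dif_pos ht]
      congr 2
      apply Subtype.ext
      simp only
      ring)
    have h2 := sub_eq_sub_of_exp_eq_exp (hκ γ') (k' := k₂) (by fun_prop) (fun t => by
      rw [hκe, hk₂]
      simp only
      rw [hk, hκe, Path.trans_apply]
      split_ifs with ht
      · have ht0 : t = 0 := Subtype.ext (le_antisymm (by simp only at ht; simp; linarith) t.2.1)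
        subst ht0
        have : (⟨2 * ((1 + ((0 : I) : ℝ)) / 2), by norm_num⟩ : I) = 1 := Subtype.ext (by norm_num)
        simp only [this, γ.target, γ'.source]
      · congr 2
        apply Subtype.ext
        simp only
        ring)
    rw [h1, h2]
    have a0 : k₁ 0 = k 0 := by
      simp only [hk₁]; congr 1; apply Subtype.ext; norm_num
    have a1 : k₁ 1 = k₂ 0 := by
      simp only [hk₁, hk₂]; congr 1; apply Subtype.ext; norm_num
    have a2 : k₂ 1 = k 1 := by
      simp only [hk₂]; congr 1; apply Subtype.ext; norm_num
    rw [a0, a1, a2]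
    ring
  · intro x y γ k hk hke
    exact sub_eq_sub_of_exp_eq_exp (hκ γ) hk (fun t => by rw [hκe, hke])

theorem isPathConnected_of_charts {T : Type*} [TopologicalSpace T] [PreconnectedSpace T]
    (hT : ∀ p : T, ∃ g : ℝ → T, IsChart (Ioo (-1) 1) g ∧ g 0 = p) (x y : T) : Joined x y := by
  refine isPreconnected_univ.induction₂ (P := Joined) ?_ (fun _ _ _ _ _ _ h h' => h.trans h')
    (fun _ _ _ _ h => h.symm) (mem_univ x) (mem_univ y)
  intro p _
  obtain ⟨g, hg, rfl⟩ := hT p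
  have ho := hg.isOpen_image univ isOpen_univ
  rw [inter_univ] at ho
  have h0 : g 0 ∈ g '' Ioo (-1) 1 := ⟨0, by norm_num, rfl⟩
  have hpc : IsPathConnected (g '' Ioo (-1) 1) :=
    ((convex_Ioo _ _).isPathConnected ⟨0, by norm_num⟩).image' hg.cont
  filter_upwards [mem_nhdsWithin_of_mem_nhds (ho.mem_nhds h0)] with q hq
  exact (hpc.joinedIn _ h0 _ hq).joined

theorem IsSurface.exists_path_surfaceBoundary [T2Space X] (hX : IsSurface X) {x y : X}
    (hx : x ∈ surfaceBoundary X) (hy : y ∈ connectedComponentIn (surfaceBoundary X) x) :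
    ∃ γ : Path x y, range γ ⊆ surfaceBoundary X := by
  set b := connectedComponentIn (surfaceBoundary X) x with hbdef
  have hxb : x ∈ b := mem_connectedComponentIn hx
  have : ConnectedSpace b := isConnected_iff_connectedSpace.1 (isConnected_connectedComponentIn_iff.2 hx)
  have hT : ∀ p : b, ∃ g : ℝ → b, IsChart (Ioo (-1) 1) g ∧ g 0 = p := by
    intro p
    obtain ⟨ψ, hψ, -⟩ := hX.exists_disc_of_mem_surfaceBoundary
      (connectedComponentIn_subset _ _ p.2) (univ_mem (α := X))
    obtain ⟨g, hg, h0, -⟩ := hψ.exists_boundary_chart p.2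
    exact ⟨g, hg, Subtype.ext h0⟩
  obtain ⟨γ⟩ := isPathConnected_of_charts hT ⟨x, hxb⟩ ⟨y, hy⟩
  refine ⟨γ.map continuous_subtype_val, ?_⟩
  rintro _ ⟨t, rfl⟩
  exact connectedComponentIn_subset _ _ (γ t).2

end

/-- The fundamental group of a compact surface is finitely generated. -/
theorem IsSurface.fg_fundamentalGroup {X : Type*} [MetricSpace X] [CompactSpace X]
    [PathConnectedSpace X] (hX : IsSurface X) (hl : IsLengthSpace X) (x : X) :
    Group.FG (FundamentalGroup X x) := by
  choose N hN _ _ hhom using fun p : X => hX.exists_nhds_homotopic p (univ_mem (f := 𝓝 p))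
  obtain ⟨ε, hε, hball⟩ := lebesgue_number_lemma_of_metric (c := fun p => interior (N p))
    isCompact_univ (fun _ => isOpen_interior)
    (fun p _ => mem_iUnion.2 ⟨p, mem_interior_iff_mem_nhds.2 (hN p)⟩)
  have hhom' : ∀ (a : X) {u v : X} (γ γ' : Path u v), range γ ⊆ ball a ε → range γ' ⊆ ball a ε →
      γ.Homotopic γ' := by
    intro a u v γ γ' h h'
    obtain ⟨p, hp⟩ := hball a (mem_univ a)
    exact hhom p u v γ γ' ((h.trans hp).trans interior_subset) ((h'.trans hp).trans interior_subset)
  obtain ⟨A, -, hAf, hA⟩ := finite_cover_balls_of_compact (isCompact_univ (X := X))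
    (show 0 < ε / 6 by positivity)
  have hnet : ∀ p, ∃ a ∈ A, ∃ γ : Path a p, range γ ⊆ ball a (ε / 6) := by
    intro p
    obtain ⟨a, ha, hp⟩ : ∃ a ∈ A, p ∈ ball a (ε / 6) := by simpa using hA (mem_univ p)
    obtain ⟨γ, hγ⟩ := hl.exists_path (mem_ball'.1 hp)
    exact ⟨a, ha, γ, range_subset_iff.2 fun t => mem_ball'.2 (hγ t)⟩
  choose a haA c hc using hnet
  have hP : ∀ a b : X, ∃ γ : Path a b, dist a b < 4 * (ε / 6) → range γ ⊆ ball a (4 * (ε / 6)) := by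
    intro a b
    by_cases h : dist a b < 4 * (ε / 6)
    · obtain ⟨γ, hγ⟩ := hl.exists_path h
      exact ⟨γ, fun _ => range_subset_iff.2 fun t => mem_ball'.2 (hγ t)⟩
    · exact ⟨PathConnectedSpace.somePath a b, fun h' => absurd h' h⟩
  choose P hPs using hP
  let T : ∀ b : X, Path.Homotopic.Quotient x b := fun b =>
    .mk (PathConnectedSpace.somePath x b)
  let G : X × X → FundamentalGroup X x := fun b =>
    ((T b.1).trans (.mk (P b.1 b.2))).trans (T b.2).symm
  let S : ∀ p : X, Path.Homotopic.Quotient x p := fun p => (T (a p)).trans (.mk (c p))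
  let H : Subgroup (FundamentalGroup X x) := Subgroup.closure (G '' (A ×ˢ A))
  let K : ∀ {p q : X}, Path p q → FundamentalGroup X x := fun {p q} γ =>
    ((S p).trans (.mk γ)).trans (S q).symm
  have key : ∀ {p q : X} (γ : Path p q), K γ ∈ H := by
    intro p q γ
    refine Path.induction_small (fun γ => K γ ∈ H) ?_ ?_ ?_ γ
    · intro p q γ γ' h hγ
      have : K γ = K γ' := by
        change ((S p).trans (.mk γ)).trans (S q).symm = ((S p).trans (.mk γ')).trans (S q).symm
        rw [Path.Homotopic.Quotient.eq.2 h]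
      rwa [← this]
    · intro p q r γ γ' h h'
      have : K (γ.trans γ') = K γ' * K γ := by
        rw [FundamentalGroup.mul_def]
        change ((S p).trans (.mk (γ.trans γ'))).trans (S r).symm =
          (((S p).trans (.mk γ)).trans (S q).symm).trans (((S q).trans (.mk γ')).trans (S r).symm)
        rw [Path.Homotopic.Quotient.mk_trans]
        simp only [Path.Homotopic.Quotient.trans_assoc]
        rw [← Path.Homotopic.Quotient.trans_assoc (S q).symm, Path.Homotopic.Quotient.symm_trans,
          Path.Homotopic.Quotient.refl_trans]
      rw [this]
      exact H.mul_mem h' h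
    · intro p₀
      refine ⟨ball p₀ (ε / 6), ball_mem_nhds _ (by positivity), ?_⟩
      intro p q γ hγ
      have hp : dist p p₀ < ε / 6 := hγ ⟨0, γ.source⟩
      have hq : dist q p₀ < ε / 6 := hγ ⟨1, γ.target⟩
      have hap : dist p (a p) < ε / 6 := hc p ⟨1, (c p).target⟩
      have haq : dist q (a q) < ε / 6 := hc q ⟨1, (c q).target⟩
      have hpq : dist p q < 2 * (ε / 6) := by linarith [dist_triangle_right p q p₀]
      have hab : dist (a p) (a q) < 4 * (ε / 6) := by
        linarith [dist_triangle4 (a p) p q (a q), dist_comm p (a p)]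
      have hh : (((c p).trans γ).trans (c q).symm).Homotopic (P (a p) (a q)) := by
        refine hhom' (a p) _ _ ?_ ((hPs _ _ hab).trans (ball_subset_ball (by linarith)))
        rw [Path.trans_range, Path.trans_range, Path.symm_range]
        refine union_subset (union_subset ?_ ?_) ?_
        · exact (hc p).trans (ball_subset_ball (by linarith))
        · refine hγ.trans (ball_subset_ball' ?_)
          linarith [dist_triangle_left p₀ (a p) p]
        · refine (hc q).trans (ball_subset_ball' ?_)
          linarith [dist_comm (a p) (a q)]
      have : K γ = G (a p, a q) := by
        change ((((T (a p)).trans (.mk (c p)))).trans (.mk γ)).trans ((T (a q)).trans (.mk (c q))).symm =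
          ((T (a p)).trans (.mk (P (a p) (a q)))).trans (T (a q)).symm
        rw [← Path.Homotopic.Quotient.eq.2 hh]
        have hs : ((T (a q)).trans (.mk (c q))).symm =
            (Path.Homotopic.Quotient.mk (c q)).symm.trans (T (a q)).symm := by
          change (Path.Homotopic.Quotient.mk _).symm = _
          rw [← Path.Homotopic.Quotient.mk_symm, Path.trans_symm, Path.Homotopic.Quotient.mk_trans]
          rfl
        rw [hs]
        simp only [Path.Homotopic.Quotient.mk_trans, Path.Homotopic.Quotient.mk_symm,
          Path.Homotopic.Quotient.trans_assoc]
      rw [this]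
      exact Subgroup.subset_closure ⟨_, ⟨haA p, haA q⟩, rfl⟩
  have htop : H = ⊤ := by
    rw [Subgroup.eq_top_iff']
    intro g
    let s : FundamentalGroup X x := S x
    have hconj : ∀ g : FundamentalGroup X x, s⁻¹ * g * s ∈ H := by
      intro g
      obtain ⟨γ, hγ⟩ := Quotient.exists_rep g
      have h1 : s⁻¹ * g * s = K γ := by
        rw [FundamentalGroup.mul_def, FundamentalGroup.mul_def, ← hγ]
        exact (Path.Homotopic.Quotient.trans_assoc (S x) (.mk γ) (S x).symm).symm
      rw [h1]
      exact key γ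
    have := hconj (s * g * s⁻¹)
    rwa [show s⁻¹ * (s * g * s⁻¹) * s = g by group] at this
  refine ⟨?_⟩
  rw [← htop]
  have hfin := (hAf.prod hAf).image G
  exact ⟨hfin.toFinset, by rw [hfin.coe_toFinset]⟩

theorem one_le_toNat_rank_of_fg {G : Type*} [Group G] [Group.FG G] (f : G →* Multiplicative ℂ)
    {g : G} (hg : f g ≠ 1) : 1 ≤ (Module.rank ℤ (Additive (Abelianization G))).toNat := by
  have hfg : Group.FG (Abelianization G) :=
    Group.fg_of_surjective (f := Abelianization.of) (QuotientGroup.mk_surjective)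
  have hfa : AddGroup.FG (Additive (Abelianization G)) := inferInstance
  have hfin : Module.Finite ℤ (Additive (Abelianization G)) := Module.Finite.iff_addGroup_fg.2 hfa
  by_contra hcon
  have h0 : Module.finrank ℤ (Additive (Abelianization G)) = 0 := by
    unfold Module.finrank
    omega
  rw [Module.finrank_eq_zero_iff] at h0
  obtain ⟨n, hn, hn0⟩ := h0 (Additive.ofMul (Abelianization.of g))
  let φ : Additive (Abelianization G) →+ ℂ := MonoidHom.toAdditiveLeft (Abelianization.lift f)
  have h1 : φ (Additive.ofMul (Abelianization.of g)) ≠ 0 := by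
    intro h
    apply hg
    have : Abelianization.lift f (Abelianization.of g) = f g := Abelianization.lift_apply_of f g
    rw [← this]
    exact h
  have h2 := congrArg φ hn0
  rw [map_zsmul, map_zero, smul_eq_zero] at h2
  exact h2.elim hn h1

theorem h1Rank_eq_toNat {X : Type*} [TopologicalSpace X] [PathConnectedSpace X] (x : X) :
    h1Rank X = (Module.rank ℤ (Additive (Abelianization (FundamentalGroup X x)))).toNat := by
  unfold h1Rank
  have : ∀ y : X, (Module.rank ℤ (Additive (Abelianization (FundamentalGroup X y)))).toNat =
      (Module.rank ℤ (Additive (Abelianization (FundamentalGroup X x)))).toNat := by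
    intro y
    let e := (FundamentalGroup.fundamentalGroupMulEquivOfPathConnected y x).abelianizationCongr
    exact congrArg _ (LinearEquiv.rank_eq (e.toAdditive.toIntLinearEquiv))
  have hne : Nonempty X := ⟨x⟩
  simp only [this]
  exact ciSup_const

/-- Two nearby points of a boundary component which are distinguished by a square root of a
function that is trivial near these points give rise to a non-trivial homology class. -/
theorem IsSurface.one_le_h1Rank {X : Type*} [MetricSpace X] [CompactSpace X] [ConnectedSpace X]
    (hX : IsSurface X) (hl : IsLengthSpace X) {F r : X → ℂ} (hF : Continuous F)
    (hF0 : ∀ q, F q ≠ 0) (hr : ContinuousOn r (surfaceBoundary X))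
    (hrF : ∀ q ∈ surfaceBoundary X, r q ^ 2 = F q) {u v : X} (hu : u ∈ surfaceBoundary X)
    (hv : v ∈ connectedComponentIn (surfaceBoundary X) u) {ρ : ℝ} (huv : dist u v < ρ)
    (hF1 : ∀ q, dist u q < ρ → F q = 1) (hru : r u = 1) (hrv : r v = -1) : 1 ≤ h1Rank X := by
  have hlpc := hX.locallyPathConnectedSpace
  have hpc : PathConnectedSpace X := pathConnectedSpace_iff_connectedSpace.2 inferInstance
  have hfg := hX.fg_fundamentalGroup hl u
  obtain ⟨ω, hω, hωk⟩ := exists_log_change hF hF0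
  obtain ⟨α, hα⟩ := hX.exists_path_surfaceBoundary hu hv
  obtain ⟨β, hβ⟩ := hl.exists_path huv
  have hb : ω (Path.Homotopic.Quotient.mk β) = 0 := by
    rw [hωk β (fun _ => 0) continuous_const (fun t => by rw [Complex.exp_zero, hF1 _ (hβ t)])]
    simp
  have ha : ω (Path.Homotopic.Quotient.mk α) ≠ 0 := by
    obtain ⟨k, hk, hke⟩ := α.exists_log (hr.mono hα) (fun q hq h0 => by
      have := hrF q (hα hq)
      rw [h0] at this
      exact hF0 q (by rw [← this]; norm_num))
    rw [hωk α (fun t => 2 * k t) (by fun_prop) (fun t => by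
      rw [← hrF _ (hα (mem_range_self t)), ← hke, ← Complex.exp_nat_mul]
      norm_num)]
    intro h
    have h1 : k 1 = k 0 := by linear_combination h / 2
    have h2 := hke 1
    rw [h1, hke 0, α.source, α.target, hru, hrv] at h2
    norm_num at h2
  have hmul : ∀ p q : FundamentalGroup X u, ω (x := u) (y := u) (p * q) = ω (x := u) (y := u) p + ω (x := u) (y := u) q := by
    intro p q
    rw [FundamentalGroup.mul_def, add_comm]
    exact hω _ _
  let f : FundamentalGroup X u →* Multiplicative ℂ :=
    MonoidHom.mk' (fun p => Multiplicative.ofAdd (ω (x := u) (y := u) p)) (fun p q => by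
      rw [hmul, ofAdd_add])
  rw [h1Rank_eq_toNat u]
  refine one_le_toNat_rank_of_fg f (g := (Path.Homotopic.Quotient.mk (α.trans β.symm) :
    Path.Homotopic.Quotient u u)) ?_
  intro h
  have h1 : ω (Path.Homotopic.Quotient.mk (α.trans β.symm)) = 0 := h
  have h2 : ω (Path.Homotopic.Quotient.mk β.symm) = 0 := by
    rw [hωk β.symm (fun _ => 0) continuous_const (fun t => by
      rw [Complex.exp_zero]
      exact (hF1 _ (hβ _)).symm)]
    simp
  rw [Path.Homotopic.Quotient.mk_trans, hω, h2, add_zero] at h1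
  exact ha h1

/-- A continuous nowhere vanishing function with a square root on the boundary, where the square root takes
opposite values at the boundary points `u` and `v` and the function is constant on the ball of radius `ρ`
around `u` containing `v`. -/
def HasSignChange (X : Type*) [MetricSpace X] (ρ : ℝ) : Prop :=
  ∃ (F r : X → ℂ) (u v : X), Continuous F ∧ (∀ q, F q ≠ 0) ∧ ContinuousOn r (surfaceBoundary X) ∧
    (∀ q ∈ surfaceBoundary X, r q ^ 2 = F q) ∧ u ∈ surfaceBoundary X ∧ v ∈ surfaceBoundary X ∧
    dist u v < ρ ∧ (∀ q, dist u q < ρ → F q = 1) ∧ r u = 1 ∧ r v = -1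

theorem nonempty_surfaceBoundary_of_ncard_pos {X : Type*} [TopologicalSpace X]
    (h : 0 < (surfaceBoundaryComponents X).ncard) : (surfaceBoundary X).Nonempty :=
  let ⟨_, p, hp, _⟩ := nonempty_of_ncard_ne_zero h.ne'
  ⟨p, hp⟩

theorem h1Rank_eq_of_redConnNum {X : Type*} [TopologicalSpace X] {c : ℤ} {q : ℕ} (hq : 0 < q)
    (hn : (surfaceBoundaryComponents X).ncard = q) (hc : redConnNum X = c) :
    (h1Rank X : ℤ) = c + q - 1 := by
  have hne := nonempty_surfaceBoundary_of_ncard_pos (hn ▸ hq)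
  rw [redConnNum, connNum, if_neg (fun h => hne.ne_empty h.1), hn] at hc
  push_cast at hc
  linarith

theorem exists_isNonContractibleJordanCurve_of_hasSignChange {c : ℤ} {q : ℕ} (hq : 0 < q)
    {Xs : ℕ → Type} [∀ n, MetricSpace (Xs n)]
    (hsurf : ∀ n, IsCompactSurface (Xs n)) (hlen : ∀ n, IsLengthSpace (Xs n))
    (hnb : ∀ n, (surfaceBoundaryComponents (Xs n)).ncard = q) (hrc : ∀ n, redConnNum (Xs n) = c)
    {D : ℕ → Type} [∀ n, MetricSpace (D n)] {ip im : ∀ n, Xs n → D n}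
    (hdouble : ∀ n, IsMetricDouble (Xs n) (surfaceBoundary (Xs n)) (D n) (ip n) (im n))
    {m : ℕ} {ρ : ℝ} (h : HasSignChange (Xs m) ρ) (k : ℕ) :
    ∃ J : Set (D k), IsNonContractibleJordanCurve J := by
  obtain ⟨_, _, _, hXk⟩ := hsurf k
  obtain ⟨_, _, _, hXm⟩ := hsurf m
  rcases le_or_gt 2 q with h2 | h2
  · exact (hdouble k).exists_isNonContractibleJordanCurve_of_two_le_ncard hXk (hlen k) (by rwa [hnb k])
  · obtain ⟨F, r, u, v, hF, hF0, hr, hrF, hu, hv, huv, hF1, hru, hrv⟩ := h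
    have hv' : v ∈ connectedComponentIn (surfaceBoundary (Xs m)) u := by
      obtain ⟨b, hb⟩ := ncard_eq_one.1 (show (surfaceBoundaryComponents (Xs m)).ncard = 1 by rw [hnb m]; omega)
      have h1 : connectedComponentIn (surfaceBoundary (Xs m)) u ∈ ({b} : Set (Set (Xs m))) := by
        rw [← hb]; exact ⟨u, hu, rfl⟩
      have h2 : connectedComponentIn (surfaceBoundary (Xs m)) v ∈ ({b} : Set (Set (Xs m))) := by
        rw [← hb]; exact ⟨v, hv, rfl⟩
      rw [mem_singleton_iff] at h1 h2
      rw [h1, ← h2]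
      exact mem_connectedComponentIn hv
    have hm := hXm.one_le_h1Rank (hlen m) hF hF0 hr hrF hu hv' huv hF1 hru hrv
    have e1 := h1Rank_eq_of_redConnNum hq (hnb m) (hrc m)
    have e2 := h1Rank_eq_of_redConnNum hq (hnb k) (hrc k)
    obtain ⟨J, hJ⟩ := hXk.exists_isNonContractibleJordanCurve (by omega)
    exact ⟨_, (hdouble k).isNonContractibleJordanCurve_image
      (nonempty_surfaceBoundary_of_ncard_pos (by rw [hnb k]; exact hq)) isClosed_surfaceBoundary hJ⟩

/-- In a regular sequence, sign changes cannot occur at arbitrarily small scales. -/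
theorem RegularDoubleSeq.exists_le_of_hasSignChange {c : ℤ} {q : ℕ} (hq : 0 < q)
    {Xs : ℕ → Type} [∀ n, MetricSpace (Xs n)]
    (hsurf : ∀ n, IsCompactSurface (Xs n)) (hlen : ∀ n, IsLengthSpace (Xs n))
    (hnb : ∀ n, (surfaceBoundaryComponents (Xs n)).ncard = q) (hrc : ∀ n, redConnNum (Xs n) = c)
    {D : ℕ → Type} [∀ n, MetricSpace (D n)] {ip im : ∀ n, Xs n → D n}
    (hdouble : ∀ n, IsMetricDouble (Xs n) (surfaceBoundary (Xs n)) (D n) (ip n) (im n))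
    (hreg : RegularDoubleSeq D) :
    ∃ δ > 0, ∀ᶠ n in atTop, ∀ ρ, HasSignChange (Xs n) ρ → δ ≤ 2 * ρ := by
  by_cases H : ∃ m ρ, HasSignChange (Xs m) ρ
  · obtain ⟨m, ρ₀, hm⟩ := H
    obtain ⟨δ, hδ, hev⟩ := hreg.exists_le_diam fun k =>
      exists_isNonContractibleJordanCurve_of_hasSignChange hq hsurf hlen hnb hrc hdouble hm k
    refine ⟨δ, hδ, hev.mono fun n hn ρ hρ => ?_⟩
    obtain ⟨_, _, _, hXn⟩ := hsurf n
    obtain ⟨F, r, u, v, hF, hF0, hr, hrF, hu, hv, huv, hF1, hru, hrv⟩ := hρ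
    obtain ⟨J, hJ, hJd⟩ := (hdouble n).exists_isNonContractibleJordanCurve hXn (hlen n) hF hF0 hr hrF hu hv
      huv hF1 hru hrv
    exact (hn J hJ).trans hJd
  · exact ⟨1, one_pos, .of_forall fun n ρ h => (H ⟨n, ρ, h⟩).elim⟩

theorem eventually_approx_of_hausdorffEDist {Z : Type*} [MetricSpace Z] {A : ℕ → Set Z} {B : Set Z}
    (h : Tendsto (fun n => hausdorffEDist (A n) B) atTop (𝓝 0)) {η : ℝ} (hη : 0 < η) :
    ∀ᶠ n in atTop, (∀ a ∈ B, ∃ p ∈ A n, dist p a < η) ∧ ∀ p ∈ A n, ∃ a ∈ B, dist p a < η := by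
  filter_upwards [h.eventually_lt_const (ENNReal.ofReal_pos.2 hη)] with n hn
  constructor
  · intro a ha
    rw [hausdorffEDist_comm] at hn
    obtain ⟨p, hp, hd⟩ := exists_edist_lt_of_hausdorffEDist_lt ha hn
    exact ⟨p, hp, by rwa [dist_comm, ← edist_lt_ofReal]⟩
  · intro p hp
    obtain ⟨a, ha, hd⟩ := exists_edist_lt_of_hausdorffEDist_lt hp hn
    exact ⟨a, ha, by rwa [← edist_lt_ofReal]⟩

/-- Connected sets of the limit avoiding a point are shadowed by connected sets of the approximating length
spaces staying away from that point. -/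
theorem exists_isPreconnected_approx {Z : Type*} [MetricSpace Z] {Xs : ℕ → Type} [∀ n, MetricSpace (Xs n)]
    (hlen : ∀ n, IsLengthSpace (Xs n)) {e : ∀ n, Xs n → Z} (hiso : ∀ n, Isometry (e n)) {X C : Set Z}
    (hX : ∀ η > 0, ∀ᶠ n in atTop, ∀ a ∈ X, ∃ p, dist (e n p) a < η) (hC : IsPreconnected C) {x y z : Z}
    (hCX : C ⊆ X \ {z}) (hx : x ∈ C) (hy : y ∈ C) :
    ∃ δ > 0, ∀ᶠ n in atTop, ∀ p q, dist (e n p) x < δ → dist (e n q) y < δ →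
      ∃ S : Set (Xs n), IsPreconnected S ∧ p ∈ S ∧ q ∈ S ∧ ∀ s ∈ S, δ < dist (e n s) z := by
  refine hC.induction₂ (fun x y => ∃ δ > 0, ∀ᶠ n in atTop, ∀ p q, dist (e n p) x < δ → dist (e n q) y < δ →
      ∃ S : Set (Xs n), IsPreconnected S ∧ p ∈ S ∧ q ∈ S ∧ ∀ s ∈ S, δ < dist (e n s) z) ?_ ?_ ?_ hx hy
  · intro a ha
    obtain ⟨r, hr⟩ : ∃ r, dist a z = 8 * r := ⟨dist a z / 8, by ring⟩
    have hr0 : 0 < r := by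
      have := dist_pos.2 (hCX ha).2
      linarith
    filter_upwards [mem_nhdsWithin_of_mem_nhds (ball_mem_nhds a hr0)] with b hb
    refine ⟨r, hr0, .of_forall fun n p q hp hq => ?_⟩
    have h1 : dist p q < 3 * r := by
      rw [← (hiso n).dist_eq]
      have := dist_triangle4 (e n p) a b (e n q)
      rw [dist_comm b (e n q), dist_comm a b] at this
      rw [mem_ball] at hb
      linarith
    obtain ⟨S, hS, hSc, hpS, hqS⟩ := (hlen n).exists_isPreconnected h1
    refine ⟨S, hSc, hpS, hqS, fun s hs => ?_⟩
    have h2 := hS hs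
    rw [mem_ball, ← (hiso n).dist_eq] at h2
    have h3 := dist_triangle4 a (e n p) (e n s) z
    rw [dist_comm a (e n p), dist_comm (e n p) (e n s)] at h3
    linarith
  · rintro a b d ha hb hd ⟨δ, hδ, h1⟩ ⟨δ', hδ', h2⟩
    refine ⟨min δ δ', lt_min hδ hδ', ?_⟩
    filter_upwards [h1, h2, hX _ (lt_min hδ hδ')] with n h1 h2 h3 p q hp hq
    obtain ⟨m, hm⟩ := h3 b (hCX hb).1
    obtain ⟨S, hS, hpS, hmS, hSz⟩ := h1 p m (hp.trans_le (min_le_left _ _)) (hm.trans_le (min_le_left _ _))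
    obtain ⟨T, hT, hmT, hqT, hTz⟩ := h2 m q (hm.trans_le (min_le_right _ _)) (hq.trans_le (min_le_right _ _))
    refine ⟨S ∪ T, hS.union m hmS hmT hT, .inl hpS, .inr hqT, ?_⟩
    rintro s (hs | hs)
    · exact (min_le_left _ _).trans_lt (hSz s hs)
    · exact (min_le_right _ _).trans_lt (hTz s hs)
  · rintro a b ha hb ⟨δ, hδ, h1⟩
    refine ⟨δ, hδ, h1.mono fun n h p q hp hq => ?_⟩
    obtain ⟨S, hS, hpS, hmS, hSz⟩ := h q p hq hp
    exact ⟨S, hS, hmS, hpS, hSz⟩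

/-- If `z` separates `x` and `y` in the limit `B`, then connected subsets of the approximating sets joining
points close to `x` and `y` come close to `z`. -/
theorem exists_eventually_mem_near {Z : Type*} [MetricSpace Z] [CompactSpace Z] {A : ℕ → Set Z} {B : Set Z}
    (hB : IsClosed B) (hA : ∀ η > 0, ∀ᶠ n in atTop, ∀ p ∈ A n, ∃ a ∈ B, dist p a < η) {x y z : Z}
    (hx : x ∈ B) (hy : y ∈ B) (hsep : ∀ C ⊆ B \ {z}, IsPreconnected C → ¬ (x ∈ C ∧ y ∈ C)) {ε : ℝ}
    (hε : 0 < ε) (hxz : ε ≤ dist x z) (hyz : ε ≤ dist y z) :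
    ∃ η > 0, ∀ᶠ n in atTop, ∀ S ⊆ A n, IsPreconnected S → ∀ s ∈ S, ∀ t ∈ S, dist s x < η → dist t y < η →
      ∃ p ∈ S, dist p z < ε := by
  set Y : Set Z := B ∩ {p | ε / 2 ≤ dist p z}
  have hY : IsClosed Y := hB.inter (isClosed_le (by fun_prop) (by fun_prop))
  have hYc : CompactSpace Y := isCompact_iff_compactSpace.1 hY.isCompact
  have hxY : x ∈ Y := ⟨hx, by simp only [mem_ofPred_eq]; linarith⟩
  have hyY : y ∈ Y := ⟨hy, by simp only [mem_ofPred_eq]; linarith⟩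
  have hcomp : (⟨y, hyY⟩ : Y) ∉ connectedComponent (⟨x, hxY⟩ : Y) := by
    intro h
    refine hsep (Subtype.val '' connectedComponent (⟨x, hxY⟩ : Y)) ?_
      (isPreconnected_connectedComponent.image _ continuous_subtype_val.continuousOn)
      ⟨⟨_, mem_connectedComponent, rfl⟩, ⟨_, h, rfl⟩⟩
    rintro _ ⟨p, -, rfl⟩
    refine ⟨p.2.1, fun hp => ?_⟩
    have := p.2.2
    rw [mem_singleton_iff] at hp
    simp only [mem_ofPred_eq, hp, dist_self] at this
    linarith
  rw [connectedComponent_eq_iInter_isClopen] at hcomp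
  simp only [mem_iInter, not_forall] at hcomp
  obtain ⟨⟨U, hU, hxU⟩, hyU⟩ := hcomp
  obtain ⟨δ, hδ, hd⟩ := Disjoint.exists_thickenings
    (disjoint_image_of_injective Subtype.val_injective (disjoint_compl_right (a := U)))
    (hU.1.isCompact.image continuous_subtype_val)
    (hU.compl.1.isCompact.image continuous_subtype_val).isClosed
  refine ⟨min δ (ε / 2), lt_min hδ (half_pos hε), ?_⟩
  filter_upwards [hA _ (lt_min hδ (half_pos hε))] with n hn S hS hSc s hs t ht hsx hty
  by_contra! H
  obtain ⟨p, -, hp1, hp2⟩ := hSc _ _ isOpen_thickening isOpen_thickening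
    (show S ⊆ thickening δ (Subtype.val '' U) ∪ thickening δ (Subtype.val '' Uᶜ) from fun p hp => by
      obtain ⟨a, ha, hpa⟩ := hn p (hS hp)
      have haY : a ∈ Y := ⟨ha, by
        have h1 := H p hp
        have h2 := dist_triangle p a z
        have h3 := hpa.trans_le (min_le_right _ _)
        simp only [mem_ofPred_eq]
        linarith⟩
      have hpa' := hpa.trans_le (min_le_left _ _)
      by_cases haU : (⟨a, haY⟩ : Y) ∈ U
      · exact .inl (mem_thickening_iff.2 ⟨a, ⟨_, haU, rfl⟩, hpa'⟩)
      · exact .inr (mem_thickening_iff.2 ⟨a, ⟨_, haU, rfl⟩, hpa'⟩))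
    ⟨s, hs, mem_thickening_iff.2 ⟨x, ⟨_, hxU, rfl⟩, hsx.trans_le (min_le_left _ _)⟩⟩
    ⟨t, ht, mem_thickening_iff.2 ⟨y, ⟨_, hyU, rfl⟩, hty.trans_le (min_le_left _ _)⟩⟩
  exact hd.le_bot ⟨hp1, hp2⟩

/-- Approximations of a connected set have no large gaps. -/
theorem IsPreconnected.exists_dist_lt_of_approx {Z : Type*} [MetricSpace Z] {A K W : Set Z}
    (hK : IsPreconnected K) {η : ℝ} (hA : ∀ a ∈ K, ∃ p ∈ A, dist p a < η) {x y p q : Z} (hx : x ∈ K)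
    (hy : y ∈ K) (hp : p ∈ A) (hpW : p ∈ W) (hq : q ∈ A) (hqW : q ∉ W) (hpx : dist p x < η)
    (hqy : dist q y < η) : ∃ u ∈ A, u ∈ W ∧ ∃ v ∈ A, v ∉ W ∧ dist u v < 2 * η := by
  obtain ⟨k, -, h1, h2⟩ := hK _ _ isOpen_thickening isOpen_thickening
    (show K ⊆ thickening η (A ∩ W) ∪ thickening η (A \ W) from fun a ha => by
      obtain ⟨p, hp, hpa⟩ := hA a ha
      rw [dist_comm] at hpa
      by_cases hpW : p ∈ W
      · exact .inl (mem_thickening_iff.2 ⟨p, ⟨hp, hpW⟩, hpa⟩)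
      · exact .inr (mem_thickening_iff.2 ⟨p, ⟨hp, hpW⟩, hpa⟩))
    ⟨x, hx, mem_thickening_iff.2 ⟨p, ⟨hp, hpW⟩, by rwa [dist_comm]⟩⟩
    ⟨y, hy, mem_thickening_iff.2 ⟨q, ⟨hq, hqW⟩, by rwa [dist_comm]⟩⟩
  obtain ⟨u, ⟨hu, huW⟩, hku⟩ := mem_thickening_iff.1 h1
  obtain ⟨v, ⟨hv, hvW⟩, hkv⟩ := mem_thickening_iff.1 h2
  refine ⟨u, hu, huW, v, hv, hvW, ?_⟩
  have := dist_triangle_left u v k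
  linarith

theorem hasSignChange_of_not_mem_component {X : Type*} [MetricSpace X] (hX : IsSurface X) {p u v : X}
    (hu : u ∈ connectedComponentIn (surfaceBoundary X) p) (hv : v ∈ surfaceBoundary X)
    (hvp : v ∉ connectedComponentIn (surfaceBoundary X) p) {ρ : ℝ} (huv : dist u v < ρ) :
    HasSignChange X ρ := by
  classical
  set b := connectedComponentIn (surfaceBoundary X) p
  have hr2 : ∀ q ∈ surfaceBoundary X, (if q ∈ b then (1 : ℂ) else -1) ^ 2 = 1 := by
    intro q _
    split_ifs <;> norm_num
  refine ⟨fun _ => 1, fun q => if q ∈ b then 1 else -1, u, v, continuous_const, by simp, ?_, hr2,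
    connectedComponentIn_subset _ _ hu, hv, huv, by simp, if_pos hu, if_neg hvp⟩
  refine continuousOn_of_eq_on_components hX fun p' hp q hq => ?_
  have : q ∈ b ↔ p' ∈ b := by
    have e1 := connectedComponentIn_eq hq
    constructor
    · intro h
      rw [show b = _ from connectedComponentIn_eq h, ← e1]
      exact mem_connectedComponentIn hp
    · intro h
      rw [show b = _ from connectedComponentIn_eq h]
      exact hq
  simp only [this]

/-- A connected set joining two points of a boundary component far away from `z`, both of whose
complementary boundary arcs pass close to `z`, produces a sign change. -/
theorem IsSurface.hasSignChange {X Z : Type*} [MetricSpace X] [CompactSpace X] [MetricSpace Z]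
    (hX : IsSurface X) {e : X → Z} (he : Isometry e) {z : Z} {x y : X} {ε : ℝ}
    (hx : x ∈ surfaceBoundary X) (hy : y ∈ connectedComponentIn (surfaceBoundary X) x) (hxy : x ≠ y)
    {S : Set X} (hS : IsPreconnected S) (hxS : x ∈ S) (hyS : y ∈ S) (hSz : ∀ s ∈ S, 7 * ε < dist (e s) z)
    (hε : 0 < ε)
    (hz : ∀ T ⊆ surfaceBoundary X, IsPreconnected T → x ∈ T → y ∈ T → ∃ s ∈ T, dist (e s) z < ε) :
    HasSignChange X (5 * ε) := by
  have := hX.locallyPathConnectedSpace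
  have hG : IsOpen {p | 7 * ε < dist (e p) z} :=
    isOpen_lt continuous_const (he.continuous.dist continuous_const)
  set W := connectedComponentIn {p | 7 * ε < dist (e p) z} x
  have hW : IsOpen W := hG.connectedComponentIn
  have hSW : S ⊆ W := hS.subset_connectedComponentIn hxS hSz
  have hWz : ∀ q ∈ W, 7 * ε < dist (e q) z := fun q hq =>
    connectedComponentIn_subset {p | 7 * ε < dist (e p) z} x hq
  obtain ⟨P, Q, F, r, hP, hQ, hxP, hxQ, hyP, hyQ, hu, hi, hF, hF0, hF1, hr, hrF, hr1, hr2⟩ :=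
    exists_dual_function hX hx hy hxy (hW.sdiff isClosed_surfaceBoundary)
      (hX.isPreconnected_diff_surfaceBoundary hW isPreconnected_connectedComponentIn) (fun q hq => hq.2)
      (hW.mem_nhds (hSW hxS)) (hW.mem_nhds (hSW hyS)) subset_rfl sdiff_subset
  have hPB : P ⊆ surfaceBoundary X :=
    subset_union_left.trans (hu.subset.trans (connectedComponentIn_subset _ _))
  have hQB : Q ⊆ surfaceBoundary X :=
    subset_union_right.trans (hu.subset.trans (connectedComponentIn_subset _ _))
  obtain ⟨p, hp, hpz⟩ := hz P hPB hP hxP hyP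
  obtain ⟨q, hq, hqz⟩ := hz Q hQB hQ hxQ hyQ
  have hpq : dist p q < 2 * ε := by
    rw [← he.dist_eq]
    have := dist_triangle_right (e p) (e q) z
    linarith
  have hqW : q ∉ W := fun h => by
    have := hWz q h
    linarith
  have hqP : q ∉ P := by
    intro hqP
    have : q ∈ ({x, y} : Set X) := by rw [← hi]; exact ⟨hqP, hq⟩
    rcases this with rfl | rfl
    exacts [hqW (hSW hxS), hqW (hSW hyS)]
  have hpW : ∀ w, dist p w < 5 * ε → w ∉ W := fun w hw h => by
    have h1 := hWz w h
    rw [← he.dist_eq, dist_comm] at hw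
    have := dist_triangle (e w) (e p) z
    linarith
  exact ⟨F, r, p, q, hF, hF0, hr, hrF, hPB hp, hQB hq, by linarith, fun w hw => hF1 w (hpW w hw),
    hr1 p hp (hpW p (by rw [dist_self]; linarith)), hr2 q (hQB hq) hqP hqW⟩

/-! ## STATEMENT 15 -/

theorem stmt15 (c : ℤ) (q : ℕ) (hq : 0 < q)
    (Xs : ℕ → Type) [∀ n, MetricSpace (Xs n)]
    (hsurf : ∀ n, IsCompactSurface (Xs n)) (hlen : ∀ n, IsLengthSpace (Xs n))
    (hnb : ∀ n, (surfaceBoundaryComponents (Xs n)).ncard = q)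
    (hrc : ∀ n, redConnNum (Xs n) = c)
    (D : ℕ → Type) [∀ n, MetricSpace (D n)]
    (ip im : ∀ n, Xs n → D n)
    (hdouble : ∀ n, IsMetricDouble (Xs n) (surfaceBoundary (Xs n)) (D n) (ip n) (im n))
    (hreg : RegularDoubleSeq D)
    (Z : Type) [MetricSpace Z] [CompactSpace Z]
    (e : ∀ n, Xs n → Z) (hiso : ∀ n, Isometry (e n))
    (X : Set Z) (hXcl : IsClosed X) (hXne : X.Nonempty)
    (hconv : Filter.Tendsto (fun n => EMetric.hausdorffEdist (Set.range (e n)) X)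
      Filter.atTop (nhds 0))
    (Binf : Set Z) (hBcl : IsClosed Binf) (hBsub : Binf ⊆ X)
    (hBconv : Filter.Tendsto
      (fun n => EMetric.hausdorffEdist (e n '' surfaceBoundary (Xs n)) Binf)
      Filter.atTop (nhds 0))
    (bcomp : Set Z) (hbc : ∃ z ∈ Binf, bcomp = connectedComponentIn Binf z)
    (x y z : Z) (hsep : SeparatesIn bcomp z x y) :
    SeparatesIn X z x y := by
  have hsub : bcomp ⊆ Binf := by
    obtain ⟨w, -, rfl⟩ := hbc
    exact connectedComponentIn_subset _ _
  have hpre : IsPreconnected bcomp := by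
    obtain ⟨w, -, rfl⟩ := hbc
    exact isPreconnected_connectedComponentIn
  obtain ⟨hx, hy, hsep⟩ := hsep
  refine ⟨⟨hBsub (hsub hx.1), hx.2⟩, ⟨hBsub (hsub hy.1), hy.2⟩, fun C hCX hC ⟨hxC, hyC⟩ => ?_⟩
  have hsepB : ∀ C ⊆ Binf \ {z}, IsPreconnected C → ¬ (x ∈ C ∧ y ∈ C) := by
    rintro C hCB hC ⟨hxC, hyC⟩
    refine hsep C (fun p hp => ⟨?_, (hCB hp).2⟩) hC ⟨hxC, hyC⟩
    obtain ⟨w, -, rfl⟩ := hbc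
    rw [connectedComponentIn_eq hx.1]
    exact hC.subset_connectedComponentIn hxC (fun p hp => (hCB hp).1) hp
  have hxy : x ≠ y := by
    rintro rfl
    exact hsep {x} (singleton_subset_iff.2 hx) isPreconnected_singleton ⟨rfl, rfl⟩
  have hXa : ∀ η > 0, ∀ᶠ n in atTop, ∀ a ∈ X, ∃ p, dist (e n p) a < η := fun η hη =>
    (eventually_approx_of_hausdorffEDist hconv hη).mono fun n h a ha => by
      obtain ⟨_, ⟨p, rfl⟩, hp⟩ := h.1 a ha
      exact ⟨p, hp⟩
  have hBa := fun η (hη : (0 : ℝ) < η) => eventually_approx_of_hausdorffEDist hBconv hη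
  obtain ⟨δ₁, hδ₁, hS⟩ := exists_isPreconnected_approx hlen hiso hXa hC hCX hxC hyC
  obtain ⟨δ₀, hδ₀, hno⟩ := hreg.exists_le_of_hasSignChange hq hsurf hlen hnb hrc hdouble
  have hxz : 0 < dist x z := dist_pos.2 hx.2
  have hyz : 0 < dist y z := dist_pos.2 hy.2
  obtain ⟨ε, hε, h1, h2, h3, h4⟩ : ∃ ε > 0, 7 * ε ≤ δ₁ ∧ 11 * ε ≤ δ₀ ∧ ε ≤ dist x z ∧ ε ≤ dist y z := by
    have h := min_le_left (min (δ₁ / 7) (δ₀ / 11)) (min (dist x z) (dist y z))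
    have h' := min_le_right (min (δ₁ / 7) (δ₀ / 11)) (min (dist x z) (dist y z))
    refine ⟨min (min (δ₁ / 7) (δ₀ / 11)) (min (dist x z) (dist y z)),
      lt_min (lt_min (by positivity) (by positivity)) (lt_min hxz hyz), ?_, ?_, ?_, ?_⟩
    · linarith [h.trans (min_le_left _ _)]
    · linarith [h.trans (min_le_right _ _)]
    · exact h'.trans (min_le_left _ _)
    · exact h'.trans (min_le_right _ _)
  obtain ⟨η, hη, hnear⟩ := exists_eventually_mem_near hBcl (fun η hη => (hBa η hη).mono fun _ h => h.2)
    (hsub hx.1) (hsub hy.1) hsepB hε h3 h4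
  have hd := dist_pos.2 hxy
  set κ := min (min δ₁ η) (min (δ₀ / 5) (dist x y / 2))
  have hκ : 0 < κ := lt_min (lt_min hδ₁ hη) (lt_min (by positivity) (by positivity))
  have hκ1 : κ ≤ δ₁ := (min_le_left _ _).trans (min_le_left _ _)
  have hκ2 : κ ≤ η := (min_le_left _ _).trans (min_le_right _ _)
  have hκ3 : κ ≤ δ₀ / 5 := (min_le_right _ _).trans (min_le_left _ _)
  have hκ4 : κ ≤ dist x y / 2 := (min_le_right _ _).trans (min_le_right _ _)
  obtain ⟨n, hSn, hnon, hnearn, hBn⟩ := (hS.and (hno.and (hnear.and (hBa κ hκ)))).exists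
  obtain ⟨_, _, _, hXn⟩ := hsurf n
  obtain ⟨_, ⟨p, hp, rfl⟩, hpx⟩ := hBn.1 x (hsub hx.1)
  obtain ⟨_, ⟨q', hq', rfl⟩, hqy⟩ := hBn.1 y (hsub hy.1)
  have hpq : p ≠ q' := by
    rintro rfl
    have := dist_triangle_left x y (e n p)
    linarith
  have hcomp : q' ∈ connectedComponentIn (surfaceBoundary (Xs n)) p := by
    by_contra hcomp
    obtain ⟨_, -, ⟨u, hu, rfl⟩, _, ⟨v, hv, rfl⟩, hvW, huv⟩ := hpre.exists_dist_lt_of_approx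
      (W := e n '' connectedComponentIn (surfaceBoundary (Xs n)) p)
      (fun a ha => hBn.1 a (hsub ha)) hx.1 hy.1 ⟨p, hp, rfl⟩ ⟨p, mem_connectedComponentIn hp, rfl⟩
      ⟨q', hq', rfl⟩ (fun ⟨w, hw, hwe⟩ => hcomp ((hiso n).injective hwe ▸ hw)) hpx hqy
    rw [(hiso n).dist_eq] at huv
    have := hnon _ (hasSignChange_of_not_mem_component hXn hu hv (fun h => hvW ⟨v, h, rfl⟩) huv)
    linarith
  obtain ⟨S, hSc, hpS, hqS, hSz⟩ := hSn p q' (hpx.trans_le hκ1) (hqy.trans_le hκ1)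
  have := hnon _ (hXn.hasSignChange (hiso n) hp hcomp hpq hSc hpS hqS (fun s hs => h1.trans_lt (hSz s hs)) hε
    fun T hT hTc hpT hqT => by
      obtain ⟨_, ⟨s, hs, rfl⟩, hsz⟩ := hnearn (e n '' T) (image_mono hT)
        (hTc.image _ (hiso n).continuous.continuousOn) _ ⟨p, hpT, rfl⟩ _ ⟨q', hqT, rfl⟩
        (hpx.trans_le hκ2) (hqy.trans_le hκ2)
      exact ⟨s, hs, hsz⟩)
  linarith
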